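/- arXiv:math/0209196 — 3 statements merged into one kernel-verified Lean document; each statement's English description precedes it below -/
import Mathlib

section
/- Let (T,m) be a complete Noetherian local domain and u, v ∈ T with ht (u,v)T = 2. For n ≥ 1, let M_n be the cokernel of the map T^{n+1} → T^n given by the n × (n+1) bidiagonal matrix A_n with (A_n)_{i,i} = u, (A_n)_{i,i+1} = v, and 0 elsewhere. Then ∩_{n ≥ 1} ann_T M_n = (0). -/
/-- The `n × (n+1)` bidiagonal matrix with `u` on the main diagonal and `v` on the
superdiagonal. -/
def bidiagMatrix {T : Type} [CommRing T] (u v : T) (n : ℕ) :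
    Matrix (Fin n) (Fin (n + 1)) T :=
  Matrix.of fun i j =>
    if (j : ℕ) = (i : ℕ) then u else if (j : ℕ) = (i : ℕ) + 1 then v else 0

/-- The cokernel `M_n` of the map `T^{n+1} → T^n` given by the bidiagonal matrix `A_n`. -/
abbrev bidiagCoker {T : Type} [CommRing T] (u v : T) (n : ℕ) :=
  (Fin n → T) ⧸ LinearMap.range (Matrix.mulVecLin (bidiagMatrix u v n))

/-- The height of an ideal: the infimum of the heights of the prime ideals containing it. -/
noncomputable def idealHeight {T : Type} [CommRing T] (I : Ideal T) : WithTop ℕ :=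
  ⨅ p ∈ { p : PrimeSpectrum T | I ≤ p.asIdeal }, Order.height p

open IsLocalRing in
theorem isArtinianRing_quotient_maximalIdeal_pow (R : Type*) [CommRing R] [IsLocalRing R]
    [IsNoetherianRing R] (s : ℕ) : IsArtinianRing (R ⧸ maximalIdeal R ^ s) := by
  rcases eq_or_ne s 0 with rfl | hs
  · have : Subsingleton (R ⧸ maximalIdeal R ^ 0) :=
      Ideal.Quotient.subsingleton_iff.mpr (by simp)
    infer_instance
  · refine quotient_artinian_of_mem_minimalPrimes_of_isLocalRing _ ⟨⟨inferInstance,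
      Ideal.pow_le_self hs⟩, fun q hq _ ↦ ?_⟩
    have := hq.1
    exact (Ideal.IsPrime.pow_le_iff hs).mp hq.2

open IsLocalRing in
theorem Ideal.iInf_sup_maximalIdeal_pow {R : Type*} [CommRing R] [IsLocalRing R]
    [IsNoetherianRing R] (I : Ideal R) : ⨅ s : ℕ, I ⊔ maximalIdeal R ^ s = I := by
  refine le_antisymm (fun x hx ↦ ?_) (le_iInf fun s ↦ le_sup_left)
  have h : Ideal.Quotient.mk I x ∈
      (⨅ s : ℕ, maximalIdeal R ^ s • ⊤ : Submodule R (R ⧸ I)) := by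
    refine (Submodule.mem_iInf _).mpr fun s ↦ ?_
    obtain ⟨y, hy, z, hz, rfl⟩ := Submodule.mem_sup.mp ((Submodule.mem_iInf _).mp hx s)
    have h : Ideal.Quotient.mk I (y + z) = z • (1 : R ⧸ I) := by
      rw [map_add, Ideal.Quotient.eq_zero_iff_mem.mpr hy, zero_add, Algebra.smul_def, mul_one]
      rfl
    rw [h]
    exact Submodule.smul_mem_smul hz Submodule.mem_top
  rw [Ideal.iInf_pow_smul_eq_bot_of_isLocalRing _ (maximalIdeal.isMaximal R).ne_top] at h
  exact Ideal.Quotient.eq_zero_iff_mem.mp h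

open IsLocalRing in
/-- **Chevalley's theorem**: in a complete Noetherian local ring, a decreasing sequence of ideals
with zero intersection is cofinal with the powers of the maximal ideal. -/
theorem exists_le_maximalIdeal_pow_of_antitone {R : Type*} [CommRing R] [IsLocalRing R]
    [IsNoetherianRing R] [IsAdicComplete (maximalIdeal R) R] {K : ℕ → Ideal R}
    (hK : Antitone K) (hbot : ⨅ n, K n = ⊥) (s : ℕ) : ∃ n, K n ≤ maximalIdeal R ^ s := by
  set m := maximalIdeal R
  let J (s : ℕ) : Ideal R := ⨅ n, K n ⊔ m ^ s
  have hJ (s : ℕ) : ∃ N, K N ≤ J s := by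
    have := isArtinianRing_quotient_maximalIdeal_pow R s
    obtain ⟨N, hN⟩ := IsArtinian.monotone_stabilizes (R := R ⧸ m ^ s) (M := R ⧸ m ^ s)
      ⟨fun n ↦ OrderDual.toDual ((K n).map (Ideal.Quotient.mk (m ^ s))),
        fun a b h ↦ Ideal.map_mono (hK h)⟩
    refine ⟨N, le_iInf fun n ↦ ?_⟩
    rcases le_total n N with h | h
    · exact (hK h).trans le_sup_left
    · have h' : (K N).map (Ideal.Quotient.mk (m ^ s)) = (K n).map (Ideal.Quotient.mk (m ^ s)) :=
        hN n h
      have h2 := Ideal.le_comap_map (f := Ideal.Quotient.mk (m ^ s)) (I := K N)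
      rwa [h', Ideal.comap_map_of_surjective _ Ideal.Quotient.mk_surjective,
        ← RingHom.ker_eq_comap_bot, Ideal.mk_ker] at h2
  obtain ⟨N, hN⟩ := hJ s
  refine ⟨N, fun x hx ↦ ?_⟩
  have step (k : ℕ) (y : J (s + k)) : ∃ z : J (s + (k + 1)), (y : R) - z ∈ m ^ (s + k) := by
    obtain ⟨n, hn⟩ := hJ (s + (k + 1))
    obtain ⟨a, ha, b, hb, hab⟩ := Submodule.mem_sup.mp ((Submodule.mem_iInf _).mp y.2 n)
    exact ⟨⟨a, hn ha⟩, by simpa [← hab] using hb⟩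
  choose g hg using step
  let y : (k : ℕ) → J (s + k) := fun k ↦ Nat.rec ⟨x, hN hx⟩ g k
  have hy (k l : ℕ) : (y k).1 - (y (k + l)).1 ∈ m ^ (s + k) := by
    induction l with
    | zero => simp
    | succ l ih =>
      have h := add_mem ih (Ideal.pow_le_pow_right (by omega) (hg (k + l) (y (k + l))))
      rwa [sub_add_sub_cancel] at h
  obtain ⟨L, hL⟩ := IsPrecomplete.prec (I := m) (M := R) inferInstance
    (f := fun k ↦ (y k).1) (fun {a b} h ↦ by
      obtain ⟨l, rfl⟩ := Nat.exists_eq_add_of_le h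
      rw [SModEq.sub_mem, smul_eq_mul, Ideal.mul_top]
      exact Ideal.pow_le_pow_right (Nat.le_add_left a s) (hy a l))
  simp only [SModEq.sub_mem, smul_eq_mul, Ideal.mul_top] at hL
  have hL0 : L = 0 := by
    rw [← Ideal.mem_bot, ← hbot]
    refine (Submodule.mem_iInf _).mpr fun n ↦ ?_
    rw [← (K n).iInf_sup_maximalIdeal_pow]
    refine (Submodule.mem_iInf _).mpr fun k ↦ ?_
    have hle : K n ⊔ m ^ (s + k) ≤ K n ⊔ m ^ k :=
      sup_le_sup_left (Ideal.pow_le_pow_right (Nat.le_add_left k s)) _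
    have h1 : (y k).1 ∈ K n ⊔ m ^ k :=
      hle ((Submodule.mem_iInf _).mp (y k).2 n)
    simpa using sub_mem h1 (Ideal.mem_sup_right (S := K n) (hL k))
  have h1 : (y s).1 ∈ m ^ s := by simpa [hL0] using hL s
  have h2 : x - (y s).1 ∈ m ^ s := by
    have h := hy 0 s
    rwa [zero_add] at h
  simpa using add_mem h2 h1

/-- The ideal of elements `a` such that `y ^ j` divides `a * x ^ j` for all `j ≤ n`. -/
def fractionPowIdeal {R : Type*} [CommRing R] (x y : R) (n : ℕ) : Ideal R :=
  ⨅ j ∈ Set.Iic n, Submodule.comap (LinearMap.mulRight R (x ^ j)) (Ideal.span {y ^ j})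

theorem mem_fractionPowIdeal {R : Type*} [CommRing R] {x y a : R} {n : ℕ} :
    a ∈ fractionPowIdeal x y n ↔ ∀ j ≤ n, y ^ j ∣ a * x ^ j := by
  simp [fractionPowIdeal, Submodule.mem_iInf, Ideal.mem_span_singleton]

theorem antitone_fractionPowIdeal {R : Type*} [CommRing R] (x y : R) :
    Antitone (fractionPowIdeal x y) := fun _ _ h _ ha ↦
  mem_fractionPowIdeal.mpr fun j hj ↦ mem_fractionPowIdeal.mp ha j (hj.trans h)

theorem exists_dvd_pow_of_forall_pow_dvd {R : Type*} [CommRing R] [IsDomain R]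
    [IsNoetherianRing R] {x y a : R} (ha : a ≠ 0) (h : ∀ j, y ^ j ∣ a * x ^ j) :
    ∃ n, y ∣ x ^ n := by
  choose b hb using h
  obtain ⟨n, hn⟩ := monotone_stabilizes_iff_noetherian.mpr ‹IsNoetherianRing R›
    ⟨fun n ↦ Ideal.span (b '' Set.Iio n), fun _ _ h ↦
      Ideal.span_mono (Set.image_mono (Set.Iio_subset_Iio h))⟩
  have hn' : Ideal.span (b '' Set.Iio n) = Ideal.span (b '' Set.Iio (n + 1)) := hn _ n.le_succ
  have hbn : b n ∈ Ideal.span (b '' Set.Iio n) :=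
    hn' ▸ Ideal.subset_span ⟨n, Nat.lt_succ_self n, rfl⟩
  have hle : Ideal.span (b '' Set.Iio n) ≤
      Submodule.comap (LinearMap.mulRight R (y ^ n)) (Ideal.span {a * y}) := by
    refine Ideal.span_le.mpr ?_
    rintro _ ⟨j, hj, rfl⟩
    obtain ⟨k, rfl⟩ := Nat.exists_eq_add_of_lt (Set.mem_Iio.mp hj)
    refine Ideal.mem_span_singleton.mpr ⟨y ^ k * x ^ j, ?_⟩
    rw [LinearMap.mulRight_apply]
    linear_combination (-y ^ (k + 1)) * hb j
  have h := Ideal.mem_span_singleton.mp (hle hbn)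
  rw [LinearMap.mulRight_apply, mul_comm (b n), ← hb n] at h
  exact ⟨n, (mul_dvd_mul_iff_left ha).mp h⟩

theorem idealHeight_span_pair_ne_two {R : Type} [CommRing R] [IsNoetherianRing R] {x y : R}
    {n : ℕ} (h : y ∣ x ^ n) : idealHeight (Ideal.span {x, y}) ≠ 2 := by
  intro h2
  have hne : Ideal.span {x, y} ≠ ⊤ := by
    intro htop
    have : idealHeight (Ideal.span {x, y}) = ⊤ := by
      refine iInf₂_eq_top.mpr fun p hp ↦ (p.2.ne_top ?_).elim
      exact top_le_iff.mp (htop ▸ hp)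
    rw [this] at h2
    exact absurd h2 (by simp)
  obtain ⟨p, hp⟩ := (Ideal.span {y}).nonempty_minimalPrimes
    (ne_top_of_le_ne_top hne (Ideal.span_mono (by simp)))
  have hprime := hp.isPrime
  have hy : y ∈ p := hp.1.2 (Ideal.mem_span_singleton_self y)
  have hx : x ∈ p := hprime.mem_of_pow_mem n (Ideal.mem_of_dvd p h hy)
  have h1 := Ideal.height_le_one_of_isPrincipal_of_mem_minimalPrimes _ p hp
  have h3 : idealHeight (Ideal.span {x, y}) ≤ Order.height (⟨p, hprime⟩ : PrimeSpectrum R) :=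
    iInf₂_le (⟨p, hprime⟩ : PrimeSpectrum R)
      (Ideal.span_le.mpr (by simp [Set.insert_subset_iff, hx, hy]))
  rw [← PrimeSpectrum.height_eq_orderHeight, h2] at h3
  have h4 : (2 : ℕ∞) ≤ 1 := h3.trans h1
  exact absurd h4 (by decide)

theorem iInf_fractionPowIdeal_eq_bot {R : Type} [CommRing R] [IsNoetherianRing R] [IsDomain R]
    {x y : R} (hht : idealHeight (Ideal.span {x, y}) = 2) :
    ⨅ n, fractionPowIdeal x y n = ⊥ := by
  refine eq_bot_iff.mpr fun a ha ↦ ?_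
  by_contra h0
  obtain ⟨n, hn⟩ := exists_dvd_pow_of_forall_pow_dvd (x := x) (y := y) h0 fun j ↦
    mem_fractionPowIdeal.mp ((Submodule.mem_iInf _).mp ha j) j le_rfl
  exact idealHeight_span_pair_ne_two hn hht

theorem bidiagMatrix_mulVec {T : Type} [CommRing T] (u v : T) (n : ℕ) (f : Fin (n + 1) → T)
    (i : Fin n) : (bidiagMatrix u v n).mulVec f i = u * f i.castSucc + v * f i.succ := by
  rw [Matrix.mulVec, dotProduct, Finset.sum_eq_add i.castSucc i.succ]
  · simp [bidiagMatrix]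
  · exact Fin.castSucc_lt_succ.ne
  · rintro c - ⟨h1, h2⟩
    have h3 : (c : ℕ) ≠ i := fun h ↦ h1 (Fin.ext h)
    have h4 : (c : ℕ) ≠ i + 1 := fun h ↦ h2 (Fin.ext h)
    simp [bidiagMatrix, h3, h4]
  · simp
  · simp

/-- An element killing `M_n` solves a two-term recurrence with a single source term at any
prescribed index. -/
theorem exists_recurrence_of_mem_annihilator {T : Type} [CommRing T] {u v t : T} {n : ℕ}
    (ht : t ∈ Module.annihilator T (bidiagCoker u v n)) (i : ℕ) :
    ∃ f : ℕ → T, ∀ k < n, u * f k + v * f (k + 1) = if k = i then t else 0 := by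
  have h := Module.mem_annihilator.mp ht
    (Submodule.Quotient.mk fun k : Fin n ↦ if (k : ℕ) = i then 1 else 0)
  rw [← Submodule.Quotient.mk_smul, Submodule.Quotient.mk_eq_zero] at h
  obtain ⟨f, hf⟩ := h
  refine ⟨fun k ↦ if hk : k < n + 1 then f ⟨k, hk⟩ else 0, fun k hk ↦ ?_⟩
  have h := congrFun hf ⟨k, hk⟩
  rw [Matrix.mulVecLin_apply, bidiagMatrix_mulVec] at h
  simpa [hk, Nat.lt_succ_of_lt hk] using h

theorem mem_fractionPowIdeal_of_recurrence {R : Type*} [CommRing R] {x y : R} {g : ℕ → R} {n : ℕ}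
    (h : ∀ j < n, x * g j + y * g (j + 1) = 0) : g 0 ∈ fractionPowIdeal x y n := by
  refine mem_fractionPowIdeal.mpr fun j hj ↦ ⟨(-1) ^ j * g j, ?_⟩
  induction j with
  | zero => simp
  | succ j ih =>
    linear_combination x * ih (by omega) + y ^ j * (-1) ^ j * h j (by omega)

theorem annihilator_bidiagCoker_le {T : Type} [CommRing T] (u v : T) (n : ℕ) :
    Module.annihilator T (bidiagCoker u v (2 * n + 1)) ≤
      fractionPowIdeal v u n ⊔ fractionPowIdeal u v n := by
  intro t ht
  obtain ⟨f, hf⟩ := exists_recurrence_of_mem_annihilator ht n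
  have h1 : f n ∈ fractionPowIdeal v u n :=
    mem_fractionPowIdeal_of_recurrence (g := fun j ↦ f (n - j)) fun j hj ↦ by
      have h := hf (n - (j + 1)) (by omega)
      rw [if_neg (by omega), show n - (j + 1) + 1 = n - j by omega] at h
      linear_combination h
  have h2 : f (n + 1) ∈ fractionPowIdeal u v n :=
    mem_fractionPowIdeal_of_recurrence (g := fun j ↦ f (n + 1 + j)) fun j hj ↦ by
      have h := hf (n + 1 + j) (by omega)
      rwa [if_neg (by omega)] at h
  have h := hf n (by omega)
  rw [if_pos rfl] at h
  rw [← h]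
  exact Submodule.add_mem_sup (Ideal.mul_mem_left _ _ h1) (Ideal.mul_mem_left _ _ h2)

/-- Let `(T, m)` be a complete Noetherian local domain and `u, v ∈ T` with
`ht (u,v)T = 2`.  For `n ≥ 1` let `M_n` be the cokernel of the map `T^{n+1} → T^n`
given by the bidiagonal matrix `A_n`.  Then `⋂_{n ≥ 1} ann_T M_n = (0)`. -/
theorem iInf_annihilator_bidiagCoker_eq_bot
    {T : Type} [CommRing T] [IsLocalRing T] [IsNoetherianRing T] [IsDomain T]
    [IsAdicComplete (IsLocalRing.maximalIdeal T) T]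
    (u v : T) (hht : idealHeight (Ideal.span {u, v}) = 2) :
    (⨅ n : ℕ, Module.annihilator T (bidiagCoker u v (n + 1))) = ⊥ := by
  refine eq_bot_iff.mpr ?_
  rw [← Ideal.iInf_pow_eq_bot_of_isLocalRing _ (IsLocalRing.maximalIdeal.isMaximal T).ne_top]
  refine le_iInf fun s ↦ ?_
  obtain ⟨a, ha⟩ := exists_le_maximalIdeal_pow_of_antitone (antitone_fractionPowIdeal u v)
    (iInf_fractionPowIdeal_eq_bot hht) s
  obtain ⟨b, hb⟩ := exists_le_maximalIdeal_pow_of_antitone (antitone_fractionPowIdeal v u)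
    (iInf_fractionPowIdeal_eq_bot (Set.pair_comm u v ▸ hht)) s
  refine (iInf_le _ (2 * max a b)).trans ((annihilator_bidiagCoker_le u v (max a b)).trans ?_)
  exact sup_le ((antitone_fractionPowIdeal v u (le_max_right a b)).trans hb)
    ((antitone_fractionPowIdeal u v (le_max_left a b)).trans ha)
end

section
/- Let (T,m) be a Noetherian local ring of dimension d ≥ 2, R = T[x_1,…,x_n] a polynomial ring over T, and I = (x_1,…,x_n)R. Let f ∈ R be a homogeneous element of degree p whose nonzero coefficients form a system of parameters for T. Then dim T/ann_T H^n_I(R/fR) ≥ 2. -/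
open MvPolynomial

section ExtClass

open CategoryTheory CategoryTheory.Limits Opposite

variable {R : Type} [CommRing R] {X X' : ModuleCat.{0} R}

noncomputable section

/-- The functor `Hom(-, Y)`, viewed as a covariant functor to the opposite category. -/
abbrev homOp (Y : ModuleCat.{0} R) : ModuleCat.{0} R ⥤ (ModuleCat.{0} R)ᵒᵖ :=
  ((linearYoneda R (ModuleCat.{0} R)).obj Y).rightOp

/-- The map `R → Hom(A, Y)` given by `φ`, viewed in the opposite category. -/
def spanOp {A : ModuleCat.{0} R} (Y : ModuleCat.{0} R) (φ : A ⟶ Y) :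
    (homOp Y).obj A ⟶ op (ModuleCat.of R R) :=
  (ModuleCat.ofHom (LinearMap.toSpanSingleton R (A ⟶ Y) φ)).op

lemma map_comp_spanOp {A B Y : ModuleCat.{0} R} (d : B ⟶ A) (φ : A ⟶ Y) :
    (homOp Y).map d ≫ spanOp Y φ = spanOp Y (d ≫ φ) := by
  apply Quiver.Hom.unop_inj
  apply ModuleCat.hom_ext
  apply LinearMap.ext_ring
  change d ≫ ((1 : R) • φ) = (1 : R) • (d ≫ φ)
  simp

lemma spanOp_zero {A Y : ModuleCat.{0} R} : spanOp Y (0 : A ⟶ Y) = 0 := by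
  apply Quiver.Hom.unop_inj
  apply ModuleCat.hom_ext
  apply LinearMap.ext_ring
  change (1 : R) • (0 : A ⟶ Y) = 0
  simp

/-- The complex `Hom(K, Y)` in the opposite category. -/
abbrev homOpComplex (K : ChainComplex (ModuleCat.{0} R) ℕ) (Y : ModuleCat.{0} R) :
    ChainComplex (ModuleCat.{0} R)ᵒᵖ ℕ :=
  ((homOp Y).mapHomologicalComplex _).obj K

lemma d_comp_spanOp {K : ChainComplex (ModuleCat.{0} R) ℕ} {Y : ModuleCat.{0} R} {n : ℕ}
    {φ : K.X n ⟶ Y} (hφ : K.d (n + 1) n ≫ φ = 0) :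
    (homOpComplex K Y).d (n + 1) n ≫ spanOp Y φ = 0 :=
  (map_comp_spanOp _ _).trans (by rw [hφ]; exact spanOp_zero)

/-- The map on homology induced by a map on cycles, in its dual form. -/
def homologyDesc {𝒜 : Type*} [Category 𝒜] [Abelian 𝒜] (L : ChainComplex 𝒜 ℕ) (n : ℕ) {Z : 𝒜}
    (a : L.X n ⟶ Z) (ha : L.d (n + 1) n ≫ a = 0) : L.homology n ⟶ Z :=
  L.homologyι n ≫ L.descOpcycles a (n + 1) (by simp) ha

lemma homologyMap_comp_homologyDesc {𝒜 : Type*} [Category 𝒜] [Abelian 𝒜] {L L' : ChainComplex 𝒜 ℕ}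
    {n : ℕ} {Z : 𝒜} {a : L.X n ⟶ Z} {ha : L.d (n + 1) n ≫ a = 0}
    {b : L'.X n ⟶ Z} {hb : L'.d (n + 1) n ≫ b = 0} (g : L' ⟶ L) (h : g.f n ≫ a = b) :
    HomologicalComplex.homologyMap g n ≫ homologyDesc L n a ha = homologyDesc L' n b hb := by
  subst h
  simp only [homologyDesc]
  rw [HomologicalComplex.homologyι_naturality_assoc,
    HomologicalComplex.opcyclesMap_comp_descOpcycles]

lemma homologyDesc_comp {𝒜 : Type*} [Category 𝒜] [Abelian 𝒜] {L : ChainComplex 𝒜 ℕ}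
    {n : ℕ} {Z Z' : 𝒜} {a : L.X n ⟶ Z} {ha : L.d (n + 1) n ≫ a = 0}
    {b : L.X n ⟶ Z'} {hb : L.d (n + 1) n ≫ b = 0} (m : Z ⟶ Z') (h : a ≫ m = b) :
    homologyDesc L n a ha ≫ m = homologyDesc L n b hb := by
  subst h
  simp only [homologyDesc, Category.assoc]
  congr 1
  rw [← cancel_epi (L.pOpcycles n)]
  simp

lemma exists_of_homologyDesc_eq_zero {𝒜 : Type*} [Category 𝒜] [Abelian 𝒜] {L : ChainComplex 𝒜 ℕ}
    {n : ℕ} {Z : 𝒜} [Injective Z] {a : L.X n ⟶ Z} {ha : L.d (n + 1) n ≫ a = 0}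
    (h : homologyDesc L n a ha = 0) {j : ℕ} (hj : (ComplexShape.down ℕ).next n = j) :
    ∃ ψ : L.X j ⟶ Z, L.d n j ≫ ψ = a := by
  have hex := (ShortComplex.exact_of_f_is_kernel
    (ShortComplex.mk _ _ (L.homologyι_comp_fromOpcycles n j)) (L.homologyIsKernel n j hj))
  obtain ⟨ψ, hψ⟩ : ∃ ψ : L.X j ⟶ Z,
      L.fromOpcycles n j ≫ ψ = L.descOpcycles a (n + 1) (by simp) ha :=
    ⟨_, hex.comp_descToInjective _ h⟩
  refine ⟨ψ, ?_⟩
  rw [← HomologicalComplex.p_fromOpcycles_assoc, hψ, HomologicalComplex.p_descOpcycles]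

/-- The homology class of a cocycle. -/
def homologyClass (K : ChainComplex (ModuleCat.{0} R) ℕ) (Y : ModuleCat.{0} R) (n : ℕ)
    (φ : K.X n ⟶ Y) (hφ : K.d (n + 1) n ≫ φ = 0) :
    (homOpComplex K Y).homology n ⟶ op (ModuleCat.of R R) :=
  homologyDesc (homOpComplex K Y) n (spanOp Y φ) (d_comp_spanOp hφ)

lemma homologyMap_comp_homologyClass {K K' : ChainComplex (ModuleCat.{0} R) ℕ}
    {Y Y' : ModuleCat.{0} R} {n : ℕ} {φ : K.X n ⟶ Y} {hφ : K.d (n + 1) n ≫ φ = 0}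
    {ψ : K'.X n ⟶ Y'} {hψ : K'.d (n + 1) n ≫ ψ = 0}
    (g : homOpComplex K' Y' ⟶ homOpComplex K Y) (h : g.f n ≫ spanOp Y φ = spanOp Y' ψ) :
    HomologicalComplex.homologyMap g n ≫ homologyClass K Y n φ hφ =
      homologyClass K' Y' n ψ hψ :=
  homologyMap_comp_homologyDesc g h

lemma exists_of_homologyClass_eq_zero {K : ChainComplex (ModuleCat.{0} R) ℕ} {Y : ModuleCat.{0} R}
    {n : ℕ} {φ : K.X n ⟶ Y} {hφ : K.d (n + 1) n ≫ φ = 0} (h : homologyClass K Y n φ hφ = 0)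
    {j : ℕ} (hj : (ComplexShape.down ℕ).next n = j) :
    ∃ ψ : K.X j ⟶ Y, K.d n j ≫ ψ = φ := by
  obtain ⟨ψ, hψ⟩ := exists_of_homologyDesc_eq_zero h hj
  have h3 := congr_arg (fun f => f.unop.hom (1 : R)) hψ
  exact ⟨ψ.unop.hom (1 : R), h3.trans (one_smul R φ)⟩

/-- `Ext` is computed by a projective resolution. -/
def homOpIso (P : ProjectiveResolution X) (Y : ModuleCat.{0} R) (n : ℕ) :
    ((homOp Y).leftDerived n).obj X ≅ (homOpComplex P.complex Y).homology n :=
  P.isoLeftDerivedObj (homOp Y) n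

/-- The class in `Ext` of a cocycle on a projective resolution, as a map from `R`. -/
def extClass (P : ProjectiveResolution X) (Y : ModuleCat.{0} R) (n : ℕ)
    (φ : P.complex.X n ⟶ Y) (hφ : P.complex.d (n + 1) n ≫ φ = 0) :
    ModuleCat.of R R ⟶ ((Ext R (ModuleCat.{0} R) n).obj (op X)).obj Y :=
  ((homOpIso P Y n).hom ≫ homologyClass P.complex Y n φ hφ).unop

lemma exists_of_extClass_eq_zero {P : ProjectiveResolution X} {Y : ModuleCat.{0} R}
    {n : ℕ} {φ : P.complex.X n ⟶ Y} {hφ : P.complex.d (n + 1) n ≫ φ = 0}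
    (h : extClass P Y n φ hφ = 0) {j : ℕ} (hj : (ComplexShape.down ℕ).next n = j) :
    ∃ ψ : P.complex.X j ⟶ Y, P.complex.d n j ≫ ψ = φ := by
  refine exists_of_homologyClass_eq_zero (hφ := hφ) ?_ hj
  rw [← cancel_epi (homOpIso P Y n).hom, comp_zero]
  exact Quiver.Hom.unop_inj h

lemma extClass_comp_map_left {P : ProjectiveResolution X} {P' : ProjectiveResolution X'}
    {Y : ModuleCat.{0} R} {n : ℕ} {φ : P.complex.X n ⟶ Y} (hφ : P.complex.d (n + 1) n ≫ φ = 0)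
    (f : X' ⟶ X) (g : P'.complex ⟶ P.complex) (hg : g.f 0 ≫ P.π.f 0 = P'.π.f 0 ≫ f) :
    extClass P Y n φ hφ ≫ ((Ext R (ModuleCat.{0} R) n).map f.op).app Y =
      extClass P' Y n (g.f n ≫ φ) (by rw [← g.comm_assoc, hφ, comp_zero]) := by
  apply Quiver.Hom.op_inj
  change ((homOp Y).leftDerived n).map f ≫
    (homOpIso P Y n).hom ≫ homologyClass P.complex Y n φ hφ =
    (homOpIso P' Y n).hom ≫ homologyClass P'.complex Y n _ _
  have key : ((homOp Y).leftDerived n).map f ≫ (homOpIso P Y n).hom =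
    (homOpIso P' Y n).hom ≫ HomologicalComplex.homologyMap
      (((homOp Y).mapHomologicalComplex _).map g) n :=
    ProjectiveResolution.isoLeftDerivedObj_hom_naturality f P' P g hg _ _
  rw [← Category.assoc, key, Category.assoc]
  congr 1
  exact homologyMap_comp_homologyClass _ (map_comp_spanOp _ _)

lemma smul_extClass {P : ProjectiveResolution X} {Y : ModuleCat.{0} R} {n : ℕ}
    {φ : P.complex.X n ⟶ Y} (hφ : P.complex.d (n + 1) n ≫ φ = 0) (r : R) :
    r • (extClass P Y n φ hφ).hom 1 =
      (extClass P Y n (r • φ) (by rw [Linear.comp_smul, hφ, smul_zero])).hom 1 := by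
  let m : ModuleCat.of R R ⟶ ModuleCat.of R R :=
    ModuleCat.ofHom (LinearMap.toSpanSingleton R R r)
  have h : m ≫ extClass P Y n φ hφ =
      extClass P Y n (r • φ) (by rw [Linear.comp_smul, hφ, smul_zero]) := by
    apply Quiver.Hom.op_inj
    change ((homOpIso P Y n).hom ≫ homologyClass P.complex Y n φ hφ) ≫ m.op =
      (homOpIso P Y n).hom ≫ homologyClass P.complex Y n _ _
    rw [Category.assoc]
    congr 1
    refine homologyDesc_comp m.op ?_
    apply Quiver.Hom.unop_inj
    apply ModuleCat.hom_ext
    apply LinearMap.ext_ring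
    change ((1 : R) • r) • φ = (1 : R) • r • φ
    simp
  rw [← h, ← map_smul]
  change _ = (extClass P Y n φ hφ).hom ((1 : R) • r)
  simp

lemma exists_map_app_eq_zero_of_colimit {D : Type} {𝒞 : Type*} [SmallCategory D] [IsFiltered D]
    [Category 𝒞] (F : D ⥤ 𝒞 ⥤ ModuleCat.{0} R) (Y : 𝒞) {i : D} (x : (F.obj i).obj Y)
    (hx : ((colimit.ι F i).app Y).hom x = 0) :
    ∃ (j : D) (f : i ⟶ j), ((F.map f).app Y).hom x = 0 := by
  have hc := isColimitOfPreserves ((evaluation 𝒞 (ModuleCat.{0} R)).obj Y) (colimit.isColimit F)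
  obtain ⟨j, f, g, h⟩ := Concrete.isColimit_exists_of_rep_eq
    (F ⋙ (evaluation 𝒞 (ModuleCat.{0} R)).obj Y) hc (i := i) (j := i) x 0
      (hx.trans (map_zero ((colimit.ι F i).app Y).hom).symm)
  exact ⟨j, f, h.trans (map_zero ((F.map g).app Y).hom)⟩

/-- If `t` annihilates local cohomology of `Y`, then a multiple by `t` of a cocycle becomes a
coboundary after passing to a higher power of the ideal. -/
lemma exists_coboundary_of_mem_annihilator_localCohomology {J : Ideal R} {n : ℕ}
    {Y : ModuleCat.{0} R} {t : R} (ht : t ∈ Module.annihilator R ((localCohomology J n).obj Y))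
    {K : ℕ} (P : ProjectiveResolution (ModuleCat.of R (R ⧸ J ^ K))) (φ : P.complex.X n ⟶ Y)
    (hφ : P.complex.d (n + 1) n ≫ φ = 0) {j : ℕ} (hj : (ComplexShape.down ℕ).next n = j) :
    ∃ (k : ℕ) (hk : J ^ k ≤ J ^ K) (P' : ProjectiveResolution (ModuleCat.of R (R ⧸ J ^ k)))
      (g : P'.complex ⟶ P.complex) (ψ : P'.complex.X j ⟶ Y),
      g.f 0 ≫ P.π.f 0 =
          P'.π.f 0 ≫ ModuleCat.ofHom (Submodule.mapQ (J ^ k) (J ^ K) LinearMap.id hk) ∧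
        P'.complex.d n j ≫ ψ = g.f n ≫ (t • φ) := by
  have hφ' : P.complex.d (n + 1) n ≫ (t • φ) = 0 := by rw [Linear.comp_smul, hφ, smul_zero]
  let F := localCohomology.diagram (localCohomology.idealPowersDiagram J) n
  have h0 : ((colimit.ι F (op (op K))).app Y).hom ((extClass P Y n (t • φ) hφ').hom 1) = 0 := by
    rw [← smul_extClass hφ t]
    exact (map_smul ((colimit.ι F (op (op K))).app Y).hom t ((extClass P Y n φ hφ).hom 1)).trans
      (Module.mem_annihilator.mp ht _)
  obtain ⟨⟨⟨k⟩⟩, f, hf⟩ := exists_map_app_eq_zero_of_colimit F Y _ h0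
  have hk : J ^ k ≤ J ^ K := Ideal.pow_le_pow_right (leOfHom f.unop.unop)
  let P' : ProjectiveResolution (ModuleCat.of R (R ⧸ J ^ k)) := ProjectiveResolution.of _
  let q : ModuleCat.of R (R ⧸ J ^ k) ⟶ ModuleCat.of R (R ⧸ J ^ K) :=
    ModuleCat.ofHom (Submodule.mapQ (J ^ k) (J ^ K) LinearMap.id hk)
  let g := ProjectiveResolution.lift q P' P
  have hg : g.f 0 ≫ P.π.f 0 = P'.π.f 0 ≫ q := ProjectiveResolution.lift_commutes_zero q P' P
  have hz : extClass P' Y n (g.f n ≫ (t • φ)) (by rw [← g.comm_assoc, hφ', comp_zero]) = 0 := by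
    rw [← extClass_comp_map_left hφ' q g hg]
    apply ModuleCat.hom_ext
    apply LinearMap.ext_ring
    exact hf
  obtain ⟨ψ, hψ⟩ := exists_of_extClass_eq_zero hz hj
  exact ⟨k, hk, P', g, ψ, hg, hψ⟩

end

end ExtClass

section Cochains

open CategoryTheory RingTheory.Sequence
open scoped Pointwise

variable {R : Type} [CommRing R]

/-- The differential of a chain complex of modules, as a linear map. -/
abbrev ChainComplex.dHom (G : ChainComplex (ModuleCat.{0} R) ℕ) (i : ℕ) :
    G.X (i + 1) →ₗ[R] G.X i :=
  (G.d (i + 1) i).hom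

lemma ChainComplex.dHom_comp_dHom (G : ChainComplex (ModuleCat.{0} R) ℕ) (i : ℕ) :
    G.dHom i ∘ₗ G.dHom (i + 1) = 0 := by
  have := congr_arg ModuleCat.Hom.hom (G.d_comp_d (i + 2) (i + 1) i)
  exact this

lemma ChainComplex.hom_comp_dHom {G F : ChainComplex (ModuleCat.{0} R) ℕ} (τ : G ⟶ F) (i : ℕ) :
    (τ.f i).hom ∘ₗ G.dHom i = F.dHom i ∘ₗ (τ.f (i + 1)).hom := by
  have := congr_arg ModuleCat.Hom.hom (τ.comm (i + 1) i)
  exact this.symm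

/-- A cochain on `G` with values in `M` is a coboundary. -/
def IsCoboundary (G : ChainComplex (ModuleCat.{0} R) ℕ) {M : Type} [AddCommGroup M] [Module R M] :
    (i : ℕ) → (G.X i →ₗ[R] M) → Prop
  | 0, z => z = 0
  | i + 1, z => ∃ h : G.X i →ₗ[R] M, h ∘ₗ G.dHom i = z

/-- Some power of `r` annihilates all cohomology of `Hom(G, M)`, uniformly in `M`. -/
def PowKillsCohomology (G : ChainComplex (ModuleCat.{0} R) ℕ) (r : R) : Prop :=
  ∃ N : ℕ, ∀ (M : Type) [AddCommGroup M] [Module R M] (i : ℕ) (z : G.X i →ₗ[R] M),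
    z ∘ₗ G.dHom i = 0 → IsCoboundary G i (r ^ N • z)

lemma exists_smul_of_mkQ_comp_eq_zero {P M : Type} [AddCommGroup P] [Module R P]
    [Module.Projective R P] [AddCommGroup M] [Module R M] {r : R} {g : P →ₗ[R] M}
    (hg : (r • (⊤ : Submodule R M)).mkQ ∘ₗ g = 0) : ∃ g' : P →ₗ[R] M, r • g' = g := by
  have hmem : ∀ y, g y ∈ LinearMap.range (LinearMap.lsmul R M r) := by
    intro y
    have h1 : (r • (⊤ : Submodule R M)).mkQ (g y) = 0 := LinearMap.congr_fun hg y
    rw [Submodule.mkQ_apply, Submodule.Quotient.mk_eq_zero,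
      Submodule.mem_smul_pointwise_iff_exists] at h1
    obtain ⟨b, -, hb⟩ := h1
    exact ⟨b, hb⟩
  obtain ⟨g', hg'⟩ := Module.projective_lifting_property (LinearMap.lsmul R M r).rangeRestrict
    (g.codRestrict _ hmem) (LinearMap.surjective_rangeRestrict _)
  refine ⟨g', LinearMap.ext fun y => ?_⟩
  exact congr_arg Subtype.val (LinearMap.congr_fun hg' y)

lemma IsCoboundary.exists_lift {G : ChainComplex (ModuleCat.{0} R) ℕ}
    [∀ i, Module.Projective R (G.X i)] {M M' : Type} [AddCommGroup M] [Module R M]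
    [AddCommGroup M'] [Module R M'] {q : M →ₗ[R] M'} (hq : Function.Surjective q) {i : ℕ}
    {z : G.X i →ₗ[R] M'} (hz : IsCoboundary G i z) :
    ∃ e : G.X i →ₗ[R] M, IsCoboundary G i e ∧ e ∘ₗ G.dHom i = 0 ∧ q ∘ₗ e = z := by
  cases i with
  | zero => exact ⟨0, rfl, LinearMap.zero_comp _, by rw [LinearMap.comp_zero, show z = 0 from hz]⟩
  | succ i =>
    obtain ⟨h, rfl⟩ := hz
    obtain ⟨h', rfl⟩ := Module.projective_lifting_property q h hq
    refine ⟨h' ∘ₗ G.dHom i, ⟨h', rfl⟩, ?_, rfl⟩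
    rw [LinearMap.comp_assoc, G.dHom_comp_dHom, LinearMap.comp_zero]

/-- Cocycles of degree less than the length of a weakly regular sequence are coboundaries. -/
lemma isCoboundary_of_isWeaklyRegular {G : ChainComplex (ModuleCat.{0} R) ℕ}
    [∀ i, Module.Projective R (G.X i)] (rs : List R) (hG : ∀ r ∈ rs, PowKillsCohomology G r)
    (M : Type) [AddCommGroup M] [Module R M] (hM : IsWeaklyRegular M rs) (i : ℕ)
    (hi : i < rs.length) (z : G.X i →ₗ[R] M) (hz : z ∘ₗ G.dHom i = 0) : IsCoboundary G i z := by
  induction rs generalizing M i with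
  | nil => simp at hi
  | cons r rs ih =>
    rw [isWeaklyRegular_cons_iff] at hM
    obtain ⟨hr, hrs⟩ := hM
    have hinj : ∀ {P : Type} [AddCommGroup P] [Module R P] {a b : P →ₗ[R] M},
        r • a = r • b → a = b := fun h =>
      LinearMap.ext fun y => hr (LinearMap.congr_fun h y)
    have step : ∀ z : G.X i →ₗ[R] M, z ∘ₗ G.dHom i = 0 → IsCoboundary G i (r • z) →
        IsCoboundary G i z := by
      intro z hz hc
      cases i with
      | zero =>
        refine hinj ?_
        rw [smul_zero]
        exact hc
      | succ k =>
        obtain ⟨h, hh⟩ := hc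
        have hcoc : ((r • (⊤ : Submodule R M)).mkQ ∘ₗ h) ∘ₗ G.dHom k = 0 := by
          rw [LinearMap.comp_assoc, hh]
          ext y
          simp only [LinearMap.comp_apply, LinearMap.smul_apply, LinearMap.zero_apply,
            Submodule.mkQ_apply, Submodule.Quotient.mk_eq_zero]
          exact Submodule.smul_mem_pointwise_smul _ _ _ trivial
        obtain ⟨e, -, he, hqe⟩ := (ih (fun s hs => hG s (List.mem_cons_of_mem _ hs)) _ hrs k
          (by simpa using hi) _ hcoc).exists_lift (Submodule.mkQ_surjective _)
        obtain ⟨h', hh'⟩ := exists_smul_of_mkQ_comp_eq_zero (r := r) (g := h - e)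
          (by rw [LinearMap.comp_sub, hqe, sub_self])
        refine ⟨h', hinj ?_⟩
        rw [← LinearMap.smul_comp, hh', LinearMap.sub_comp, he, sub_zero, hh]
    obtain ⟨N, hN⟩ := hG r List.mem_cons_self
    have hN' := hN M i z hz
    clear hN
    induction N with
    | zero => simpa using hN'
    | succ N ihN =>
      refine ihN (step _ ?_ ?_)
      · rw [LinearMap.smul_comp, hz, smul_zero]
      · rwa [smul_smul, ← pow_succ']

lemma exists_cocycle_of_isWeaklyRegular (rs : List R) {F : ChainComplex (ModuleCat.{0} R) ℕ}
    [∀ i, Module.Projective R (F.X i)] (A : Type) [AddCommGroup A] [Module R A]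
    (hA : IsWeaklyRegular A rs) (α : F.X 0 →ₗ[R] A)
    (hα : ∀ y, α (F.dHom 0 y) ∈ Ideal.ofList rs • (⊤ : Submodule R A)) :
    ∃ φ : F.X rs.length →ₗ[R] A, φ ∘ₗ F.dHom rs.length = 0 ∧
      ∀ (G : ChainComplex (ModuleCat.{0} R) ℕ) [∀ i, Module.Projective R (G.X i)]
        (_ : ∀ r ∈ rs, PowKillsCohomology G r) (τ : G ⟶ F) (M : Type) [AddCommGroup M]
        [Module R M] (_ : IsWeaklyRegular M rs) (Q : A →ₗ[R] M),
        IsCoboundary G rs.length (Q ∘ₗ φ ∘ₗ (τ.f rs.length).hom) →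
        ∀ y, Q (α ((τ.f 0).hom y)) ∈ Ideal.ofList rs • (⊤ : Submodule R M) := by
  induction rs generalizing A with
  | nil =>
    refine ⟨α, ?_, ?_⟩
    · ext y
      simpa using hα y
    · intro G _ _ τ M _ _ _ Q hc y
      have : Q ∘ₗ α ∘ₗ (τ.f 0).hom = 0 := hc
      have h2 : Q (α ((τ.f 0).hom y)) = 0 := LinearMap.congr_fun this y
      rw [h2]
      exact zero_mem _
  | cons r rs ih =>
    have hmem : ∀ (M : Type) [AddCommGroup M] [Module R M] (x : M),
        (r • (⊤ : Submodule R M)).mkQ x ∈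
          Ideal.ofList rs • (⊤ : Submodule R (QuotSMulTop r M)) ↔
        x ∈ Ideal.ofList (r :: rs) • (⊤ : Submodule R M) := by
      intro M _ _ x
      rw [Ideal.ofList_cons, Submodule.sup_smul, Submodule.ideal_span_singleton_smul]
      rw [← Submodule.mem_comap]
      rw [show (⊤ : Submodule R (QuotSMulTop r M)) =
        Submodule.map (r • (⊤ : Submodule R M)).mkQ ⊤ by
          rw [Submodule.map_top, Submodule.range_mkQ]]
      rw [← Submodule.map_smul'', Submodule.comap_map_mkQ]
    rw [isWeaklyRegular_cons_iff] at hA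
    obtain ⟨hr, hrs⟩ := hA
    obtain ⟨φ', hφ', H⟩ := ih (QuotSMulTop r A) hrs ((r • (⊤ : Submodule R A)).mkQ ∘ₗ α)
      (fun y => (hmem A _).2 (hα y))
    obtain ⟨ψ, hψ⟩ := Module.projective_lifting_property (r • (⊤ : Submodule R A)).mkQ φ'
      (Submodule.mkQ_surjective _)
    obtain ⟨φ, hφ⟩ := exists_smul_of_mkQ_comp_eq_zero (r := r) (g := ψ ∘ₗ F.dHom rs.length)
      (by rw [← LinearMap.comp_assoc, hψ]; exact hφ')
    have hφ0 : φ ∘ₗ F.dHom (rs.length + 1) = 0 := by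
      ext y
      apply hr
      have := LinearMap.congr_fun (congr_arg (· ∘ₗ F.dHom (rs.length + 1)) hφ) y
      simp only [LinearMap.comp_assoc, F.dHom_comp_dHom] at this
      simpa using this
    refine ⟨φ, hφ0, ?_⟩
    intro G _ hG τ M _ _ hM Q hc y
    have hM' := hM
    rw [isWeaklyRegular_cons_iff] at hM
    obtain ⟨h, hh⟩ := hc
    have hcomm := ChainComplex.hom_comp_dHom τ rs.length
    have hz : (Q ∘ₗ ψ ∘ₗ (τ.f rs.length).hom - r • h) ∘ₗ G.dHom rs.length = 0 := by
      rw [LinearMap.sub_comp, LinearMap.smul_comp, hh, sub_eq_zero, LinearMap.comp_assoc,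
        LinearMap.comp_assoc, hcomm, ← LinearMap.comp_assoc _ _ ψ, ← hφ, LinearMap.smul_comp,
        LinearMap.comp_smul]
      rfl
    have hcob := isCoboundary_of_isWeaklyRegular (r :: rs) hG M hM' rs.length (by simp) _ hz
    let Q' : QuotSMulTop r A →ₗ[R] QuotSMulTop r M :=
      Submodule.mapQ _ _ Q (by
        rw [← Submodule.map_le_iff_le_comap, Submodule.map_pointwise_smul]
        exact smul_mono_right r le_top)
    refine (hmem M _).1 (H G (fun s hs => hG s (List.mem_cons_of_mem _ hs)) τ (QuotSMulTop r M)
      hM.2 Q' ?_ y)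
    have : Q' ∘ₗ φ' ∘ₗ (τ.f rs.length).hom = (r • (⊤ : Submodule R M)).mkQ ∘ₗ
        (Q ∘ₗ ψ ∘ₗ (τ.f rs.length).hom - r • h) := by
      rw [← hψ]
      ext y
      simp only [LinearMap.comp_apply, LinearMap.sub_apply, map_sub, Q', Submodule.mapQ_apply,
        Submodule.mkQ_apply, LinearMap.smul_apply]
      rw [(Submodule.Quotient.mk_eq_zero (r • (⊤ : Submodule R M))).2
        (Submodule.smul_mem_pointwise_smul _ _ _ trivial), sub_zero]
    rw [this]
    generalize (Q ∘ₗ ψ ∘ₗ (τ.f rs.length).hom - r • h) = z at hcob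
    generalize rs.length = m at z hcob
    cases m with
    | zero =>
      rw [show z = 0 from hcob]
      exact LinearMap.comp_zero _
    | succ m =>
      obtain ⟨g, rfl⟩ := hcob
      exact ⟨(r • (⊤ : Submodule R M)).mkQ ∘ₗ g, LinearMap.comp_assoc _ _ _⟩

end Cochains

section Resolution

open CategoryTheory RingTheory.Sequence

variable {R : Type} [CommRing R]

lemma CategoryTheory.ProjectiveResolution.module_projective {X : ModuleCat.{0} R}
    (P : ProjectiveResolution X) (i : ℕ) : Module.Projective R (P.complex.X i) :=
  (IsProjective.iff_projective _).2 (P.projective i)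

lemma powKillsCohomology_of_pow_mem {𝔞 : Ideal R}
    (P : ProjectiveResolution (ModuleCat.of R (R ⧸ 𝔞))) {r : R} {N : ℕ} (hr : r ^ N ∈ 𝔞) :
    PowKillsCohomology P.complex r := by
  refine ⟨N, fun M _ _ i z hz => ?_⟩
  have h0 : (r ^ N • 𝟙 P.complex) ≫ P.π = 0 := by
    apply HomologicalComplex.to_single_hom_ext
    change (r ^ N • 𝟙 (P.complex.X 0)) ≫ P.π.f 0 = 0
    rw [Linear.smul_comp, Category.id_comp]
    apply ModuleCat.hom_ext
    apply LinearMap.ext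
    intro y
    change r ^ N • (show R ⧸ 𝔞 from (P.π.f 0).hom y) = 0
    generalize (show R ⧸ 𝔞 from (P.π.f 0).hom y) = w
    obtain ⟨w, rfl⟩ := Ideal.Quotient.mk_surjective w
    rw [← Ideal.Quotient.mk_eq_mk, ← Submodule.Quotient.mk_smul, Submodule.Quotient.mk_eq_zero]
    exact Ideal.mul_mem_right _ _ hr
  have H := (ProjectiveResolution.liftHomotopyZero (P := P) (Q := P) _ h0).comm i
  have hprev : prevD i (ProjectiveResolution.liftHomotopyZero (P := P) (Q := P) _ h0).hom ≫
      ModuleCat.ofHom z = 0 := by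
    rw [Homotopy.prevD_chainComplex, Category.assoc]
    convert Limits.comp_zero
    exact ModuleCat.hom_ext hz
  have H2 := congr_arg (· ≫ ModuleCat.ofHom z) H
  simp only [Preadditive.add_comp, hprev, HomologicalComplex.zero_f, add_zero] at H2
  have H3 : (r ^ N • 𝟙 P.complex : P.complex ⟶ P.complex).f i ≫ ModuleCat.ofHom z =
      ModuleCat.ofHom (r ^ N • z) := by
    change (r ^ N • 𝟙 (P.complex.X i)) ≫ _ = _
    rw [Linear.smul_comp, Category.id_comp]
    rfl
  rw [H3] at H2
  cases i with
  | zero =>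
    rw [Homotopy.dNext_zero_chainComplex, Limits.zero_comp] at H2
    exact congr_arg ModuleCat.Hom.hom H2
  | succ i =>
    rw [Homotopy.dNext_succ_chainComplex, Category.assoc] at H2
    exact ⟨_, congr_arg ModuleCat.Hom.hom H2.symm⟩

end Resolution

section AnnihilatorLocalCohomology

open CategoryTheory RingTheory.Sequence

variable {R : Type} [CommRing R]

lemma CategoryTheory.ProjectiveResolution.π_surjective {X : ModuleCat.{0} R}
    (P : ProjectiveResolution X) : Function.Surjective (P.π.f 0).hom :=
  (ModuleCat.epi_iff_surjective (P.π.f 0)).1 inferInstance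

/-- If `t` annihilates `Hⁿ_J(Y)` and `rs` is a sequence of length `n` in `J`, generating an ideal
containing a power of `J`, which is weakly regular on `R` and on `M`, then `t` maps the image of
any `Y → M` into `rs • M`. -/
lemma smul_mem_of_mem_annihilator_localCohomology {J : Ideal R} (rs : List R)
    {n : ℕ} (hn : rs.length = n)
    (hJ : ∀ r ∈ rs, r ∈ J) {K : ℕ} (hK : J ^ K ≤ Ideal.ofList rs) (hR : IsWeaklyRegular R rs)
    {Y : ModuleCat.{0} R} {t : R}
    (ht : t ∈ Module.annihilator R ((localCohomology J n).obj Y))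
    {M : Type} [AddCommGroup M] [Module R M] (hM : IsWeaklyRegular M rs) (Q : Y →ₗ[R] M) (x : Y) :
    t • Q x ∈ Ideal.ofList rs • (⊤ : Submodule R M) := by
  subst hn
  let P : ProjectiveResolution (ModuleCat.of R (R ⧸ J ^ K)) := ProjectiveResolution.of _
  have := P.module_projective
  let u : P.complex.X 0 →ₗ[R] R ⧸ J ^ K := (P.π.f 0).hom
  obtain ⟨α, hα⟩ := Module.projective_lifting_property (Ideal.ofList rs).mkQ
    (Submodule.mapQ (J ^ K) (Ideal.ofList rs) LinearMap.id hK ∘ₗ u) (Submodule.mkQ_surjective _)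
  have hα' : ∀ y, Submodule.Quotient.mk (α y) =
      Submodule.mapQ (J ^ K) (Ideal.ofList rs) LinearMap.id hK (u y) := LinearMap.congr_fun hα
  have hu : ∀ y, u (P.complex.dHom 0 y) = 0 := fun y => by
    have : P.complex.d 1 0 ≫ P.π.f 0 = 0 := P.complex_d_comp_π_f_zero
    exact LinearMap.congr_fun (congr_arg ModuleCat.Hom.hom this) y
  obtain ⟨φ, hφ, H⟩ := exists_cocycle_of_isWeaklyRegular rs R hR α (fun y => by
    rw [smul_eq_mul, Ideal.mul_top, ← Submodule.Quotient.mk_eq_zero, hα', hu, map_zero])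
  let π : R →ₗ[R] Y := LinearMap.toSpanSingleton R Y x
  obtain ⟨k, hk, P', g, ψ, hg, hψ⟩ := exists_coboundary_of_mem_annihilator_localCohomology ht P
    (ModuleCat.ofHom (π ∘ₗ φ)) (by
      apply ModuleCat.hom_ext
      change (π ∘ₗ φ) ∘ₗ P.complex.dHom rs.length = 0
      rw [LinearMap.comp_assoc, hφ, LinearMap.comp_zero]) rfl
  have := P'.module_projective
  have hψ' : ψ.hom ∘ₗ (P'.complex.d rs.length ((ComplexShape.down ℕ).next rs.length)).hom =
      t • (π ∘ₗ φ ∘ₗ (g.f rs.length).hom) := congr_arg ModuleCat.Hom.hom hψ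
  have hcob : IsCoboundary P'.complex rs.length ((t • Q ∘ₗ π) ∘ₗ φ ∘ₗ (g.f rs.length).hom) := by
    have h2 : (Q ∘ₗ ψ.hom) ∘ₗ
        (P'.complex.d rs.length ((ComplexShape.down ℕ).next rs.length)).hom =
        (t • Q ∘ₗ π) ∘ₗ φ ∘ₗ (g.f rs.length).hom := by
      rw [LinearMap.comp_assoc, hψ', LinearMap.comp_smul]
      rfl
    rw [← h2]
    clear hψ h2 hψ' H hφ
    generalize rs.length = m at ψ
    cases m with
    | zero =>
      rw [P'.complex.shape _ _ (by simp)]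
      exact LinearMap.comp_zero _
    | succ m =>
      have : (ComplexShape.down ℕ).next (m + 1) = m := ChainComplex.next_nat_succ _
      generalize (ComplexShape.down ℕ).next (m + 1) = m' at this ψ
      subst this
      exact ⟨_, rfl⟩
  have H' := H P'.complex (fun r hr => powKillsCohomology_of_pow_mem P' (N := k)
    (Ideal.pow_mem_pow (hJ r hr) k)) g M hM (t • Q ∘ₗ π) hcob
  obtain ⟨y, hy⟩ := P'.π_surjective (show R ⧸ J ^ k from Submodule.Quotient.mk 1)
  have hgy : u ((g.f 0).hom y) = Submodule.Quotient.mk 1 := by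
    have h3 : u ((g.f 0).hom y) = Submodule.mapQ (J ^ k) (J ^ K) LinearMap.id hk
        ((P'.π.f 0).hom y) := LinearMap.congr_fun (congr_arg ModuleCat.Hom.hom hg) y
    rw [h3, hy]
    rfl
  have h4 : α ((g.f 0).hom y) - 1 ∈ Ideal.ofList rs := by
    rw [← Submodule.Quotient.mk_eq_zero, Submodule.Quotient.mk_sub, hα', hgy, sub_eq_zero]
    rfl
  have h5 := Submodule.sub_mem _ (H' y) (Submodule.smul_mem_smul h4
    (Submodule.mem_top (x := t • Q x)))
  have h6 : (t • Q ∘ₗ π) (α ((g.f 0).hom y)) = α ((g.f 0).hom y) • t • Q x := by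
    simp [π, smul_comm t]
  rwa [h6, ← sub_smul, sub_sub_cancel, one_smul] at h5

end AnnihilatorLocalCohomology

section CoeffSubmodule

open RingTheory.Sequence

variable {σ T A : Type} [CommRing T] [CommRing A] [Algebra T A]
  [Module (MvPolynomial σ T) (MvPolynomial σ A)]

/-- The polynomials over `A` whose coefficients at exponents in `D` belong to `L`. -/
def coeffSubmodule
    (hs : ∀ (r : MvPolynomial σ T) (p : MvPolynomial σ A), r • p = map (algebraMap T A) r * p)
    (D : LowerSet (σ →₀ ℕ)) (L : Submodule T A) :
    Submodule (MvPolynomial σ T) (MvPolynomial σ A) where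
  carrier := {p | ∀ m ∈ D, coeff m p ∈ L}
  zero_mem' := by simp
  add_mem' {p q} hp hq := fun m hm => by
    rw [coeff_add]
    exact add_mem (hp m hm) (hq m hm)
  smul_mem' r p hp := fun m hm => by
    classical
    rw [hs, coeff_mul]
    refine Submodule.sum_mem _ fun x hx => ?_
    rw [coeff_map, ← Algebra.smul_def]
    refine Submodule.smul_mem _ _ (hp _ (D.lower ?_ hm))
    rw [← Finset.HasAntidiagonal.mem_antidiagonal.1 hx]
    exact le_add_self

/-- The exponents less than `c` at all places in `l`. -/
def boundedExponents (l : List σ) (c : ℕ) : LowerSet (σ →₀ ℕ) where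
  carrier := {m | ∀ j ∈ l, m j < c}
  lower' _ _ h hm := fun j hj => (h j).trans_lt (hm j hj)

lemma coeff_X_pow_smul_of_lt
    (hs : ∀ (r : MvPolynomial σ T) (p : MvPolynomial σ A), r • p = map (algebraMap T A) r * p)
    {j : σ} {c : ℕ} {m : σ →₀ ℕ} (h : m j < c)
    (q : MvPolynomial σ A) : coeff m ((X j ^ c : MvPolynomial σ T) • q) = 0 := by
  classical
  rw [hs, map_pow, map_X, X_pow_eq_monomial, coeff_monomial_mul', if_neg]
  intro hle
  have := hle j
  simp at this
  omega

lemma coeff_add_X_pow_smul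
    (hs : ∀ (r : MvPolynomial σ T) (p : MvPolynomial σ A), r • p = map (algebraMap T A) r * p)
    (j : σ) (c : ℕ) (m : σ →₀ ℕ)
    (q : MvPolynomial σ A) :
    coeff (m + Finsupp.single j c) ((X j ^ c : MvPolynomial σ T) • q) = coeff m q := by
  rw [hs, map_pow, map_X, X_pow_eq_monomial, add_comm, coeff_monomial_mul, one_mul]

lemma ofList_smul_sup_coeffSubmodule
    (hs : ∀ (r : MvPolynomial σ T) (p : MvPolynomial σ A), r • p = map (algebraMap T A) r * p)
    (l : List σ) (c : ℕ) (L : Submodule T A) :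
    Ideal.ofList (l.map fun j => (X j ^ c : MvPolynomial σ T)) •
        (⊤ : Submodule (MvPolynomial σ T) (MvPolynomial σ A)) ⊔ coeffSubmodule hs ⊤ L =
      coeffSubmodule hs (boundedExponents l c) L := by
  classical
  apply le_antisymm
  · refine sup_le (Submodule.smul_le.2 fun r hr q _ => ?_) fun p hp m _ => hp m trivial
    induction hr using Submodule.span_induction with
    | mem r hr =>
      obtain ⟨j, hj, rfl⟩ := List.mem_map.1 hr
      intro m hm
      rw [coeff_X_pow_smul_of_lt hs (hm j hj)]
      exact zero_mem _
    | zero => rw [zero_smul]; exact zero_mem _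
    | add a b _ _ ha hb => rw [add_smul]; exact add_mem ha hb
    | smul a b _ hb => rw [smul_assoc]; exact Submodule.smul_mem _ _ hb
  · intro p hp
    rw [p.as_sum]
    refine Submodule.sum_mem _ fun m _ => ?_
    by_cases hm : m ∈ boundedExponents l c
    · refine Submodule.mem_sup_right fun m' _ => ?_
      rw [coeff_monomial]
      split_ifs with h
      · exact hp m hm
      · exact zero_mem _
    · obtain ⟨j, hj, hjc⟩ : ∃ j ∈ l, c ≤ m j := by
        by_contra! h
        exact hm h
      refine Submodule.mem_sup_left ?_
      have : monomial m (coeff m p) =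
          (X j ^ c : MvPolynomial σ T) • monomial (m - Finsupp.single j c) (coeff m p) := by
        rw [hs, map_pow, map_X, X_pow_eq_monomial, monomial_mul, one_mul,
          add_tsub_cancel_of_le (by simpa using hjc)]
      rw [this]
      exact Submodule.smul_mem_smul (Ideal.subset_span (List.mem_map.2 ⟨j, hj, rfl⟩)) trivial

lemma mk_mem_ofList_smul_iff
    (hs : ∀ (r : MvPolynomial σ T) (p : MvPolynomial σ A), r • p = map (algebraMap T A) r * p)
    (l : List σ) (c : ℕ) (L : Submodule T A) (p : MvPolynomial σ A) :
    (Submodule.Quotient.mk p : MvPolynomial σ A ⧸ coeffSubmodule hs ⊤ L) ∈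
      Ideal.ofList (l.map fun j => (X j ^ c : MvPolynomial σ T)) •
        (⊤ : Submodule (MvPolynomial σ T) (MvPolynomial σ A ⧸ coeffSubmodule hs ⊤ L)) ↔
      ∀ m, (∀ j ∈ l, m j < c) → coeff m p ∈ L := by
  change _ ↔ p ∈ coeffSubmodule hs (boundedExponents l c) L
  rw [← ofList_smul_sup_coeffSubmodule hs l c L, ← Submodule.mkQ_apply, ← Submodule.mem_comap,
    show (⊤ : Submodule (MvPolynomial σ T) (MvPolynomial σ A ⧸ coeffSubmodule hs ⊤ L)) =
      Submodule.map (coeffSubmodule hs ⊤ L).mkQ ⊤ by rw [Submodule.map_top, Submodule.range_mkQ],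
    ← Submodule.map_smul'', Submodule.comap_map_mkQ, sup_comm]

lemma isWeaklyRegular_X_pow
    (hs : ∀ (r : MvPolynomial σ T) (p : MvPolynomial σ A), r • p = map (algebraMap T A) r * p)
    (l : List σ) (hl : l.Nodup) (c : ℕ) (L : Submodule T A) :
    IsWeaklyRegular (MvPolynomial σ A ⧸ coeffSubmodule hs ⊤ L)
      (l.map fun j => (X j ^ c : MvPolynomial σ T)) := by
  refine ⟨fun i hi => ?_⟩
  rw [isSMulRegular_quotient_iff_mem_of_smul_mem]
  intro x
  obtain ⟨p, rfl⟩ := Submodule.Quotient.mk_surjective _ x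
  rw [List.length_map] at hi
  rw [← List.map_take, List.getElem_map, ← Submodule.Quotient.mk_smul,
    mk_mem_ofList_smul_iff, mk_mem_ofList_smul_iff]
  intro h m hm
  rw [← coeff_add_X_pow_smul hs l[i] c]
  refine h _ fun j hj => ?_
  have hne : l[i] ≠ j := by
    rintro rfl
    obtain ⟨k, hk, hkj⟩ := List.mem_take_iff_getElem.1 hj
    have := (hl.getElem_inj_iff).1 hkj
    omega
  rw [Finsupp.add_apply, Finsupp.single_eq_of_ne hne.symm, add_zero]
  exact hm j hj

end CoeffSubmodule

section CoeffAnnihilator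

open RingTheory.Sequence

lemma isWeaklyRegular_self_X_pow {T : Type} [CommRing T] {n : ℕ} (c : ℕ) :
    IsWeaklyRegular (MvPolynomial (Fin n) T)
      ((List.finRange n).map fun j => (X j ^ c : MvPolynomial (Fin n) T)) := by
  have hs : ∀ r p : MvPolynomial (Fin n) T, r • p = map (algebraMap T T) r * p := by
    intro r p
    rw [Algebra.algebraMap_self, MvPolynomial.map_id, smul_eq_mul]
  have hbot : coeffSubmodule hs ⊤ (⊥ : Submodule T T) = ⊥ := by
    rw [eq_bot_iff]
    intro p hp
    rw [Submodule.mem_bot]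
    ext m
    exact hp m trivial
  rw [← (Submodule.quotEquivOfEqBot _ hbot).isWeaklyRegular_congr]
  exact isWeaklyRegular_X_pow hs _ (List.nodup_finRange n) c ⊥

/-- If `t` annihilates `Hⁿ_I(R/fR)` and all coefficients of `f * P` belong to `L`, then so do all
coefficients of `t • P`. -/
lemma smul_coeff_mem_of_mem_annihilator {T A : Type} [CommRing T] [CommRing A] [Algebra T A]
    {n : ℕ} {f : MvPolynomial (Fin n) T} {t : T}
    (ht : C t ∈ Module.annihilator (MvPolynomial (Fin n) T)
      ((localCohomology (Ideal.span (Set.range (X : Fin n → MvPolynomial (Fin n) T))) n).obj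
        (ModuleCat.of _ (MvPolynomial (Fin n) T ⧸ Ideal.span {f}))))
    (L : Submodule T A) (P : MvPolynomial (Fin n) A)
    (hP : ∀ m, coeff m (map (algebraMap T A) f * P) ∈ L) (m : Fin n →₀ ℕ) :
    t • coeff m P ∈ L := by
  let : Module (MvPolynomial (Fin n) T) (MvPolynomial (Fin n) A) :=
    Module.compHom _ (map (algebraMap T A))
  have hs : ∀ (r : MvPolynomial (Fin n) T) (p : MvPolynomial (Fin n) A),
      r • p = map (algebraMap T A) r * p := fun r p => rfl
  let c := P.totalDegree + 1
  let rs := (List.finRange n).map fun j => (X j ^ c : MvPolynomial (Fin n) T)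
  obtain ⟨K, hK⟩ := Ideal.exists_pow_le_of_le_radical_of_fg (I := Ideal.span (Set.range X))
    (J := Ideal.ofList rs)
    (Ideal.span_le.2 (by
      rintro _ ⟨j, rfl⟩
      exact ⟨c, Ideal.subset_span (List.mem_map.2 ⟨j, List.mem_finRange j, rfl⟩)⟩))
    (Submodule.fg_span (Set.finite_range _))
  let N := coeffSubmodule hs ⊤ L
  let Q : (MvPolynomial (Fin n) T ⧸ Ideal.span {f}) →ₗ[MvPolynomial (Fin n) T]
      MvPolynomial (Fin n) A ⧸ N :=
    Submodule.liftQ _ (LinearMap.toSpanSingleton _ _ (N.mkQ P)) (by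
      rw [Ideal.span, Submodule.span_singleton_le_iff_mem, LinearMap.mem_ker,
        LinearMap.toSpanSingleton_apply, ← map_smul, Submodule.mkQ_apply,
        Submodule.Quotient.mk_eq_zero, hs]
      exact fun m _ => hP m)
  have hmem := smul_mem_of_mem_annihilator_localCohomology rs (by simp [rs]) (by
      intro r hr
      obtain ⟨j, -, rfl⟩ := List.mem_map.1 hr
      exact Ideal.pow_mem_of_mem _ (Ideal.subset_span (Set.mem_range_self j)) _ (Nat.succ_pos _)) hK
    (isWeaklyRegular_self_X_pow c) ht (isWeaklyRegular_X_pow hs _ (List.nodup_finRange n) c L) Q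
    (Submodule.Quotient.mk 1)
  have hQ : Q (Submodule.Quotient.mk 1) = N.mkQ P :=
    (Submodule.liftQ_apply _ _ _).trans (one_smul _ _)
  rw [hQ, ← map_smul, Submodule.mkQ_apply, mk_mem_ofList_smul_iff] at hmem
  by_cases hm : ∀ j ∈ List.finRange n, m j < c
  · have := hmem m hm
    rwa [hs, map_C, coeff_C_mul, ← Algebra.smul_def] at this
  · push Not at hm
    obtain ⟨j, -, hj⟩ := hm
    rw [coeff_eq_zero_of_totalDegree_lt, smul_zero]
    · exact zero_mem _
    · refine (Nat.lt_of_succ_le hj).trans_le ?_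
      by_cases h0 : j ∈ m.support
      · exact Finset.single_le_sum (f := fun i => m i) (fun _ _ => Nat.zero_le _) h0
      · rw [Finsupp.notMem_support_iff.1 h0]; exact Nat.zero_le _

end CoeffAnnihilator

section Homogenization

variable {σ A : Type} [CommRing A]

/-- The homogenization of a univariate polynomial in the monomials with exponents `a` and `b`. -/
noncomputable def monomialHomogenize (a b : σ →₀ ℕ) (N : ℕ) (p : Polynomial A) :
    MvPolynomial σ A :=
  ∑ j ∈ Finset.range (N + 1), monomial (j • a + (N - j) • b) (p.coeff j)

lemma coeff_monomialHomogenize_mem {T : Type} [CommRing T] [Algebra T A] {L : Submodule T A}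
    {p : Polynomial A} (hp : ∀ j, p.coeff j ∈ L) (a b : σ →₀ ℕ) (N : ℕ) (m : σ →₀ ℕ) :
    coeff m (monomialHomogenize a b N p) ∈ L := by
  classical
  rw [monomialHomogenize, coeff_sum]
  refine Submodule.sum_mem _ fun j _ => ?_
  rw [coeff_monomial]
  split_ifs
  · exact hp j
  · exact zero_mem _

lemma coeff_monomialHomogenize {a b : σ →₀ ℕ} (hab : a ≠ b) {N j : ℕ} (hj : j ≤ N)
    (p : Polynomial A) :
    coeff (j • a + (N - j) • b) (monomialHomogenize a b N p) = p.coeff j := by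
  classical
  obtain ⟨i, hi⟩ := DFunLike.ne_iff.1 hab
  rw [monomialHomogenize, coeff_sum, Finset.sum_eq_single j]
  · rw [coeff_monomial, if_pos rfl]
  · intro k hk hkj
    rw [coeff_monomial, if_neg]
    intro h
    obtain ⟨s, hs⟩ := Nat.exists_eq_add_of_le (Nat.lt_succ_iff.1 (Finset.mem_range.1 hk))
    obtain ⟨s', hs'⟩ := Nat.exists_eq_add_of_le hj
    have h1 := DFunLike.congr_fun h i
    rw [show N - k = s by omega, show N - j = s' by omega] at h1
    simp only [Finsupp.add_apply, Finsupp.smul_apply, smul_eq_mul] at h1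
    zify at h1 hs hs' hi hkj
    have h2 : ((k : ℤ) - j) * ((a i : ℤ) - b i) = 0 := by
      linear_combination h1 + (b i : ℤ) * hs - (b i : ℤ) * hs'
    rcases mul_eq_zero.1 h2 with h3 | h3
    · exact hkj (by linarith)
    · exact hi (by linarith)
  · intro h
    simp at h
    omega

lemma mul_monomialHomogenize (a b : σ →₀ ℕ) (u v : A) {N : ℕ} {p : Polynomial A}
    (hp : p.natDegree ≤ N) :
    (monomial a u + monomial b v) * monomialHomogenize a b N p =
      monomialHomogenize a b (N + 1) ((Polynomial.C u * Polynomial.X + Polynomial.C v) * p) := by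
  have h1 : monomial a u * monomialHomogenize a b N p =
      monomialHomogenize a b (N + 1) (Polynomial.C u * (p * Polynomial.X)) := by
    rw [monomialHomogenize, monomialHomogenize, Finset.sum_range_succ' _ (N + 1), Finset.mul_sum,
      Polynomial.coeff_C_mul, Polynomial.mul_coeff_zero, Polynomial.coeff_X_zero, mul_zero,
      mul_zero, map_zero, add_zero]
    refine Finset.sum_congr rfl fun j _ => ?_
    rw [monomial_mul, Polynomial.coeff_C_mul, Polynomial.coeff_mul_X, Nat.add_sub_add_right,
      succ_nsmul, add_comm (j • a) a, add_assoc]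
  have h2 : monomial b v * monomialHomogenize a b N p =
      monomialHomogenize a b (N + 1) (Polynomial.C v * p) := by
    rw [monomialHomogenize, monomialHomogenize, Finset.sum_range_succ _ (N + 1), Finset.mul_sum,
      Polynomial.coeff_C_mul, Polynomial.coeff_eq_zero_of_natDegree_lt (Nat.lt_succ_of_le hp),
      mul_zero, map_zero, add_zero]
    refine Finset.sum_congr rfl fun j hj => ?_
    rw [monomial_mul, Polynomial.coeff_C_mul,
      Nat.succ_sub (Nat.lt_succ_iff.1 (Finset.mem_range.1 hj)), succ_nsmul]
    congr 1
    rw [add_comm b, add_assoc]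
  have h3 : (Polynomial.C u * Polynomial.X + Polynomial.C v) * p =
      Polynomial.C u * (p * Polynomial.X) + Polynomial.C v * p := by ring
  rw [add_mul, h1, h2, h3]
  simp only [monomialHomogenize, Polynomial.coeff_add, map_add, Finset.sum_add_distrib]

/-- If multiplication by `t` preserves the property that the coefficients belong to `L`, up to
multiplication by a binomial `u * x ^ a + v * x ^ b`, then `t` belongs to certain submodules. -/
lemma smul_one_mem_of_binomial {T : Type} [CommRing T] [Algebra T A] {a b : σ →₀ ℕ} (hab : a ≠ b)
    {u v w' : A} {l : T} {w : A} (hw : w = v + algebraMap T A l * u) (hww' : w * w' = 1) {t : T}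
    (ht : ∀ (L : Submodule T A) (P : MvPolynomial σ A),
      (∀ m, coeff m ((monomial a u + monomial b v) * P) ∈ L) → ∀ m, t • coeff m P ∈ L) (N : ℕ) :
    t • (1 : A) ∈
      Submodule.span T {w} ⊔ (Ideal.span {u ^ (N + 1)} : Ideal A).restrictScalars T := by
  set L := Submodule.span T {w} ⊔ (Ideal.span {u ^ (N + 1)} : Ideal A).restrictScalars T
  let E : Polynomial A :=
    Polynomial.C (-u * w') * (Polynomial.X - Polynomial.C (algebraMap T A l))
  let p : Polynomial A := ∑ j ∈ Finset.range (N + 1), E ^ j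
  have hE : E.natDegree ≤ 1 := by
    refine (Polynomial.natDegree_C_mul_le _ _).trans (Polynomial.natDegree_X_sub_C_le _)
  have hdeg : p.natDegree ≤ N := by
    refine Polynomial.natDegree_sum_le_of_forall_le _ _ fun j hj => ?_
    refine (Polynomial.natDegree_pow_le_of_le j hE).trans ?_
    simpa [Nat.lt_succ_iff] using hj
  have heval : p.eval (algebraMap T A l) = 1 := by
    simp [p, E, Polynomial.eval_finsetSum, Finset.sum_range_succ']
  have hlin : Polynomial.C u * Polynomial.X + Polynomial.C v = Polynomial.C w * (1 - E) := by
    have h1 : Polynomial.C w * Polynomial.C w' = 1 := by rw [← map_mul, hww', map_one]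
    have h2 : Polynomial.C w = Polynomial.C v + Polynomial.C (algebraMap T A l) * Polynomial.C u :=
      by rw [hw, map_add, map_mul]
    simp only [E, map_mul, map_neg]
    linear_combination (-Polynomial.C u * (Polynomial.X - Polynomial.C (algebraMap T A l))) * h1
      - h2
  have hprod : (Polynomial.C u * Polynomial.X + Polynomial.C v) * p =
      Polynomial.C w - Polynomial.C (u ^ (N + 1)) * (Polynomial.C (w * (-w') ^ (N + 1)) *
        (Polynomial.X - Polynomial.C (algebraMap T A l)) ^ (N + 1)) := by
    rw [hlin, mul_assoc, mul_neg_geom_sum]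
    rw [show E = Polynomial.C u * (Polynomial.C (-w') *
      (Polynomial.X - Polynomial.C (algebraMap T A l))) by simp only [E, map_mul, map_neg]; ring,
      mul_pow, mul_pow, map_mul, map_pow, map_pow]
    ring
  have hL : ∀ j, ((Polynomial.C u * Polynomial.X + Polynomial.C v) * p).coeff j ∈ L := by
    intro j
    rw [hprod, Polynomial.coeff_sub, Polynomial.coeff_C_mul]
    refine sub_mem (Submodule.mem_sup_left ?_) (Submodule.mem_sup_right ?_)
    · rw [Polynomial.coeff_C]
      split_ifs
      · exact Submodule.mem_span_singleton_self w
      · exact zero_mem _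
    · exact Ideal.mul_mem_right _ _ (Ideal.mem_span_singleton_self _)
  have hcoeff : ∀ j ≤ N, t • p.coeff j ∈ L := by
    intro j hj
    rw [← coeff_monomialHomogenize hab hj p]
    refine ht L _ ?_ _
    rw [mul_monomialHomogenize a b u v hdeg]
    exact coeff_monomialHomogenize_mem hL _ _ _
  rw [← heval, Polynomial.eval_eq_sum_range' (Nat.lt_succ_of_le hdeg), Finset.smul_sum]
  refine Submodule.sum_mem _ fun j hj => ?_
  rw [← map_pow, mul_comm, ← Algebra.smul_def, smul_comm]
  exact Submodule.smul_mem _ _ (hcoeff j (Nat.lt_succ_iff.1 (Finset.mem_range.1 hj)))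

end Homogenization

section LocalAlgebra

open IsLocalRing

/-- In a Noetherian local domain, if `w` avoids the prime `q ∋ u`, then the ideals
`(w) + (u ^ (r + 1) D_q ∩ D)` do not all contain a fixed power of the maximal ideal. -/
lemma not_forall_maximalIdeal_pow_le {D : Type} [CommRing D] [IsDomain D] [IsLocalRing D]
    [IsNoetherianRing D] (q : Ideal D) [q.IsPrime] {u w : D} (hu0 : u ≠ 0) (hu : u ∈ q)
    (hwq : w ∉ q) (hw : w ∈ maximalIdeal D) (k : ℕ) :
    ¬ ∀ r : ℕ, maximalIdeal D ^ k ≤ Ideal.span {w} ⊔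
      (Ideal.span {algebraMap D (Localization.AtPrime q) u ^ (r + 1)}).comap
        (algebraMap D (Localization.AtPrime q)) := by
  intro h
  let φ := algebraMap D (Localization.AtPrime q)
  let U : ℕ → Ideal D := fun r => (Ideal.span {φ u ^ (r + 1)}).comap φ
  have hU : Antitone U := antitone_nat_of_succ_le fun r =>
    Ideal.comap_mono (Ideal.span_singleton_le_span_singleton.2 (pow_dvd_pow _ (Nat.le_succ _)))
  have hstab : ∃ r, Ideal.span {w} ⊔ U r = Ideal.span {w} ⊔ U (r + 1) := by
    rcases Nat.eq_zero_or_pos k with rfl | hk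
    · refine ⟨0, ?_⟩
      have h0 := h 0
      have h1 := h 1
      rw [pow_zero, Ideal.one_eq_top, top_le_iff] at h0 h1
      exact h0.trans h1.symm
    have hmin : maximalIdeal D ∈ (maximalIdeal D ^ k).minimalPrimes := by
      refine ⟨⟨inferInstance, Ideal.pow_le_self hk.ne'⟩, fun p hp _ => ?_⟩
      have := hp.1
      exact Ideal.IsPrime.le_of_pow_le hp.2
    have := IsLocalRing.quotient_artinian_of_mem_minimalPrimes_of_isLocalRing _ hmin
    let f : ℕ →o (Submodule (D ⧸ maximalIdeal D ^ k) (D ⧸ maximalIdeal D ^ k))ᵒᵈ :=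
      ⟨fun r => OrderDual.toDual
        ((Ideal.span {w} ⊔ U r).map (Ideal.Quotient.mk (maximalIdeal D ^ k))),
        fun r s hrs => Ideal.map_mono (sup_le_sup_left (hU hrs) _)⟩
    obtain ⟨r, hr⟩ := IsArtinian.monotone_stabilizes f
    refine ⟨r, ?_⟩
    have h1 := congr_arg (Ideal.comap (Ideal.Quotient.mk (maximalIdeal D ^ k)))
      (OrderDual.toDual_inj.1 (hr (r + 1) (Nat.le_succ r)))
    rwa [Ideal.comap_map_of_surjective _ Ideal.Quotient.mk_surjective,
      Ideal.comap_map_of_surjective _ Ideal.Quotient.mk_surjective,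
      ← RingHom.ker_eq_comap_bot, Ideal.mk_ker, sup_eq_left.2 (h r), sup_eq_left.2 (h (r + 1))]
      at h1
  obtain ⟨r, hr⟩ := hstab
  have hwu : IsUnit (φ w) := IsLocalization.map_units (Localization.AtPrime q)
    (⟨w, hwq⟩ : q.primeCompl)
  have hle : U r ≤ U (r + 1) ⊔ Ideal.span {w} • U r := by
    intro x hx
    have hx' : x ∈ Ideal.span {w} ⊔ U (r + 1) := hr ▸ Submodule.mem_sup_right hx
    obtain ⟨y, hy, z, hz, rfl⟩ := Submodule.mem_sup.1 hx'
    obtain ⟨d, rfl⟩ := Ideal.mem_span_singleton'.1 hy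
    have hdw : d * w ∈ U r := (Ideal.add_mem_iff_left _ (hU (Nat.le_succ r) hz)).1 hx
    have hd : d ∈ U r := by
      have h2 : φ d * φ w ∈ Ideal.span {φ u ^ (r + 1)} := by rw [← map_mul]; exact hdw
      exact (Ideal.mul_unit_mem_iff_mem _ hwu).1 h2
    rw [add_comm (d * w) z]
    refine Submodule.add_mem_sup hz ?_
    rw [mul_comm d w]
    exact Submodule.smul_mem_smul (Ideal.mem_span_singleton_self w) hd
  have hle' : U r ≤ U (r + 1) := Submodule.le_of_le_smul_of_le_jacobson_bot
    (IsNoetherian.noetherian _) (by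
      rw [IsLocalRing.jacobson_eq_maximalIdeal _ bot_ne_top, Ideal.span_singleton_le_iff_mem]
      exact hw) hle
  have hmem' : φ (u ^ (r + 1)) ∈ Ideal.span {φ u ^ (r + 1)} := by
    rw [map_pow]
    exact Ideal.mem_span_singleton_self _
  have hmem : u ^ (r + 1) ∈ U (r + 1) := hle' hmem'
  obtain ⟨c, hc⟩ := Ideal.mem_span_singleton'.1 (show φ (u ^ (r + 1)) ∈ _ from hmem)
  have hφu : φ u ≠ 0 := by
    rw [Ne, IsLocalization.to_map_eq_zero_iff _ q.primeCompl_le_nonZeroDivisors]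
    exact hu0
  have hunit : c * φ u = 1 := by
    apply mul_right_cancel₀ (pow_ne_zero (r + 1) hφu)
    rw [map_pow] at hc
    linear_combination hc
  have h3 : IsUnit (φ u) := IsUnit.of_mul_eq_one_right _ hunit
  rw [IsLocalization.AtPrime.isUnit_to_map_iff _ q] at h3
  exact h3 hu

/-- A form of prime avoidance: if `u` and `v` are not both contained in any nonmaximal prime over
`J`, and `dim B / J ≤ 1`, then some `v + l * u` is contained in no such prime. -/
lemma exists_add_mul_forall_isPrime {B : Type} [CommRing B] [IsLocalRing B] [IsNoetherianRing B]
    (J : Ideal B) {u v : B}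
    (hJ : ∀ p q : Ideal B, p.IsPrime → q.IsPrime → J ≤ p → p < q → q = maximalIdeal B)
    (huv : ∀ q : Ideal B, q.IsPrime → J ≤ q → u ∈ q → v ∈ q → q = maximalIdeal B) :
    ∃ l : B, ∀ q : Ideal B, q.IsPrime → J ≤ q → v + l * u ∈ q → q = maximalIdeal B := by
  classical
  have hfin : (J.minimalPrimes \ {maximalIdeal B}).Finite :=
    (Ideal.finite_minimalPrimes_of_isNoetherianRing B J).subset Set.sdiff_subset
  let S := hfin.toFinset
  have hS : ∀ p, p ∈ S ↔ p ∈ J.minimalPrimes ∧ p ≠ maximalIdeal B := fun p => by simp [S]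
  let I₀ : Ideal B := (S.filter fun p => v ∉ p).inf id
  have hnot : ¬ (I₀ : Set B) ⊆ ⋃ p ∈ (↑(S.filter fun p => v ∈ p) : Set (Ideal B)), (p : Set B) := by
    rw [Ideal.subset_union_prime (f := fun p : Ideal B => p) ⊥ ⊥
      (fun p hp _ _ => ((hS p).1 (Finset.mem_filter.1 hp).1).1.1.1)]
    rintro ⟨p, hp, hle⟩
    obtain ⟨hpS, hvp⟩ := Finset.mem_filter.1 hp
    have hpm := ((hS p).1 hpS).1
    obtain ⟨p', hp', hle'⟩ := (Ideal.IsPrime.inf_le' hpm.1.1).1 hle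
    obtain ⟨hpS', hvp'⟩ := Finset.mem_filter.1 hp'
    exact hvp' (hpm.2 ((hS p').1 hpS').1.1 hle' hvp)
  obtain ⟨l, hl, hl'⟩ := Set.not_subset.1 hnot
  refine ⟨l, fun q hq hJq hw => ?_⟩
  by_contra hqm
  obtain ⟨p, hp, hpq⟩ := Ideal.exists_minimalPrimes_le hJq
  have hpq' : p = q := by
    by_contra hne
    exact hqm (hJ p q hp.1.1 hq hp.1.2 (lt_of_le_of_ne hpq hne))
  subst hpq'
  have hpS := (hS p).2 ⟨hp, hqm⟩
  by_cases hv : v ∈ p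
  · have hlu : l * u ∈ p := (Ideal.add_mem_iff_right _ hv).1 hw
    rcases hq.mem_or_mem hlu with h | h
    · exact hl' (Set.mem_biUnion (Finset.mem_coe.2 (Finset.mem_filter.2 ⟨hpS, hv⟩)) h)
    · exact hqm (huv p hq hJq h hv)
  · have hlp : l ∈ p := (Finset.inf_le (f := id) (Finset.mem_filter.2 ⟨hpS, hv⟩) : I₀ ≤ p) hl
    exact hv ((Ideal.add_mem_iff_left _ (Ideal.mul_mem_right _ _ hlp)).1 hw)

lemma two_le_ringKrullDim_quotient_iff {B : Type} [CommRing B] (J : Ideal B) :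
    2 ≤ ringKrullDim (B ⧸ J) ↔ ∃ p q r : Ideal B, p.IsPrime ∧ q.IsPrime ∧ r.IsPrime ∧
      J ≤ p ∧ p < q ∧ q < r := by
  rw [ringKrullDim_quotient]
  constructor
  · intro h
    obtain ⟨s, hs⟩ := (Order.le_krullDim_iff (n := 2)).1 (by exact_mod_cast h)
    have h01 : s ⟨0, by omega⟩ < s ⟨1, by omega⟩ := s.strictMono (by simp [Fin.lt_def])
    have h12 : s ⟨1, by omega⟩ < s ⟨2, by omega⟩ := s.strictMono (by simp [Fin.lt_def])
    exact ⟨_, _, _, (s ⟨0, by omega⟩).1.2, (s ⟨1, by omega⟩).1.2, (s ⟨2, by omega⟩).1.2,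
      (s ⟨0, by omega⟩).2, h01, h12⟩
  · rintro ⟨p, q, r, hp, hq, hr, hJ, hpq, hqr⟩
    let P : PrimeSpectrum.zeroLocus (R := B) J := ⟨⟨p, hp⟩, hJ⟩
    let Q : PrimeSpectrum.zeroLocus (R := B) J := ⟨⟨q, hq⟩, hJ.trans hpq.le⟩
    let S : PrimeSpectrum.zeroLocus (R := B) J := ⟨⟨r, hr⟩, hJ.trans (hpq.trans hqr).le⟩
    have hPQ : P < Q := hpq
    have hQS : Q < S := hqr
    let s : LTSeries (PrimeSpectrum.zeroLocus (R := B) J) :=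
      ⟨2, ![P, Q, S], by intro i; fin_cases i; exacts [hPQ, hQS]⟩
    have hs : s.length = 2 := rfl
    have := Order.LTSeries.length_le_krullDim s
    rw [hs] at this
    exact_mod_cast this

lemma exists_isPrime_le_two_le_ringKrullDim_quotient {B : Type} [CommRing B] [IsLocalRing B]
    [IsNoetherianRing B] (s : Finset B) (hs : ∀ x ∈ s, x ∈ maximalIdeal B)
    (hdim : ((s.card + 2 : ℕ) : WithBot ℕ∞) ≤ ringKrullDim B) :
    ∃ p : Ideal B, p.IsPrime ∧ (∀ x ∈ s, x ∈ p) ∧ 2 ≤ ringKrullDim (B ⧸ p) := by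
  have h1 := ringKrullDim_le_ringKrullDim_quotient_add_card s
    (by rw [IsLocalRing.ringJacobson_eq_maximalIdeal]; exact hs)
  have h2 : 2 ≤ ringKrullDim (B ⧸ Ideal.span (s : Set B)) := by
    have h3 := hdim.trans h1
    generalize ringKrullDim (B ⧸ Ideal.span (s : Set B)) = x at h3
    induction x with
    | bot =>
      rw [WithBot.bot_add] at h3
      exact absurd (le_bot_iff.1 h3) (WithBot.natCast_ne_bot _)
    | coe x =>
      induction x with
      | top => exact WithBot.coe_le_coe.2 (le_top : (2 : ℕ∞) ≤ ⊤)
      | coe x =>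
        have : s.card + 2 ≤ x + s.card := by
          have h4 : ((s.card + 2 : ℕ) : ℕ∞) ≤ ((x + s.card : ℕ) : ℕ∞) :=
            WithBot.coe_le_coe.1 h3
          exact Nat.cast_le.1 h4
        exact WithBot.coe_le_coe.2 (by exact_mod_cast (by omega : 2 ≤ x))
  obtain ⟨p, q, r, hp, hq, hr, hJ, hpq, hqr⟩ := (two_le_ringKrullDim_quotient_iff _).1 h2
  exact ⟨p, hp, fun x hx => hJ (Ideal.subset_span hx),
    (two_le_ringKrullDim_quotient_iff p).2 ⟨p, q, r, hp, hq, hr, le_rfl, hpq, hqr⟩⟩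

lemma ne_zero_and_exists_isPrime_mem_notMem {D : Type} [CommRing D] [IsLocalRing D]
    [IsNoetherianRing D] (hD : 2 ≤ ringKrullDim D) {u v : D} (hu : u ∈ maximalIdeal D)
    (hv : v ∈ maximalIdeal D)
    (huv : ∀ q : Ideal D, q.IsPrime → u ∈ q → v ∈ q → q = maximalIdeal D) :
    u ≠ 0 ∧ ∃ q : Ideal D, q.IsPrime ∧ u ∈ q ∧ v ∉ q := by
  have key : ∀ x ∈ maximalIdeal D, ∃ q : Ideal D, q.IsPrime ∧ x ∈ q ∧ q ≠ maximalIdeal D := by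
    intro x hx
    obtain ⟨q, hq, -⟩ := Ideal.exists_minimalPrimes_le
      ((Ideal.span_singleton_le_iff_mem (maximalIdeal D)).2 hx)
    refine ⟨q, hq.1.1, hq.1.2 (Ideal.mem_span_singleton_self x), ?_⟩
    rintro rfl
    have h1 := Ideal.height_le_one_of_isPrincipal_of_mem_minimalPrimes _ _ hq
    rw [← IsLocalRing.maximalIdeal_height_eq_ringKrullDim] at hD
    have h2 : (2 : ℕ∞) ≤ 1 := (WithBot.coe_le_coe.1 hD).trans h1
    exact absurd h2 (by norm_num)
  constructor
  · rintro rfl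
    obtain ⟨q, hq, hvq, hne⟩ := key v hv
    exact hne (huv q hq q.zero_mem hvq)
  · obtain ⟨q, hq, huq, hne⟩ := key u hu
    exact ⟨q, hq, huq, fun hvq => hne (huv q hq huq hvq)⟩

end LocalAlgebra

section SystemOfParameters

open IsLocalRing

/-- Whenever `f * P` has all coefficients in a `T`-submodule `L` of a `T`-algebra `A`, multiples of
`P` by elements of `J` have all coefficients in `L`. -/
def PreservesCoeffSubmodules {σ T : Type} [CommRing T] (f : MvPolynomial σ T) (J : Ideal T) :
    Prop :=
  ∀ t ∈ J, ∀ (A : Type) [CommRing A] [Algebra T A] (L : Submodule T A) (P : MvPolynomial σ A),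
    (∀ m, coeff m (map (algebraMap T A) f * P) ∈ L) → ∀ m, t • coeff m P ∈ L

variable {σ T : Type} [CommRing T] [IsLocalRing T] [IsNoetherianRing T]

lemma PreservesCoeffSubmodules.not_maximalIdeal_pow_le {f : MvPolynomial σ T} {J : Ideal T}
    (hJ : PreservesCoeffSubmodules f J) {a b : σ →₀ ℕ} (hab : a ≠ b) (p : Ideal T) [p.IsPrime]
    (hp : ∀ m, m ≠ a → m ≠ b → coeff m f ∈ p) (hdim : 2 ≤ ringKrullDim (T ⧸ p))
    (ha : coeff a f ∈ maximalIdeal T) (hb : coeff b f ∈ maximalIdeal T)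
    (huv : ∀ q : Ideal T, q.IsPrime → p ≤ q → coeff a f ∈ q → coeff b f ∈ q → q = maximalIdeal T)
    (l : T) (k : ℕ) :
    ¬ maximalIdeal T ^ k ≤ J ⊔ p ⊔ Ideal.span {coeff b f + l * coeff a f} := by
  classical
  intro hk
  let π := Ideal.Quotient.mk p
  have hπ : Function.Surjective π := Ideal.Quotient.mk_surjective
  have : IsLocalRing (T ⧸ p) := IsLocalRing.of_surjective' π hπ
  have hm : (maximalIdeal T).map π = maximalIdeal (T ⧸ p) :=
    IsLocalRing.map_maximalIdeal_of_surjective π hπ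
  have hcomap : (maximalIdeal (T ⧸ p)).comap π = maximalIdeal T :=
    IsLocalRing.eq_maximalIdeal (Ideal.comap_isMaximal_of_surjective π hπ)
  have hmem : ∀ x ∈ maximalIdeal T, π x ∈ maximalIdeal (T ⧸ p) := fun x hx =>
    hm ▸ Ideal.mem_map_of_mem π hx
  obtain ⟨hu0, q, hq, huq, hvq⟩ := ne_zero_and_exists_isPrime_mem_notMem hdim
    (hmem _ ha) (hmem _ hb) (fun q hq hu hv => by
      have h1 := huv (q.comap π) inferInstance
        (fun x hx => by
          rw [Ideal.mem_comap, Ideal.Quotient.eq_zero_iff_mem.2 hx]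
          exact q.zero_mem) hu hv
      rw [← hm, ← h1, Ideal.map_comap_of_surjective π hπ])
  set u := coeff a f with hu
  set v := coeff b f with hv
  have hwq : π (v + l * u) ∉ q := by
    rw [map_add, map_mul]
    exact fun h => hvq ((Ideal.add_mem_iff_left _ (Ideal.mul_mem_left _ _ huq)).1 h)
  refine not_forall_maximalIdeal_pow_le q hu0 huq hwq (hmem _ (Ideal.add_mem _ hb
    (Ideal.mul_mem_left _ _ ha))) k fun r => ?_
  let A := Localization.AtPrime q
  have hmap : map (algebraMap T A) f =
      monomial a (algebraMap T A u) + monomial b (algebraMap T A v) := by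
    ext m
    rw [coeff_map, coeff_add, coeff_monomial, coeff_monomial]
    by_cases hma : a = m
    · subst hma
      simp [hab.symm, hu]
    by_cases hmb : b = m
    · subst hmb
      simp [hab, hv]
    rw [if_neg hma, if_neg hmb, add_zero, IsScalarTower.algebraMap_apply T (T ⧸ p) A,
      Ideal.Quotient.algebraMap_eq, Ideal.Quotient.eq_zero_iff_mem.2 (hp m (Ne.symm hma)
      (Ne.symm hmb)), map_zero]
  have hw : IsUnit (algebraMap T A (v + l * u)) :=
    IsLocalization.map_units A (⟨_, hwq⟩ : q.primeCompl)
  obtain ⟨w', hw'⟩ := hw.exists_right_inv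
  have hJle : J.map π ≤ Ideal.span {π (v + l * u)} ⊔
      (Ideal.span {algebraMap (T ⧸ p) A (π u) ^ (r + 1)}).comap (algebraMap (T ⧸ p) A) := by
    rw [Ideal.map_le_iff_le_comap]
    intro t ht
    have h1 := smul_one_mem_of_binomial (T := T) hab (w := algebraMap T A (v + l * u))
      (l := l) (by rw [map_add, map_mul]) hw' (t := t)
      (fun L P => by rw [← hmap]; exact hJ t ht A L P) r
    obtain ⟨y, hy, z, hz, hyz⟩ := Submodule.mem_sup.1 h1
    obtain ⟨s, rfl⟩ := Submodule.mem_span_singleton.1 hy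
    rw [Algebra.smul_def, Algebra.smul_def, mul_one, ← map_mul] at hyz
    have h2 : π t = π (s * (v + l * u)) + π (t - s * (v + l * u)) := by
      rw [← map_add, add_sub_cancel]
    rw [Ideal.mem_comap, h2]
    refine Submodule.add_mem_sup ?_ ?_
    · rw [map_mul]
      exact Ideal.mul_mem_left _ _ (Ideal.mem_span_singleton_self _)
    · change algebraMap T A (t - s * (v + l * u)) ∈ Ideal.span {algebraMap T A u ^ (r + 1)}
      rw [map_sub, ← hyz, add_sub_cancel_left]
      exact hz
  rw [← hm, ← Ideal.map_pow]
  refine (Ideal.map_mono hk).trans ?_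
  rw [Ideal.map_sup, Ideal.map_sup, Ideal.map_quotient_self, sup_bot_eq, Ideal.map_span,
    Set.image_singleton]
  exact sup_le hJle le_sup_left

lemma PreservesCoeffSubmodules.two_le_ringKrullDim_quotient {f : MvPolynomial σ T} {J : Ideal T}
    (hJ : PreservesCoeffSubmodules f J) (hd : 2 ≤ ringKrullDim T)
    (hcard : (f.support.card : WithBot ℕ∞) = ringKrullDim T)
    (hcoeff : ∀ m ∈ f.support, coeff m f ∈ maximalIdeal T)
    (hrad : (Ideal.span ((fun m => coeff m f) '' ↑f.support)).radical = maximalIdeal T) :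
    2 ≤ ringKrullDim (T ⧸ J) := by
  classical
  by_contra hlt
  have htwo : 1 < f.support.card := by
    rw [← hcard] at hd
    exact_mod_cast hd
  obtain ⟨a, ha, b, hb, hab⟩ := Finset.one_lt_card.1 htwo
  let s := ((f.support.erase a).erase b).image fun m => coeff m f
  have hs : s.card + 2 ≤ f.support.card := by
    have h1 : ((f.support.erase a).erase b).card = f.support.card - 1 - 1 := by
      rw [Finset.card_erase_of_mem (Finset.mem_erase.2 ⟨hab.symm, hb⟩),
        Finset.card_erase_of_mem ha]
    have h2 : s.card ≤ _ := Finset.card_image_le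
    omega
  obtain ⟨p, hp, hsp, hdim⟩ := exists_isPrime_le_two_le_ringKrullDim_quotient s
    (fun x hx => by
      obtain ⟨m, hm, rfl⟩ := Finset.mem_image.1 hx
      exact hcoeff m (Finset.mem_of_mem_erase (Finset.mem_of_mem_erase hm)))
    (by rw [← hcard]; exact_mod_cast hs)
  have hpc : ∀ m, m ≠ a → m ≠ b → coeff m f ∈ p := fun m hma hmb => by
    by_cases hm : m ∈ f.support
    · exact hsp _ (Finset.mem_image_of_mem _
        (Finset.mem_erase.2 ⟨hmb, Finset.mem_erase.2 ⟨hma, hm⟩⟩))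
    · rw [notMem_support_iff.1 hm]
      exact p.zero_mem
  have huv : ∀ q : Ideal T, q.IsPrime → p ≤ q → coeff a f ∈ q → coeff b f ∈ q →
      q = maximalIdeal T := fun q hq hpq hqa hqb => by
    refine le_antisymm (IsLocalRing.le_maximalIdeal hq.ne_top) ?_
    rw [← hrad, hq.radical_le_iff, Ideal.span_le]
    rintro _ ⟨m, -, rfl⟩
    by_cases hma : m = a
    · exact hma ▸ hqa
    by_cases hmb : m = b
    · exact hmb ▸ hqb
    exact hpq (hpc m hma hmb)
  obtain ⟨l, hl⟩ := exists_add_mul_forall_isPrime (J ⊔ p)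
    (u := coeff a f) (v := coeff b f)
    (fun q q' hq hq' hle hlt' => by
      by_contra hne
      exact hlt ((two_le_ringKrullDim_quotient_iff J).2 ⟨q, q', maximalIdeal T, hq, hq',
        inferInstance, le_sup_left.trans hle, hlt',
        lt_of_le_of_ne (IsLocalRing.le_maximalIdeal hq'.ne_top) hne⟩))
    (fun q hq hle => huv q hq (le_sup_right.trans hle))
  have hle : maximalIdeal T ≤ (J ⊔ p ⊔ Ideal.span {coeff b f + l * coeff a f}).radical := by
    rw [Ideal.radical_eq_sInf]
    refine le_sInf fun q hq => ?_
    exact (hl q hq.2 (le_sup_left.trans hq.1)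
      (hq.1 (Ideal.mem_sup_right (Ideal.mem_span_singleton_self _)))).ge
  obtain ⟨k, hk⟩ := Ideal.exists_pow_le_of_le_radical_of_fg hle (IsNoetherian.noetherian _)
  exact hJ.not_maximalIdeal_pow_le hab p hpc hdim (hcoeff a ha) (hcoeff b hb) huv l k hk

end SystemOfParameters

/-- **Marley–Vassilev, Lemma 2.7.**
Let `(T, m)` be a Noetherian local ring of dimension `d ≥ 2`, `R = T[x₁,…,xₙ]`,
`I = (x₁,…,xₙ)R`, and let `f ∈ R` be homogeneous of degree `p` whose nonzero
coefficients form a system of parameters for `T`.  Then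
`dim T / ann_T Hⁿ_I(R/fR) ≥ 2`, where `ann_T N = ann_R N ∩ T` is the annihilator
of `N` as a `T`-module. -/
theorem two_le_ringKrullDim_quotient_annihilator
    {T : Type} [CommRing T] [IsLocalRing T] [IsNoetherianRing T]
    (hd : 2 ≤ ringKrullDim T)
    (n : ℕ) (f : MvPolynomial (Fin n) T) (p : ℕ) (hf : f.IsHomogeneous p)
    -- the nonzero coefficients of `f` form a system of parameters for `T`:
    (hsop_card : (f.support.card : WithBot (WithTop ℕ)) = ringKrullDim T)
    (hsop_coeff : ∀ m ∈ f.support, MvPolynomial.coeff m f ∈ IsLocalRing.maximalIdeal T)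
    (hsop_rad : (Ideal.span ((fun m => MvPolynomial.coeff m f) '' ↑f.support)).radical
        = IsLocalRing.maximalIdeal T) :
    letI R := MvPolynomial (Fin n) T
    letI I : Ideal R := Ideal.span (Set.range (X : Fin n → R))
    2 ≤ ringKrullDim
        (T ⧸ (Module.annihilator R ((localCohomology I n).obj
            (ModuleCat.of R (R ⧸ Ideal.span {f})))).comap (C : T →+* R)) := by
  refine PreservesCoeffSubmodules.two_le_ringKrullDim_quotient (fun t ht A _ _ L P hP m => ?_)
    hd hsop_card hsop_coeff hsop_rad
  exact smul_coeff_mem_of_mem_annihilator (Ideal.mem_comap.1 ht) L P hP m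
end

section
/- Let (T,m) be a Noetherian local ring of dimension d ≥ 2, R = T[x_1,…,x_n] a polynomial ring over T, and I = (x_1,…,x_n)R. Let f ∈ R be a homogeneous element whose nonzero coefficients form a system of parameters for T. Then Hom_R(R/I, H^n_I(R/fR)) is not a finitely generated R-module. -/
universe u

section ExtAndLocalCohomology

open CategoryTheory Limits Opposite

variable {R : Type u} [CommRing R]

namespace CategoryTheory

lemma unop_comp_inv_unop_eq {C : Type*} [Category* C] {a b c d : Cᵒᵖ} {e f : C} {L : a ⟶ b}
    {ip : c ⟶ a} {iq : d ⟶ b}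
    {m : c ⟶ d} {hp : c ≅ op e} {hq : d ≅ op f} {k : f ⟶ e} (h : ip ≫ L = m ≫ iq)
    (h' : m ≫ hq.hom = hp.hom ≫ k.op) :
    L.unop ≫ ip.unop ≫ hp.inv.unop = (iq.unop ≫ hq.inv.unop) ≫ k := by
  apply Quiver.Hom.op_inj
  simp only [op_comp, Quiver.Hom.op_unop, Category.assoc]
  rw [h, Iso.inv_comp_eq, ← reassoc_of% h']
  simp

namespace ProjectiveResolution

/-- The map of cochain complexes `Hom(Q, Y) → Hom(P, Y)` induced by a chain map `P → Q`. -/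
noncomputable abbrev yonedaMap {P Q : ChainComplex (ModuleCat.{u} R) ℕ} (φ : P ⟶ Q)
    (Y : ModuleCat.{u} R) : Q.linearYonedaObj R Y ⟶ P.linearYonedaObj R Y :=
  (HomologicalComplex.unopFunctor _ _).map
   ((((linearYoneda R (ModuleCat.{u} R)).obj Y).rightOp.mapHomologicalComplex _).map φ).op

lemma isoExt_naturality {X X' : ModuleCat.{u} R} (g : X ⟶ X') (P : ProjectiveResolution X)
    (Q : ProjectiveResolution X') (φ : P.complex ⟶ Q.complex)
    (comm : φ.f 0 ≫ Q.π.f 0 = P.π.f 0 ≫ g) (n : ℕ) (Y : ModuleCat.{u} R) :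
    ((Ext R (ModuleCat.{u} R) n).map g.op).app Y ≫ (P.isoExt n Y).hom =
      (Q.isoExt n Y).hom ≫ HomologicalComplex.homologyMap (yonedaMap φ Y) n :=
  unop_comp_inv_unop_eq (isoLeftDerivedObj_inv_naturality g P Q φ comm
    ((linearYoneda R (ModuleCat.{u} R)).obj Y).rightOp n)
    (HomologicalComplex.homologyOp_hom_naturality (yonedaMap φ Y) n)

end ProjectiveResolution
end CategoryTheory

namespace CochainComplex

/-- The cocycle `x` represents the cohomology class `e`. -/
def IsRep (K : CochainComplex (ModuleCat.{u} R) ℕ) (n : ℕ) (e : K.homology n) (x : K.X n) : Prop :=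
  ∃ z : K.cycles n, K.homologyπ n z = e ∧ K.iCycles n z = x

variable {K L : CochainComplex (ModuleCat.{u} R) ℕ} {n : ℕ}

lemma exists_isRep (e : K.homology n) : ∃ x, K.IsRep n e x := by
  obtain ⟨z, hz⟩ := (ModuleCat.epi_iff_surjective (K.homologyπ n)).1 inferInstance e
  exact ⟨_, z, hz, rfl⟩

lemma IsRep.d_eq_zero {e : K.homology n} {x : K.X n} (h : K.IsRep n e x) (m : ℕ) :
    K.d n m x = 0 := by
  obtain ⟨z, -, rfl⟩ := h
  rw [← ModuleCat.comp_apply, K.iCycles_d]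
  rfl

lemma exists_isRep_of_d_eq_zero (x : K.X n) (hx : K.d n (n + 1) x = 0) :
    ∃ e, K.IsRep n e x := by
  let k : ModuleCat.of R R ⟶ K.X n := ModuleCat.ofHom (LinearMap.toSpanSingleton R _ x)
  have hk : k ≫ K.d n (n + 1) = 0 := by
    ext
    simpa [k] using hx
  refine ⟨_, K.liftCycles k (n + 1) (by simp) hk (1 : R), rfl, ?_⟩
  rw [← ModuleCat.comp_apply, K.liftCycles_i]
  simp [k]

lemma IsRep.eq_of_eq {e e' : K.homology n} {x : K.X n} (h : K.IsRep n e x)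
    (h' : K.IsRep n e' x) : e = e' := by
  obtain ⟨z, rfl, rfl⟩ := h
  obtain ⟨z', rfl, hz⟩ := h'
  rw [(ModuleCat.mono_iff_injective (K.iCycles n)).1 inferInstance hz]

lemma IsRep.add {e e' : K.homology n} {x x' : K.X n} (h : K.IsRep n e x)
    (h' : K.IsRep n e' x') : K.IsRep n (e + e') (x + x') := by
  obtain ⟨z, rfl, rfl⟩ := h
  obtain ⟨z', rfl, rfl⟩ := h'
  exact ⟨z + z', by simp, by simp⟩

lemma IsRep.smul {e : K.homology n} {x : K.X n} (h : K.IsRep n e x) (r : R) :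
    K.IsRep n (r • e) (r • x) := by
  obtain ⟨z, rfl, rfl⟩ := h
  exact ⟨r • z, by simp, by simp⟩

lemma IsRep.map {e : K.homology n} {x : K.X n} (h : K.IsRep n e x) (φ : K ⟶ L) :
    L.IsRep n (HomologicalComplex.homologyMap φ n e) (φ.f n x) := by
  obtain ⟨z, rfl, rfl⟩ := h
  refine ⟨HomologicalComplex.cyclesMap φ n z, ?_, ?_⟩
  · simp only [← ModuleCat.comp_apply, HomologicalComplex.homologyπ_naturality]
  · simp only [← ModuleCat.comp_apply, HomologicalComplex.cyclesMap_i]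

lemma isRep_zero_iff {p : ℕ} (hp : p + 1 = n) (x : K.X n) :
    K.IsRep n 0 x ↔ ∃ y, K.d p n y = x := by
  have hex := (ShortComplex.moduleCat_exact_iff _).1 (ShortComplex.exact_of_g_is_cokernel
    (ShortComplex.mk _ _ (K.toCycles_comp_homologyπ p n))
    (K.homologyIsCokernel p n (by simp [← hp])))
  constructor
  · rintro ⟨z, hz, rfl⟩
    obtain ⟨y, hy⟩ := hex z hz
    refine ⟨y, ?_⟩
    rw [← hy]
    change _ = (K.iCycles n) (K.toCycles p n y)
    rw [← ModuleCat.comp_apply, K.toCycles_i]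
  · rintro ⟨y, rfl⟩
    refine ⟨K.toCycles p n y, ?_, ?_⟩
    · rw [← ModuleCat.comp_apply, K.toCycles_comp_homologyπ]; rfl
    · rw [← ModuleCat.comp_apply, K.toCycles_i]

end CochainComplex

namespace CategoryTheory.ProjectiveResolution
variable {X X' Y : ModuleCat.{u} R} {n : ℕ}

/-- A cocycle representing a class in `Ext`, for a projective resolution. -/
def IsRep (P : ProjectiveResolution X) (e : ((Ext R (ModuleCat.{u} R) n).obj (op X)).obj Y)
    (f : P.complex.X n ⟶ Y) : Prop :=
  (P.complex.linearYonedaObj R Y).IsRep n ((P.isoExt n Y).hom e) f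

variable {P : ProjectiveResolution X}

lemma exists_isRep (f : P.complex.X n ⟶ Y) (hf : P.complex.d (n + 1) n ≫ f = 0) :
    ∃ e, P.IsRep e f := by
  obtain ⟨e, he⟩ := CochainComplex.exists_isRep_of_d_eq_zero
    (K := P.complex.linearYonedaObj R Y) (n := n) f hf
  refine ⟨(P.isoExt n Y).inv e, ?_⟩
  rw [IsRep, ← ModuleCat.comp_apply]
  simpa using he

lemma exists_isRep' (e : ((Ext R (ModuleCat.{u} R) n).obj (op X)).obj Y) :
    ∃ f : P.complex.X n ⟶ Y, P.complex.d (n + 1) n ≫ f = 0 ∧ P.IsRep e f := by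
  obtain ⟨x, hx⟩ := CochainComplex.exists_isRep ((P.isoExt n Y).hom e)
  exact ⟨x, hx.d_eq_zero (n + 1), hx⟩

lemma IsRep.eq_of_eq {e e' : ((Ext R (ModuleCat.{u} R) n).obj (op X)).obj Y}
    {f : P.complex.X n ⟶ Y} (h : P.IsRep e f) (h' : P.IsRep e' f) : e = e' :=
  (P.isoExt n Y).toLinearEquiv.injective (CochainComplex.IsRep.eq_of_eq h h')

lemma IsRep.add {e e' : ((Ext R (ModuleCat.{u} R) n).obj (op X)).obj Y}
    {f f' : P.complex.X n ⟶ Y} (h : P.IsRep e f) (h' : P.IsRep e' f') :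
    P.IsRep (e + e') (f + f') := by
  rw [IsRep, map_add]
  exact CochainComplex.IsRep.add h h'

lemma IsRep.smul {e : ((Ext R (ModuleCat.{u} R) n).obj (op X)).obj Y}
    {f : P.complex.X n ⟶ Y} (h : P.IsRep e f) (r : R) :
    P.IsRep (r • e) (r • f) := by
  rw [IsRep, map_smul]
  exact CochainComplex.IsRep.smul h r

lemma isRep_zero_iff {p : ℕ} (hp : p + 1 = n) (f : P.complex.X n ⟶ Y) :
    P.IsRep 0 f ↔ ∃ g, P.complex.d n p ≫ g = f := by
  rw [IsRep, map_zero]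
  exact CochainComplex.isRep_zero_iff hp _

lemma IsRep.map {Q : ProjectiveResolution X'} {g : X ⟶ X'}
    {e : ((Ext R (ModuleCat.{u} R) n).obj (op X')).obj Y}
    {f : Q.complex.X n ⟶ Y} (h : Q.IsRep e f) (φ : ProjectiveResolution.Hom P Q g) :
    P.IsRep (((Ext R (ModuleCat.{u} R) n).map g.op).app Y e) (φ.hom.f n ≫ f) := by
  rw [IsRep, ← ModuleCat.comp_apply, isoExt_naturality g P Q φ.hom φ.hom_f_zero_comp_π_f_zero]
  exact CochainComplex.IsRep.map h _

end CategoryTheory.ProjectiveResolution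

namespace CategoryTheory.Abelian

variable {X X' Y : ModuleCat.{u} R} {n : ℕ}

open ProjectiveResolution

lemma exists_ext_isRep (α : Abelian.Ext X Y n) : ∃ (f : (projectiveResolution X).complex.X n ⟶ Y)
    (hf : (projectiveResolution X).complex.d (n + 1) n ≫ f = 0)
    (e : ((_root_.Ext R (ModuleCat.{u} R) n).obj (op X)).obj Y),
    (projectiveResolution X).extMk f (n + 1) rfl hf = α ∧ (projectiveResolution X).IsRep e f := by
  obtain ⟨f, hf, h⟩ := (projectiveResolution X).extMk_surjective α (n + 1) rfl
  obtain ⟨e, he⟩ := exists_isRep f hf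
  exact ⟨f, hf, e, h, he⟩

/-- The comparison between the two definitions of `Ext` groups. -/
noncomputable def extToLeftDerived (α : Abelian.Ext X Y n) :
    ((_root_.Ext R (ModuleCat.{u} R) n).obj (op X)).obj Y :=
  (exists_ext_isRep α).choose_spec.choose_spec.choose

lemma isRep_of_extMk_eq (hn : n ≠ 0) {P : ProjectiveResolution X}
    {e : ((_root_.Ext R (ModuleCat.{u} R) n).obj (op X)).obj Y} {f f' : P.complex.X n ⟶ Y}
    (hf : P.complex.d (n + 1) n ≫ f = 0) (hf' : P.complex.d (n + 1) n ≫ f' = 0)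
    (h : P.extMk f' (n + 1) rfl hf' = P.extMk f (n + 1) rfl hf) (h' : P.IsRep e f') :
    P.IsRep e f := by
  obtain ⟨p, rfl⟩ := Nat.exists_eq_succ_of_ne_zero hn
  have h3 : P.extMk (f - f') (p + 1 + 1) rfl (by simp [hf, hf']) = 0 := by
    rw [← sub_extMk _ _ _ _ _ hf hf', h, sub_self]
  rw [extMk_eq_zero_iff _ _ _ _ _ p rfl, ← isRep_zero_iff rfl] at h3
  simpa using h3.add h'

lemma extToLeftDerived_extMk (hn : n ≠ 0) (f : (projectiveResolution X).complex.X n ⟶ Y)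
    (hf : (projectiveResolution X).complex.d (n + 1) n ≫ f = 0) :
    (projectiveResolution X).IsRep
      (extToLeftDerived ((projectiveResolution X).extMk f (n + 1) rfl hf)) f := by
  obtain ⟨h1, h2⟩ := (exists_ext_isRep
    ((projectiveResolution X).extMk f (n + 1) rfl hf)).choose_spec.choose_spec.choose_spec
  exact isRep_of_extMk_eq hn hf _ h1 h2

variable (R X Y) in
/-- The comparison between the two definitions of `Ext` groups, in positive degrees. -/
noncomputable def extLinearEquiv (hn : n ≠ 0) :
    Abelian.Ext X Y n ≃ₗ[R] ((_root_.Ext R (ModuleCat.{u} R) n).obj (op X)).obj Y :=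
  LinearEquiv.ofBijective
    { toFun := extToLeftDerived
      map_add' α β := by
        obtain ⟨f, hf, rfl⟩ := (projectiveResolution X).extMk_surjective α (n + 1) rfl
        obtain ⟨g, hg, rfl⟩ := (projectiveResolution X).extMk_surjective β (n + 1) rfl
        rw [add_extMk]
        exact (extToLeftDerived_extMk hn _ _).eq_of_eq
          ((extToLeftDerived_extMk hn _ _).add (extToLeftDerived_extMk hn _ _))
      map_smul' r α := by
        obtain ⟨f, hf, rfl⟩ := (projectiveResolution X).extMk_surjective α (n + 1) rfl
        rw [Ext.smul_eq_comp_mk₀, extMk_comp_mk₀]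
        refine (extToLeftDerived_extMk hn _ _).eq_of_eq ?_
        simpa using (extToLeftDerived_extMk hn _ _).smul r }
    (by
      constructor
      · rw [injective_iff_map_eq_zero]
        intro α h
        obtain ⟨f, hf, rfl⟩ := (projectiveResolution X).extMk_surjective α (n + 1) rfl
        obtain ⟨p, rfl⟩ := Nat.exists_eq_succ_of_ne_zero hn
        rw [extMk_eq_zero_iff _ _ _ _ _ p rfl, ← isRep_zero_iff rfl]
        rw [← show extToLeftDerived ((projectiveResolution X).extMk f _ rfl hf) = 0 from h]
        exact extToLeftDerived_extMk hn _ _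
      · intro e
        obtain ⟨f, hf, h⟩ := exists_isRep' (P := projectiveResolution X) e
        exact ⟨(projectiveResolution X).extMk f (n + 1) rfl hf,
          (extToLeftDerived_extMk hn _ _).eq_of_eq h⟩)

lemma extLinearEquiv_mk₀_comp (hn : n ≠ 0) (g : X ⟶ X') (α : Abelian.Ext X' Y n) :
    extLinearEquiv R X Y hn ((Ext.mk₀ g).comp α (zero_add n)) =
      ((_root_.Ext R (ModuleCat.{u} R) n).map g.op).app Y (extLinearEquiv R X' Y hn α) := by
  obtain ⟨f, hf, rfl⟩ := (projectiveResolution X').extMk_surjective α (n + 1) rfl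
  let φ : ProjectiveResolution.Hom (projectiveResolution X) (projectiveResolution X') g :=
    ⟨lift g _ _, lift_commutes_zero g _ _⟩
  rw [mk₀_comp_extMk _ _ _ _ φ]
  exact (extToLeftDerived_extMk hn _ _).eq_of_eq ((extToLeftDerived_extMk hn _ _).map φ)

end CategoryTheory.Abelian

section TopExt

open CategoryTheory.Abelian

/-- The ideal generated by the first `j` elements of a sequence. -/
def Ideal.ofFirst (y : ℕ → R) : ℕ → Ideal R
  | 0 => ⊥
  | j + 1 => Ideal.ofFirst y j ⊔ Ideal.span {y j}

/-- The transition map between cyclic modules. -/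
abbrev ModuleCat.quotientMap {A B : Ideal R} (h : A ≤ B) :
    ModuleCat.of R (R ⧸ A) ⟶ ModuleCat.of R (R ⧸ B) :=
  ModuleCat.ofHom (Submodule.mapQ A B LinearMap.id h)

/-- The short complex `R/B → R/B → R/(B + (y))` whose first map is multiplication by `y`. -/
abbrev ModuleCat.mulShortComplex (B : Ideal R) (y : R) : ShortComplex (ModuleCat.{u} R) where
  X₁ := ModuleCat.of R (R ⧸ B)
  X₂ := ModuleCat.of R (R ⧸ B)
  X₃ := ModuleCat.of R (R ⧸ (B ⊔ Ideal.span {y}))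
  f := y • 𝟙 _
  g := ModuleCat.quotientMap le_sup_left
  zero := by
    ext
    simp only [ModuleCat.hom_comp, ModuleCat.hom_smul, LinearMap.comp_apply,
      LinearMap.smul_apply, ModuleCat.hom_id, LinearMap.id_apply, ModuleCat.hom_ofHom,
      Submodule.mkQ_apply, map_smul, Submodule.mapQ_apply, ModuleCat.hom_zero,
      LinearMap.zero_apply]
    rw [← Submodule.Quotient.mk_smul, Submodule.Quotient.mk_eq_zero]
    exact le_sup_right (a := B) (Ideal.mul_mem_right _ _ (Ideal.mem_span_singleton_self y))

lemma ModuleCat.mulShortComplex_shortExact {B : Ideal R} {y : R}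
    (h : ∀ r, y * r ∈ B → r ∈ B) : (ModuleCat.mulShortComplex B y).ShortExact := by
  apply ModuleCat.shortComplex_shortExact
  · rintro ⟨r⟩
    change (Submodule.mapQ B (B ⊔ Ideal.span {y}) LinearMap.id le_sup_left
      (Submodule.Quotient.mk r)) = 0 ↔ Submodule.Quotient.mk r ∈ Set.range _
    rw [Submodule.mapQ_apply, Submodule.Quotient.mk_eq_zero, LinearMap.id_apply,
      Submodule.mem_sup]
    constructor
    · rintro ⟨b, hb, c, hc, rfl⟩
      obtain ⟨s, rfl⟩ := Ideal.mem_span_singleton.1 hc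
      refine ⟨Submodule.Quotient.mk s, ?_⟩
      change y • (Submodule.Quotient.mk s : R ⧸ B) = _
      rw [← Submodule.Quotient.mk_smul, Submodule.Quotient.eq]
      simpa using neg_mem hb
    · rintro ⟨⟨s⟩, hs⟩
      change y • (Submodule.Quotient.mk s : R ⧸ B) = _ at hs
      rw [← Submodule.Quotient.mk_smul, Submodule.Quotient.eq] at hs
      exact ⟨r - y * s, by simpa using neg_mem hs, y * s,
        Ideal.mul_mem_right _ _ (Ideal.mem_span_singleton_self y), by ring⟩
  · change Function.Injective (ModuleCat.Hom.hom _)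
    rw [injective_iff_map_eq_zero]
    rintro ⟨s⟩ hs
    change y • (Submodule.Quotient.mk s : R ⧸ B) = 0 at hs
    rw [← Submodule.Quotient.mk_smul, Submodule.Quotient.mk_eq_zero] at hs
    exact (Submodule.Quotient.mk_eq_zero B).2 (h _ hs)
  · rintro ⟨r⟩
    exact ⟨Submodule.Quotient.mk r, rfl⟩

lemma Ideal.ofFirst_le {y y' z : ℕ → R} (h : ∀ i, y' i = y i * z i) (j : ℕ) :
    Ideal.ofFirst y' j ≤ Ideal.ofFirst y j := by
  induction j with
  | zero => exact le_rfl
  | succ j ih =>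
    refine sup_le_sup ih ?_
    rw [Ideal.span_singleton_le_span_singleton, h]
    exact dvd_mul_right _ _

/-- The top `Ext` of a quotient by a regular sequence, together with the transition maps. -/
lemma exists_linearMap_ext_ofFirst (M : ModuleCat.{u} R) (y : ℕ → ℕ → R) (z : ℕ → R)
    (hyz : ∀ t i, y (t + 1) i = y t i * z i) (n : ℕ)
    (hreg : ∀ t, ∀ j < n, ∀ r, y t j * r ∈ Ideal.ofFirst (y t) j → r ∈ Ideal.ofFirst (y t) j)
    (j : ℕ) (hj : j ≤ n) :
    (∀ t, HasProjectiveDimensionLT (ModuleCat.of R (R ⧸ Ideal.ofFirst (y t) j)) (j + 1)) ∧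
    ∃ θ : ∀ t, M →ₗ[R] Ext (ModuleCat.of R (R ⧸ Ideal.ofFirst (y t) j)) M j,
      (∀ t, Function.Surjective (θ t)) ∧
      (∀ t m, θ t m = 0 ↔ m ∈ Ideal.ofFirst (y t) j • (⊤ : Submodule R M)) ∧
      ∀ t m, (Ext.mk₀ (ModuleCat.quotientMap (Ideal.ofFirst_le (hyz t) j))).comp (θ t m)
        (zero_add j) = θ (t + 1) ((∏ i ∈ Finset.range j, z i) • m) := by
  induction j with
  | zero =>
    have hb : ∀ t, Ideal.ofFirst (y t) 0 = ⊥ := fun t => rfl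
    let θ : ∀ t, M ≃ₗ[R] Ext (ModuleCat.of R (R ⧸ Ideal.ofFirst (y t) 0)) M 0 := fun t =>
      ((LinearMap.ringLmapEquivSelf R R M).symm.trans
        (LinearEquiv.congrLeft M R (Submodule.quotEquivOfEqBot _ (hb t)).symm)).trans
          ((ModuleCat.homLinearEquiv (S := R) (M := ModuleCat.of R (R ⧸ Ideal.ofFirst (y t) 0))
            (N := M)).symm.trans (Ext.linearEquiv₀ (R := R)).symm)
    refine ⟨fun t => ?_, fun t => (θ t).toLinearMap, fun t => (θ t).surjective, fun t m => ?_,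
      fun t m => ?_⟩
    · have : Module.Projective R (R ⧸ Ideal.ofFirst (y t) 0) :=
        Module.Projective.of_equiv (Submodule.quotEquivOfEqBot _ (hb t)).symm
      infer_instance
    · simp [hb]
    · simp only [θ, LinearEquiv.coe_coe, LinearEquiv.trans_apply, Ext.linearEquiv₀_symm_apply,
        Ext.mk₀_comp_mk₀, Finset.range_zero, Finset.prod_empty, one_smul]
      congr 1
      ext
      rfl
  | succ j ih =>
    obtain ⟨hpd, θ, hsurj, hker, hcompat⟩ := ih (by lia)
    have hS t := ModuleCat.mulShortComplex_shortExact (hreg t j (by lia))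
    have hf : ∀ t (β : Ext (ModuleCat.of R (R ⧸ Ideal.ofFirst (y t) j)) M j),
        (Ext.mk₀ (ModuleCat.mulShortComplex (Ideal.ofFirst (y t) j) (y t j)).f).comp β
          (zero_add j) = y t j • β := by
      intro t β
      rw [Ext.mk₀_smul, Ext.smul_comp, Ext.mk₀_id_comp]
    refine ⟨fun t => ?_, fun t => Ext.precompOfLinear (hS t).extClass R M (add_comm 1 j) ∘ₗ θ t,
      fun t e => ?_, fun t m => ?_, fun t m => ?_⟩
    · have := hpd t
      exact (hS t).hasProjectiveDimensionLT_X₃ (j + 1) this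
        (hasProjectiveDimensionLT_of_ge
          (ModuleCat.of R (R ⧸ Ideal.ofFirst (y t) j)) (j + 1) (j + 1 + 1) (by lia))
    · obtain ⟨e', rfl⟩ := Ext.contravariant_sequence_exact₃ (hS t) M e
        (@Ext.eq_zero_of_hasProjectiveDimensionLT _ _ _ _ _ _ _ _ _ (hpd t) le_rfl) (add_comm 1 j)
      obtain ⟨m, rfl⟩ := hsurj t e'
      exact ⟨m, rfl⟩
    · have key : (hS t).extClass.comp (θ t m) (add_comm 1 j) = 0 ↔
          ∃ m', θ t (m - y t j • m') = 0 := by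
        constructor
        · intro h
          obtain ⟨e, he⟩ := Ext.contravariant_sequence_exact₁ (hS t) M _ _ h
          obtain ⟨m', rfl⟩ := hsurj t e
          refine ⟨m', ?_⟩
          rw [map_sub, ← he, map_smul, hf, sub_self]
        · rintro ⟨m', h⟩
          rw [map_sub, sub_eq_zero] at h
          rw [h, map_smul, ← hf, ← Ext.comp_assoc _ _ _ (add_zero 1) _ (by lia)]
          erw [(hS t).extClass_comp]
          simp
      change (hS t).extClass.comp (θ t m) (add_comm 1 j) = 0 ↔ _
      rw [key]
      simp only [hker, Ideal.ofFirst, Submodule.sup_smul, Submodule.mem_sup,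
        Submodule.ideal_span_singleton_smul, Submodule.mem_smul_pointwise_iff_exists,
        Submodule.mem_top, true_and]
      constructor
      · rintro ⟨m', h⟩
        exact ⟨_, h, _, ⟨m', rfl⟩, by simp⟩
      · rintro ⟨a, ha, _, ⟨m', rfl⟩, rfl⟩
        exact ⟨m', by simpa using ha⟩
    · let φ : ModuleCat.mulShortComplex (Ideal.ofFirst (y (t + 1)) j) (y (t + 1) j) ⟶
          ModuleCat.mulShortComplex (Ideal.ofFirst (y t) j) (y t j) :=
        { τ₁ := z j • ModuleCat.quotientMap (Ideal.ofFirst_le (hyz t) j)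
          τ₂ := ModuleCat.quotientMap (Ideal.ofFirst_le (hyz t) j)
          τ₃ := ModuleCat.quotientMap (Ideal.ofFirst_le (hyz t) (j + 1))
          comm₁₂ := by
            simp only [Linear.smul_comp, Linear.comp_smul, Category.comp_id, Category.id_comp,
              smul_smul, hyz]
          comm₂₃ := by
            ext
            rfl }
      have h := ShortComplex.ShortExact.extClass_naturality (hS (t + 1)) (hS t) φ
      change (Ext.mk₀ φ.τ₃).comp ((hS t).extClass.comp (θ t m) (add_comm 1 j)) _ =
        (hS (t + 1)).extClass.comp (θ (t + 1) _) (add_comm 1 j)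
      rw [← Ext.comp_assoc _ _ _ (zero_add 1) (add_comm 1 j) (by lia), ← h,
        Ext.comp_assoc _ _ _ (add_zero 1) (zero_add j) (by lia)]
      congr 1
      change (Ext.mk₀ (z j • ModuleCat.quotientMap (Ideal.ofFirst_le (hyz t) j))).comp _ _ = _
      rw [Ext.mk₀_smul, Ext.smul_comp, hcompat, ← map_smul, smul_smul, Finset.prod_range_succ,
        mul_comm]

end TopExt

namespace localCohomology

open CategoryTheory.Abelian

variable {J : Ideal R} {A : ℕ → Ideal R}

/-- A decreasing sequence of ideals whose radicals contain `J`. -/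
def seqToSelfLERadical (hA : Antitone A) (hJA : ∀ t, J ≤ (A t).radical) :
    ℕᵒᵖ ⥤ SelfLERadical J :=
  ObjectProperty.lift _
    { obj := fun t => A (unop t)
      map := fun w => ⟨⟨hA w.unop.down.down⟩⟩ } (fun t => hJA (unop t))

lemma seqToSelfLERadical_initial (hA : Antitone A) (hJA : ∀ t, J ≤ (A t).radical)
    (hcof : ∀ J' : Ideal R, J ≤ J'.radical → ∃ t, A t ≤ J') :
    (seqToSelfLERadical hA hJA).Initial where
  out J' := by
    apply +allowSynthFailures zigzag_isConnected
    · obtain ⟨k, hk⟩ := hcof J'.1 J'.2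
      exact ⟨CostructuredArrow.mk (⟨⟨⟨hk⟩⟩⟩ : (seqToSelfLERadical hA hJA).obj (op k) ⟶ J')⟩
    · intro j1 j2
      apply Relation.ReflTransGen.single
      rcases le_total (unop j1.left) (unop j2.left) with h | h
      · right; exact ⟨CostructuredArrow.homMk (homOfLE h).op rfl⟩
      · left; exact ⟨CostructuredArrow.homMk (homOfLE h).op rfl⟩

lemma exists_map_eq_zero {K : Type} [SmallCategory K] [IsFiltered K] {E : K ⥤ ModuleCat.{u} R}
    {c : Cocone E} (hc : IsColimit c) {k : K} (y : E.obj k) (hy : c.ι.app k y = 0) :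
    ∃ (l : K) (f : k ⟶ l), E.map f y = 0 := by
  have : PreservesFilteredColimitsOfSize.{0, 0} (forget (ModuleCat.{u} R)) :=
    preservesFilteredColimitsOfSize_shrink.{0, u, 0, u} _
  obtain ⟨l, f, g, h⟩ := Concrete.isColimit_exists_of_rep_eq E hc y (0 : E.obj k)
    (hy.trans (map_zero _).symm)
  exact ⟨l, f, h.trans (map_zero _)⟩

lemma exists_ext_to_localCohomology [IsNoetherianRing R] (hA : Antitone A)
    (hJA : ∀ t, J ≤ (A t).radical)
    (hcof : ∀ J' : Ideal R, J ≤ J'.radical → ∃ t, A t ≤ J') (n : ℕ) (hn : n ≠ 0)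
    (M : ModuleCat.{u} R) :
    ∃ γ : ∀ t, Ext (ModuleCat.of R (R ⧸ A t)) M n →ₗ[R] (localCohomology J n).obj M,
      (∀ h, ∃ t e, γ t e = h) ∧
      (∀ t s (hts : t ≤ s) e, γ s ((Ext.mk₀ (ModuleCat.quotientMap (hA hts))).comp e (zero_add n))
        = γ t e) ∧
      (∀ t e, γ t e = 0 → ∃ s, ∃ hts : t ≤ s,
        (Ext.mk₀ (ModuleCat.quotientMap (hA hts))).comp e (zero_add n) = 0) := by
  have := seqToSelfLERadical_initial hA hJA hcof
  have := hasColimitDiagram (seqToSelfLERadical hA hJA ⋙ selfLERadicalDiagram J) n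
  let D := diagram (seqToSelfLERadical hA hJA ⋙ selfLERadicalDiagram J) n
  let i : (colimit D).obj M ≅ (localCohomology J n).obj M :=
    ((isoOfFinal.{u, u, 0} (seqToSelfLERadical hA hJA) (selfLERadicalDiagram J) n).trans
      (isoSelfLERadical J n)).app M
  have hc := isColimitOfPreserves ((evaluation _ _).obj M) (colimit.isColimit D)
  let γ' (t : ℕ) : Ext (ModuleCat.of R (R ⧸ A t)) M n →ₗ[R] (colimit D).obj M :=
    (((colimit.ι D (op (op t))).app M).hom ∘ₗ
      (extLinearEquiv R (ModuleCat.of R (R ⧸ A t)) M hn).toLinearMap)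
  let γ (t : ℕ) : Ext (ModuleCat.of R (R ⧸ A t)) M n →ₗ[R] (localCohomology J n).obj M :=
    i.toLinearEquiv.toLinearMap ∘ₗ γ' t
  have hγ : ∀ t s (hts : t ≤ s) e,
      γ' s ((Ext.mk₀ (ModuleCat.quotientMap (hA hts))).comp e (zero_add n)) = γ' t e := by
    intro t s hts e
    have h := congrArg (fun f => f.app M) (colimit.w D (homOfLE hts).op.op)
    exact (congrArg ((colimit.ι D (op (op s))).app M) (extLinearEquiv_mk₀_comp hn _ e)).trans
      (congrArg (fun f => f (extLinearEquiv R (ModuleCat.of R (R ⧸ A t)) M hn e)) h)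
  have : PreservesFilteredColimitsOfSize.{0, 0} (forget (ModuleCat.{u} R)) :=
    preservesFilteredColimitsOfSize_shrink.{0, u, 0, u} _
  refine ⟨γ, fun h => ?_, fun t s hts e => ?_, fun t e he => ?_⟩
  · obtain ⟨k, y, hy⟩ := Concrete.isColimit_exists_rep _ hc (i.toLinearEquiv.symm h)
    obtain ⟨e, rfl⟩ := (extLinearEquiv R (ModuleCat.of R (R ⧸ A (unop (unop k)))) M hn).surjective y
    refine ⟨unop (unop k), e, ?_⟩
    exact i.toLinearEquiv.eq_symm_apply.1 hy
  · exact congrArg i.toLinearEquiv (hγ t s hts e)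
  · have he' : γ' t e = 0 := (LinearEquiv.map_eq_zero_iff i.toLinearEquiv).1 he
    obtain ⟨k, f, hf⟩ := exists_map_eq_zero hc (k := op (op t))
      (extLinearEquiv R (ModuleCat.of R (R ⧸ A t)) M hn e) he'
    refine ⟨unop (unop k), leOfHom f.unop.unop, ?_⟩
    exact (LinearEquiv.map_eq_zero_iff (extLinearEquiv R _ M hn)).1
      ((extLinearEquiv_mk₀_comp hn _ e).trans hf)

end localCohomology

open CategoryTheory.Abelian
lemma ModuleCat.quotientMap_refl (A : Ideal R) : ModuleCat.quotientMap (le_refl A) = 𝟙 _ := by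
  ext
  rfl

lemma ModuleCat.quotientMap_comp {A B C : Ideal R} (h₁ : A ≤ B) (h₂ : B ≤ C) :
    ModuleCat.quotientMap h₁ ≫ ModuleCat.quotientMap h₂ =
      ModuleCat.quotientMap (h₁.trans h₂) := by
  ext
  rfl

/-- Local cohomology at a cofinal family of ideals generated by regular sequences. -/
lemma localCohomology.exists_presentation [IsNoetherianRing R] {J : Ideal R} (M : ModuleCat.{u} R)
    (y : ℕ → ℕ → R) (z : ℕ → R) (hyz : ∀ t i, y (t + 1) i = y t i * z i) (n : ℕ) (hn : n ≠ 0)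
    (hreg : ∀ t, ∀ j < n, ∀ r, y t j * r ∈ Ideal.ofFirst (y t) j → r ∈ Ideal.ofFirst (y t) j)
    (hJ : ∀ t, J ≤ (Ideal.ofFirst (y t) n).radical)
    (hcof : ∀ J' : Ideal R, J ≤ J'.radical → ∃ t, Ideal.ofFirst (y t) n ≤ J') :
    ∃ β : ℕ → M →ₗ[R] (localCohomology J n).obj M,
      (∀ h, ∃ t m, β t m = h) ∧
      (∀ t m, β (t + 1) ((∏ i ∈ Finset.range n, z i) • m) = β t m) ∧
      ∀ t m, β t m = 0 ↔ ∃ s, (∏ i ∈ Finset.range n, z i) ^ s • m ∈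
        Ideal.ofFirst (y (t + s)) n • (⊤ : Submodule R M) := by
  have hA : Antitone fun t => Ideal.ofFirst (y t) n :=
    antitone_nat_of_succ_le fun t => Ideal.ofFirst_le (hyz t) n
  obtain ⟨-, θ, hsurj, hker, hcompat⟩ := exists_linearMap_ext_ofFirst M y z hyz n hreg n le_rfl
  generalize hZ : (∏ i ∈ Finset.range n, z i) = Z at hcompat ⊢
  obtain ⟨γ, hγsurj, hγcompat, hγker⟩ :=
    localCohomology.exists_ext_to_localCohomology (J := J) hA hJ hcof n hn M
  have hcompat' (t s : ℕ) (m : M) :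
      (Ext.mk₀ (ModuleCat.quotientMap (hA (Nat.le_add_right t s)))).comp (θ t m)
        (zero_add n) = θ (t + s) (Z ^ s • m) := by
    induction s with
    | zero =>
      have h : ModuleCat.quotientMap (hA (Nat.le_add_right t 0)) = 𝟙 _ :=
        ModuleCat.quotientMap_refl _
      rw [pow_zero, one_smul]
      exact (congrArg (fun g => (Ext.mk₀ g).comp (θ t m) (zero_add n)) h).trans (Ext.mk₀_id_comp _)
    | succ s ih =>
      have h : ModuleCat.quotientMap (hA (Nat.le_add_right t (s + 1))) =
        ModuleCat.quotientMap (Ideal.ofFirst_le (hyz (t + s)) n) ≫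
          ModuleCat.quotientMap (hA (Nat.le_add_right t s)) :=
        (ModuleCat.quotientMap_comp _ _).symm
      rw [pow_succ', mul_smul]
      refine Eq.trans ?_ (hcompat (t + s) _)
      rw [← ih, Ext.mk₀_comp_mk₀_assoc]
      exact congrArg (fun g => (Ext.mk₀ g).comp (θ t m) (zero_add n)) h
  have hβ (t s : ℕ) (m : M) : γ (t + s) (θ (t + s) (Z ^ s • m)) = γ t (θ t m) := by
    rw [← hγcompat t (t + s) (Nat.le_add_right t s), hcompat']
  refine ⟨fun t => γ t ∘ₗ θ t, fun h => ?_, fun t r => ?_, fun t r => ⟨fun h => ?_, ?_⟩⟩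
  · obtain ⟨t, e, rfl⟩ := hγsurj h
    obtain ⟨m, rfl⟩ := hsurj t e
    exact ⟨t, m, rfl⟩
  · simpa using hβ t 1 r
  · obtain ⟨s, hs, h⟩ := hγker t (θ t r) h
    obtain ⟨s, rfl⟩ := Nat.exists_eq_add_of_le hs
    refine ⟨s, ?_⟩
    rwa [← hker, ← hcompat']
  · rintro ⟨s, h⟩
    rw [← hker] at h
    change γ t (θ t r) = 0
    rw [← hβ t s, h, map_zero]

end ExtAndLocalCohomology

lemma Ideal.mkQ_mem_smul_top_iff {R : Type*} [CommRing R] (A B : Ideal R) (r : R) :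
    B.mkQ r ∈ A • (⊤ : Submodule R (R ⧸ B)) ↔ r ∈ A ⊔ B := by
  have h : A • (⊤ : Submodule R (R ⧸ B)) = Submodule.map B.mkQ A := by
    rw [← B.range_mkQ, LinearMap.range_eq_map, ← Submodule.map_smul'']
    simp
  rw [h, ← Submodule.mem_comap, Submodule.comap_map_eq, Submodule.ker_mkQ]

namespace MvPolynomial

variable {T : Type u} [CommRing T] {n : ℕ}

variable (T n) in
/-- The ideal generated by the `t`-th powers of the variables. -/
noncomputable def powIdeal (t : ℕ) : Ideal (MvPolynomial (Fin n) T) :=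
  Ideal.span ((fun v => monomial v (1 : T)) '' Set.range fun i => Finsupp.single i t)

variable (T n) in
/-- The powers of the variables, as an infinite sequence. -/
noncomputable def powSeq (t i : ℕ) : MvPolynomial (Fin n) T :=
  if h : i < n then X ⟨i, h⟩ ^ t else 1

lemma ofFirst_powSeq (t j : ℕ) (hj : j ≤ n) : Ideal.ofFirst (powSeq T n t) j =
    Ideal.span ((fun v => monomial v (1 : T)) ''
      ((fun i => Finsupp.single i t) '' {i : Fin n | i < j})) := by
  induction j with
  | zero => simp [Ideal.ofFirst]
  | succ j ih =>
    rw [Ideal.ofFirst, ih (by lia), ← Ideal.span_union]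
    have h : powSeq T n t j = monomial (Finsupp.single ⟨j, by lia⟩ t) (1 : T) := by
      rw [powSeq, dif_pos (by lia), X_pow_eq_monomial]
    have h2 : {i : Fin n | i < j + 1} = insert ⟨j, by lia⟩ {i : Fin n | i < j} := by
      ext i
      simp only [Set.mem_ofPred_eq, Set.mem_insert_iff, Fin.ext_iff]
      lia
    rw [h, h2, Set.image_insert_eq, Set.image_insert_eq, Set.union_singleton]

lemma ofFirst_powSeq_self (t : ℕ) : Ideal.ofFirst (powSeq T n t) n = powIdeal T n t := by
  rw [ofFirst_powSeq t n le_rfl, powIdeal]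
  simp

lemma powSeq_regular (t j : ℕ) (hj : j < n) (r : MvPolynomial (Fin n) T)
    (h : powSeq T n t j * r ∈ Ideal.ofFirst (powSeq T n t) j) :
    r ∈ Ideal.ofFirst (powSeq T n t) j := by
  rw [ofFirst_powSeq t j hj.le, mem_ideal_span_monomial_image] at h ⊢
  intro v hv
  rw [powSeq, dif_pos hj, X_pow_eq_monomial] at h
  obtain ⟨_, ⟨i, hi, rfl⟩, hle⟩ := h (Finsupp.single ⟨j, hj⟩ t + v) (by
    rwa [mem_support_iff, coeff_monomial_mul, one_mul, ← mem_support_iff])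
  refine ⟨_, ⟨i, hi, rfl⟩, ?_⟩
  have hne : (⟨j, hj⟩ : Fin n) ≠ i := fun h => by
    rw [← h] at hi
    exact lt_irrefl j hi
  rw [Finsupp.single_le_iff] at hle ⊢
  simpa [Finsupp.single_eq_of_ne hne.symm] using hle

lemma prod_powSeq : ∏ i ∈ Finset.range n, powSeq T n 1 i = ∏ i, X i := by
  rw [Finset.prod_range]
  simp [powSeq]

lemma X_pow_mem_powIdeal (i : Fin n) (t : ℕ) :
    (X i : MvPolynomial (Fin n) T) ^ t ∈ powIdeal T n t := by
  rw [X_pow_eq_monomial]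
  exact Ideal.subset_span ⟨_, ⟨i, rfl⟩, rfl⟩

lemma powIdeal_le_iff {t : ℕ} {J : Ideal (MvPolynomial (Fin n) T)} :
    powIdeal T n t ≤ J ↔ ∀ i, X i ^ t ∈ J := by
  rw [powIdeal, Ideal.span_le]
  simp [Set.subset_def, X_pow_eq_monomial]

/-- A presentation of the top local cohomology of a quotient of a polynomial ring. -/
lemma exists_localCohomology_presentation [IsNoetherianRing T] (hn : n ≠ 0)
    (f : MvPolynomial (Fin n) T) :
    ∃ β : ℕ → (MvPolynomial (Fin n) T →ₗ[MvPolynomial (Fin n) T]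
      (localCohomology (Ideal.span (Set.range (X : Fin n → MvPolynomial (Fin n) T))) n).obj
        (ModuleCat.of (MvPolynomial (Fin n) T) (MvPolynomial (Fin n) T ⧸ Ideal.span {f}))),
      (∀ h, ∃ t r, β t r = h) ∧
      (∀ t r, β (t + 1) ((∏ i, X i) * r) = β t r) ∧
      (∀ t r, β t r = 0 ↔ ∃ s, (∏ i, X i) ^ s * r ∈ powIdeal T n (t + s) ⊔ Ideal.span {f}) := by
  have hseq (t i) : powSeq T n (t + 1) i = powSeq T n t i * powSeq T n 1 i := by
    unfold powSeq
    split_ifs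
    · rw [pow_one, pow_succ]
    · rw [mul_one]
  obtain ⟨β, hβsurj, hβcompat, hβker⟩ := localCohomology.exists_presentation
    (J := Ideal.span (Set.range (X : Fin n → MvPolynomial (Fin n) T)))
    (ModuleCat.of (MvPolynomial (Fin n) T) (MvPolynomial (Fin n) T ⧸ Ideal.span {f}))
    (powSeq T n) (powSeq T n 1) hseq n hn (fun t j hj r => powSeq_regular t j hj r)
    (fun t => by
      rw [Ideal.span_le]
      rintro _ ⟨i, rfl⟩
      refine ⟨t, ?_⟩
      rw [ofFirst_powSeq_self]
      exact X_pow_mem_powIdeal i t)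
    (fun J' hJ' => by
      obtain ⟨k, hk⟩ := Ideal.exists_pow_le_of_le_radical_of_fg hJ' (IsNoetherian.noetherian _)
      refine ⟨k, ?_⟩
      rw [ofFirst_powSeq_self, powIdeal_le_iff]
      exact fun i => hk (Ideal.pow_mem_pow (Ideal.subset_span (Set.mem_range_self i)) k))
  rw [prod_powSeq] at hβcompat hβker
  have hq := Submodule.mkQ_surjective (Ideal.span {f})
  refine ⟨fun t => β t ∘ₗ (Ideal.span {f}).mkQ, fun h => ?_, fun t r => ?_, fun t r => ?_⟩
  · obtain ⟨t, m, rfl⟩ := hβsurj h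
    obtain ⟨r, rfl⟩ := hq m
    exact ⟨t, r, rfl⟩
  · exact hβcompat t ((Ideal.span {f}).mkQ r)
  · refine (hβker t _).trans (exists_congr fun s => ?_)
    rw [ofFirst_powSeq_self]
    exact Ideal.mkQ_mem_smul_top_iff _ _ _

end MvPolynomial

lemma Ideal.exists_smul_eq_zero_imp_mem_range {R : Type u} [CommRing R] {I : Ideal R} {H M : Type*}
    [AddCommGroup H] [Module R H] [AddCommGroup M] [Module R M] (β : ℕ → M →ₗ[R] H)
    (hsurj : ∀ h, ∃ t m, β t m = h) (hmono : Monotone fun t => LinearMap.range (β t))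
    (hfin : Module.Finite R ((R ⧸ I) →ₗ[R] H)) :
    ∃ t, ∀ h : H, (∀ x ∈ I, x • h = 0) → ∃ m, β t m = h := by
  let ev : ((R ⧸ I) →ₗ[R] H) →ₗ[R] H := LinearMap.applyₗ (1 : R ⧸ I)
  let N : ℕ →o Submodule R ((R ⧸ I) →ₗ[R] H) :=
    ⟨fun t => (LinearMap.range (β t)).comap ev, fun t s h => Submodule.comap_mono (hmono h)⟩
  obtain ⟨t, ht⟩ := hfin.fg_top.stabilizes_of_iSup_eq N (by
    rw [eq_top_iff]
    intro φ _
    obtain ⟨t, m, h⟩ := hsurj (ev φ)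
    exact Submodule.mem_iSup_of_mem t ⟨m, h⟩)
  refine ⟨t, fun h hh => ?_⟩
  let φ : (R ⧸ I) →ₗ[R] H := Submodule.liftQ I (LinearMap.toSpanSingleton R H h) (by
    intro x hx
    simpa using hh x hx)
  have hφ : φ ∈ N t := ht ▸ Submodule.mem_top
  have h1 : ev φ = h := by
    change φ (Submodule.Quotient.mk 1) = h
    rw [Submodule.liftQ_apply, LinearMap.toSpanSingleton_apply, one_smul]
  rw [← h1]
  exact hφ

namespace MvPolynomial

variable {T : Type u} [CommRing T] {n : ℕ}

lemma isHomogeneous_prod_X_pow (s : ℕ) :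
    ((∏ i, X i : MvPolynomial (Fin n) T) ^ s).IsHomogeneous (n * s) := by
  have h := (IsHomogeneous.prod Finset.univ (fun i => (X i : MvPolynomial (Fin n) T)) (fun _ => 1)
    fun i _ => isHomogeneous_X T i).pow s
  simpa using h

lemma prod_univ_X_pow_eq_monomial (s : ℕ) : (∏ i, X i : MvPolynomial (Fin n) T) ^ s =
    monomial (Finsupp.equivFunOnFinite.symm fun _ => s) 1 := by
  rw [← Finset.prod_pow, monomial_eq, Finsupp.prod_fintype _ _ (fun i => pow_zero _)]
  simp

attribute [local instance] gradedAlgebra in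
lemma mul_mem_of_mul_sub_mem {J : Ideal (MvPolynomial (Fin n) T)}
    (hJ : J.IsHomogeneous (homogeneousSubmodule (Fin n) T)) {m g r r' : MvPolynomial (Fin n) T}
    {c e d : ℕ} (hm : m.IsHomogeneous c) (hg : g.IsHomogeneous e) (hr : r.IsHomogeneous d)
    (hde : d < e) (h : m * (r - g * r') ∈ J) : m * r ∈ J := by
  have h1 := hJ (c + d) h
  rw [DirectSum.coe_decompose_mul_add_of_left_mem _ hm, DirectSum.decompose_sub,
    DirectSum.sub_apply, Submodule.coe_sub, DirectSum.decompose_of_mem_same _ hr,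
    DirectSum.coe_decompose_mul_of_left_mem_of_not_le _ hg (by lia), sub_zero] at h1
  exact h1

attribute [local instance] gradedAlgebra in
lemma isHomogeneous_powIdeal_sup {f : MvPolynomial (Fin n) T} {p : ℕ} (hf : f.IsHomogeneous p)
    (t : ℕ) : (powIdeal T n t ⊔ Ideal.span {f}).IsHomogeneous (homogeneousSubmodule (Fin n) T) := by
  refine Ideal.IsHomogeneous.sup (Ideal.homogeneous_span _ _ ?_) (Ideal.homogeneous_span _ _ ?_)
  · rintro _ ⟨_, ⟨i, rfl⟩, rfl⟩
    exact ⟨_, isHomogeneous_monomial _ rfl⟩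
  · rintro _ rfl
    exact ⟨p, hf⟩

variable (n) in
/-- The exponent vector all of whose entries are `s`. -/
noncomputable def constExp (s : ℕ) : Fin n →₀ ℕ := Finsupp.equivFunOnFinite.symm fun _ => s

@[simp] lemma constExp_apply (s : ℕ) (i : Fin n) : constExp n s i = s := rfl

lemma constExp_add (s t : ℕ) : constExp n (s + t) = constExp n s + constExp n t := by
  ext i
  simp

lemma degree_constExp (s : ℕ) : (constExp n s).degree = n * s := by
  simp [Finsupp.degree_eq_sum]

/-- The weight of an exponent vector, giving the `i`-th variable weight `B ^ i`. -/
def expWeight (B : ℕ) (v : Fin n →₀ ℕ) : ℕ := ∑ i, v i * B ^ (i : ℕ)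

lemma expWeight_add (B : ℕ) (v w : Fin n →₀ ℕ) :
    expWeight B (v + w) = expWeight B v + expWeight B w := by
  simp [expWeight, add_mul, Finset.sum_add_distrib]

lemma eq_of_expWeight_eq {p : ℕ} {v w : Fin n →₀ ℕ} (hv : v.degree ≤ p) (hw : w.degree ≤ p)
    (h : expWeight (p + 1) v = expWeight (p + 1) w) : v = w := by
  have hlt {v : Fin n →₀ ℕ} (hv : v.degree ≤ p) (i) : v i < p + 1 :=
    Nat.lt_succ_of_le ((Finsupp.le_degree i v).trans hv)
  have h1 := finFunctionFinEquiv.injective (Fin.ext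
    ((finFunctionFinEquiv_apply fun i => ⟨v i, hlt hv i⟩).trans
      (h.trans (finFunctionFinEquiv_apply fun i => ⟨w i, hlt hw i⟩).symm)))
  ext i
  simpa using congrArg Fin.val (congrFun h1 i)

lemma expWeight_constExp_le {B k u : ℕ} (hB : 0 < B) {v : Fin n →₀ ℕ} (hv : v.degree + k = n * u)
    (hvu : ∀ i, v i ≤ u) : expWeight B (constExp n u) ≤ expWeight B v + k * B ^ n := by
  have hk : ∑ i, (u - v i) = k := by
    have h : ∑ i, (u - v i) + v.degree = n * u := by
      rw [Finsupp.degree_eq_sum, ← Finset.sum_add_distrib,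
        Finset.sum_congr rfl fun i _ => Nat.sub_add_cancel (hvu i)]
      simp
    lia
  rw [← hk, Finset.sum_mul, expWeight, expWeight, ← Finset.sum_add_distrib]
  refine Finset.sum_le_sum fun i _ => ?_
  calc u * B ^ (i : ℕ) = v i * B ^ (i : ℕ) + (u - v i) * B ^ (i : ℕ) := by
        rw [← add_mul, Nat.add_sub_cancel' (hvu i)]
    _ ≤ _ := by
      gcongr
      exact i.2.le

lemma expWeight_le_constExp {B u : ℕ} {v : Fin n →₀ ℕ} (hvu : ∀ i, v i ≤ u) :
    expWeight B v ≤ expWeight B (constExp n u) :=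
  Finset.sum_le_sum fun i _ => Nat.mul_le_mul_right _ (hvu i)

lemma monomial_mem_powIdeal {u : ℕ} {v : Fin n →₀ ℕ} {i : Fin n} (h : u ≤ v i) (c : T) :
    monomial v c ∈ powIdeal T n u := by
  rw [powIdeal, mem_ideal_span_monomial_image]
  intro w hw
  obtain rfl := Finset.mem_singleton.1 (support_monomial_subset hw)
  exact ⟨_, ⟨i, rfl⟩, Finsupp.single_le_iff.2 h⟩

section

variable {H : Type*} [AddCommGroup H] [Module (MvPolynomial (Fin n) T) H]
  {β : ℕ → MvPolynomial (Fin n) T →ₗ[MvPolynomial (Fin n) T] H} {f : MvPolynomial (Fin n) T}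

lemma map_prod_X_pow_mul (hβ : ∀ t r, β (t + 1) ((∏ i, X i) * r) = β t r) (t s : ℕ)
    (r : MvPolynomial (Fin n) T) : β (t + s) ((∏ i, X i) ^ s * r) = β t r := by
  induction s with
  | zero => simp
  | succ s ih => rw [← add_assoc, pow_succ', mul_assoc, hβ, ih]

lemma map_monomial_mul_eq_zero {x : ℕ} {v : Fin n →₀ ℕ} {a : T} (c : T)
    (h : β x (monomial v a) = 0) : β x (monomial v (c * a)) = 0 := by
  rw [← C_mul_monomial, ← smul_eq_mul, map_smul, h, smul_zero]

/-- Multiplication by the coefficient of largest weight raises weights. -/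
lemma map_monomial_coeff_pow_eq_zero (hβ : ∀ t r, β (t + 1) ((∏ i, X i) * r) = β t r)
    (hβf : ∀ t r, r ∈ powIdeal T n t ⊔ Ideal.span {f} → β t r = 0) {B : ℕ} (hB : 0 < B)
    {α : Fin n →₀ ℕ} (hαf : α ∈ f.support)
    (hα : ∀ γ ∈ f.support, γ ≠ α → expWeight B γ < expWeight B α)
    {p : ℕ} (hf : f.IsHomogeneous p) (k s u : ℕ) (v : Fin n →₀ ℕ) (hv : v.degree + k = n * u)
    (hw : expWeight B v + k * B ^ n < expWeight B (constExp n u) + s) :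
    β u (monomial v (coeff α f ^ s)) = 0 := by
  induction s generalizing u v with
  | zero =>
    by_cases h : ∃ i, u ≤ v i
    · obtain ⟨i, hi⟩ := h
      exact hβf _ _ (Ideal.mem_sup_left (monomial_mem_powIdeal hi _))
    · push Not at h
      have := expWeight_constExp_le hB hv fun i => (h i).le
      lia
  | succ s ih =>
    have hdeg {γ} (hγ : γ ∈ f.support) : γ.degree = p := by
      by_contra h
      exact mem_support_iff.1 hγ (hf.coeff_eq_zero h)
    obtain ⟨w, hw'⟩ : ∃ w, v + constExp n p = α + w := by
      obtain ⟨w, hw⟩ := exists_add_of_le (show α ≤ constExp n p from fun i =>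
        (Finsupp.le_degree i α).trans (hdeg hαf).le)
      exact ⟨v + w, by rw [hw]; abel⟩
    have h1 : β u (monomial v (coeff α f ^ (s + 1))) =
        β (u + p) (monomial (α + w) (coeff α f * coeff α f ^ s)) := by
      rw [← map_prod_X_pow_mul hβ u p, prod_univ_X_pow_eq_monomial, monomial_mul, one_mul,
        ← hw', add_comm v, pow_succ']
      rfl
    have h2 : β (u + p) (f * monomial w (coeff α f ^ s)) = 0 :=
      hβf _ _ (Ideal.mem_sup_right (Ideal.mul_mem_right _ _ (Ideal.mem_span_singleton_self f)))
    have h3 : f * monomial w (coeff α f ^ s) =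
        ∑ γ ∈ f.support, monomial (γ + w) (coeff γ f * coeff α f ^ s) := by
      conv_lhs => rw [f.as_sum, Finset.sum_mul]
      simp [monomial_mul]
    rw [h3, map_sum, Finset.sum_eq_single_of_mem α hαf] at h2
    · rw [h1, h2]
    intro γ hγ hne
    refine map_monomial_mul_eq_zero _ (ih _ _ ?_ ?_)
    · have h := congrArg Finsupp.degree hw'
      simp only [map_add, degree_constExp] at h ⊢
      rw [hdeg hγ, mul_add]
      rw [hdeg hαf] at h
      lia
    · have h := congrArg (expWeight B) hw'
      have := hα γ hγ hne
      simp only [expWeight_add, constExp_add] at h ⊢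
      lia

lemma exists_forall_map_monomial_coeff_pow_eq_zero
    (hβ : ∀ t r, β (t + 1) ((∏ i, X i) * r) = β t r)
    (hβf : ∀ t r, r ∈ powIdeal T n t ⊔ Ideal.span {f} → β t r = 0)
    {p : ℕ} (hf : f.IsHomogeneous p) (hf0 : f ≠ 0) :
    ∃ α ∈ f.support, ∀ k, ∃ s, ∀ u (v : Fin n →₀ ℕ), v.degree + k = n * u →
      β u (monomial v (coeff α f ^ s)) = 0 := by
  have hdeg {γ} (hγ : γ ∈ f.support) : γ.degree = p := by
    by_contra h
    exact mem_support_iff.1 hγ (hf.coeff_eq_zero h)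
  obtain ⟨α, hα, hmax⟩ := Finset.exists_max_image f.support (expWeight (p + 1))
    (support_nonempty.2 hf0)
  refine ⟨α, hα, fun k => ⟨k * (p + 1) ^ n + 1, fun u v hv => ?_⟩⟩
  by_cases h : ∃ i, u ≤ v i
  · obtain ⟨i, hi⟩ := h
    exact hβf _ _ (Ideal.mem_sup_left (monomial_mem_powIdeal hi _))
  · push Not at h
    have := expWeight_le_constExp (B := p + 1) fun i => (h i).le
    refine map_monomial_coeff_pow_eq_zero hβ hβf p.succ_pos hα (fun γ hγ hne => ?_) hf k _ u v hv
      (by lia)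
    exact (hmax γ hγ).lt_of_ne fun h => hne (eq_of_expWeight_eq (hdeg hγ).le (hdeg hα).le h)

/-- If all socle elements come from a bounded stage, the exponent can be chosen uniformly. -/
lemma map_monomial_coeff_pow_eq_zero_of_socle
    (hβ : ∀ t r, β (t + 1) ((∏ i, X i) * r) = β t r)
    (hker : ∀ t r, β t r = 0 ↔ ∃ s, (∏ i, X i) ^ s * r ∈ powIdeal T n (t + s) ⊔ Ideal.span {f})
    {p : ℕ} (hf : f.IsHomogeneous p) {t : ℕ}
    (hsoc : ∀ h : H, (∀ i, (X i : MvPolynomial (Fin n) T) • h = 0) → ∃ r, β t r = h)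
    {a : T} (ha : ∀ u (v : Fin n →₀ ℕ), v.degree + n * t = n * u → β u (monomial v a) = 0)
    (k u : ℕ) (v : Fin n →₀ ℕ) (hv : v.degree + (n * t + k) = n * u) :
    β u (monomial v a) = 0 := by
  induction k generalizing u v with
  | zero => exact ha u v hv
  | succ k ih =>
    obtain ⟨r, hr⟩ := hsoc (β u (monomial v a)) fun i => by
      rw [← map_smul, smul_eq_mul, X, monomial_mul, one_mul]
      refine ih _ _ ?_
      simp only [map_add, Finsupp.degree_single]
      lia
    have htu : t ≤ u := by
      by_contra! h
      have := Nat.mul_le_mul_left n h.le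
      lia
    obtain ⟨q, rfl⟩ := exists_add_of_le htu
    rw [← map_prod_X_pow_mul hβ t q, eq_comm, ← sub_eq_zero, ← map_sub] at hr
    obtain ⟨s, hs⟩ := (hker _ _).1 hr
    refine (hker _ _).2 ⟨s, mul_mem_of_mul_sub_mem (isHomogeneous_powIdeal_sup hf _)
      (isHomogeneous_prod_X_pow s) (isHomogeneous_prod_X_pow q) (isHomogeneous_monomial a rfl)
      ?_ hs⟩
    rw [mul_add] at hv
    lia

end

/-- Lattice points on the segment between `N • β` and `N • α`. -/
noncomputable def segmentExp (α β : Fin n →₀ ℕ) (N i : ℕ) : Fin n →₀ ℕ := i • α + (N - i) • β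

lemma segmentExp_injOn {α β : Fin n →₀ ℕ} (h : α ≠ β) {N i j : ℕ} (hi : i ≤ N) (hj : j ≤ N)
    (hij : segmentExp α β N i = segmentExp α β N j) : i = j := by
  obtain ⟨x, hx⟩ := Finsupp.ne_iff.1 h
  have h1 := DFunLike.congr_fun hij x
  simp only [segmentExp, Finsupp.add_apply, Finsupp.smul_apply, smul_eq_mul] at h1
  zify [hi, hj] at h1 hx
  have h2 : ((i : ℤ) - j) * (α x - β x) = 0 := by linear_combination h1
  rcases mul_eq_zero.1 h2 with h2 | h2
  · lia
  · exact absurd (sub_eq_zero.1 h2) hx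

lemma segmentExp_succ_add (α β : Fin n →₀ ℕ) {N i : ℕ} (hi : i < N) :
    segmentExp α β N (i + 1) + β = segmentExp α β N i + α := by
  obtain ⟨k, rfl⟩ := exists_add_of_le (Nat.succ_le_of_lt hi)
  ext x
  simp only [segmentExp, Finsupp.add_apply, Finsupp.smul_apply, smul_eq_mul]
  rw [show i + 1 + k - (i + 1) = k by lia, show i.succ + k - i = k + 1 by lia]
  ring

lemma segmentExp_apply_le {α β : Fin n →₀ ℕ} {p N i : ℕ} (hα : α.degree ≤ p) (hβ : β.degree ≤ p)
    (hi : i ≤ N) (x : Fin n) : segmentExp α β N i x ≤ N * p := by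
  obtain ⟨k, rfl⟩ := exists_add_of_le hi
  simp only [segmentExp, Finsupp.add_apply, Finsupp.smul_apply, smul_eq_mul, add_mul]
  rw [Nat.add_sub_cancel_left]
  have h1 := (Finsupp.le_degree x α).trans hα
  have h2 := (Finsupp.le_degree x β).trans hβ
  gcongr

/-- A linear functional which extracts the coefficients along a segment of exponents. -/
noncomputable def segmentFunctional (α β : Fin n →₀ ℕ) (a b : T) (N s : ℕ) :
    MvPolynomial (Fin n) T →ₗ[T] T :=
  ∑ i ∈ Finset.range (N + 1),
    ((-1) ^ i * (a ^ (N - i) * b ^ i)) • lcoeff T (constExp n s + segmentExp α β (N + 1) i)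

lemma segmentFunctional_apply (α β : Fin n →₀ ℕ) (a b : T) (N s : ℕ)
    (r : MvPolynomial (Fin n) T) : segmentFunctional α β a b N s r =
      ∑ i ∈ Finset.range (N + 1), (-1) ^ i * (a ^ (N - i) * b ^ i) *
        coeff (constExp n s + segmentExp α β (N + 1) i) r := by
  simp [segmentFunctional, LinearMap.sum_apply]

lemma segmentFunctional_monomial (α β : Fin n →₀ ℕ) (a b : T) (N s : ℕ) (v : Fin n →₀ ℕ) (c : T) :
    segmentFunctional α β a b N s (monomial v c) =
      c * segmentFunctional α β a b N s (monomial v 1) := by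
  rw [← smul_eq_mul, ← map_smul, smul_monomial, smul_eq_mul, mul_one]

lemma segmentFunctional_eq_zero {α β : Fin n →₀ ℕ} {a b : T} {N s u : ℕ}
    (hu : ∀ i ≤ N, ∀ x, segmentExp α β (N + 1) i x < u) {r : MvPolynomial (Fin n) T}
    (hr : r ∈ powIdeal T n (u + s)) : segmentFunctional α β a b N s r = 0 := by
  rw [segmentFunctional_apply]
  refine Finset.sum_eq_zero fun i hi => ?_
  rw [powIdeal, mem_ideal_span_monomial_image] at hr
  by_cases h : constExp n s + segmentExp α β (N + 1) i ∈ r.support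
  · obtain ⟨_, ⟨x, rfl⟩, hx⟩ := hr _ h
    rw [Finsupp.single_le_iff] at hx
    have := hu i (Finset.mem_range_succ_iff.1 hi) x
    simp only [Finsupp.add_apply, constExp_apply] at hx
    lia
  · rw [notMem_support_iff.1 h, mul_zero]

lemma mul_sum_add_mul_sum_shift (a b : T) (P : ℕ → T) (N : ℕ) :
    a * ∑ i ∈ Finset.range (N + 1), (-1) ^ i * (a ^ (N - i) * b ^ i) * P i +
      b * ∑ i ∈ Finset.range (N + 1), (-1) ^ i * (a ^ (N - i) * b ^ i) * P (i + 1) =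
        P 0 * a ^ (N + 1) + (-1) ^ N * P (N + 1) * b ^ (N + 1) := by
  rw [Finset.sum_range_succ' (n := N), Finset.sum_range_succ (n := N), mul_add, mul_add,
    Finset.mul_sum, Finset.mul_sum, add_add_add_comm, ← Finset.sum_add_distrib,
    Finset.sum_eq_zero, zero_add]
  · simp only [Nat.sub_self, Nat.sub_zero]
    ring
  · intro i hi
    obtain ⟨k, rfl⟩ := exists_add_of_le (Nat.succ_le_of_lt (Finset.mem_range.1 hi))
    rw [show i.succ + k - (i + 1) = k by lia, show i.succ + k - i = k + 1 by lia]
    ring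

lemma add_segmentFunctional_mem (α β : Fin n →₀ ℕ) (a b : T) (N s : ℕ) (w : Fin n →₀ ℕ) :
    a * segmentFunctional α β a b N s (monomial (α + w) 1) +
      b * segmentFunctional α β a b N s (monomial (β + w) 1) ∈
        Ideal.span {a ^ (N + 1), b ^ (N + 1)} := by
  classical
  simp only [segmentFunctional_apply, coeff_monomial]
  have hiff (i) (hi : i ≤ N) : β + w = constExp n s + segmentExp α β (N + 1) i ↔
      α + w = constExp n s + segmentExp α β (N + 1) (i + 1) := by
    have h := segmentExp_succ_add α β (show i < N + 1 by lia)
    constructor <;> intro h'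
    · refine add_right_cancel (b := β) ?_
      rw [add_assoc (constExp n s), h, ← add_assoc, ← h']
      abel
    · refine add_right_cancel (b := α) ?_
      rw [add_assoc (constExp n s), ← h, ← add_assoc, ← h']
      abel
  have h : ∑ i ∈ Finset.range (N + 1), (-1) ^ i * (a ^ (N - i) * b ^ i) *
      (if β + w = constExp n s + segmentExp α β (N + 1) i then 1 else 0) =
      ∑ i ∈ Finset.range (N + 1), (-1) ^ i * (a ^ (N - i) * b ^ i) *
        (if α + w = constExp n s + segmentExp α β (N + 1) (i + 1) then 1 else 0) :=
    Finset.sum_congr rfl fun i hi => by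
      simp only [hiff i (Finset.mem_range_succ_iff.1 hi)]
  rw [h, mul_sum_add_mul_sum_shift a b
    (fun i => if α + w = constExp n s + segmentExp α β (N + 1) i then 1 else 0)]
  exact Ideal.mem_span_pair.2 ⟨_, _, rfl⟩

lemma segmentFunctional_mem {f : MvPolynomial (Fin n) T} {α β : Fin n →₀ ℕ} (hα : α ∈ f.support)
    (hβ : β ∈ f.support) (hαβ : α ≠ β) (N s : ℕ) {r : MvPolynomial (Fin n) T}
    (hr : r ∈ Ideal.span {f}) :
    segmentFunctional α β (coeff α f) (coeff β f) N s r ∈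
      Ideal.span {coeff α f ^ (N + 1), coeff β f ^ (N + 1)} ⊔
        Ideal.span ((fun m => coeff m f) '' (f.support \ {α, β})) := by
  obtain ⟨g, rfl⟩ := Ideal.mem_span_singleton'.1 hr
  rw [mul_comm, g.as_sum, Finset.mul_sum, map_sum]
  refine Ideal.sum_mem _ fun w _ => ?_
  have h : f * monomial w (coeff w g) =
      ∑ γ ∈ f.support, monomial (γ + w) (coeff γ f * coeff w g) := by
    conv_lhs => rw [f.as_sum, Finset.sum_mul]
    simp [monomial_mul]
  rw [h, map_sum, ← Finset.add_sum_erase _ _ hα,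
    ← Finset.add_sum_erase _ _ (Finset.mem_erase.2 ⟨hαβ.symm, hβ⟩), ← add_assoc]
  refine Ideal.add_mem _ (Ideal.mem_sup_left ?_) (Ideal.mem_sup_right (Ideal.sum_mem _ ?_))
  · rw [segmentFunctional_monomial, segmentFunctional_monomial _ _ _ _ _ _ (β + w)]
    convert Ideal.mul_mem_left _ (coeff w g) (add_segmentFunctional_mem α β _ _ N s w) using 1
    ring
  · intro γ hγ
    rw [segmentFunctional_monomial, mul_assoc]
    refine Ideal.mul_mem_right _ _ (Ideal.subset_span ⟨γ, ?_, rfl⟩)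
    simp only [Finset.mem_erase] at hγ
    simp [hγ.1, hγ.2.1, mem_support_iff.1 hγ.2.2]

lemma mul_pow_mul_pow_mem {f : MvPolynomial (Fin n) T} {α β : Fin n →₀ ℕ} (hα : α ∈ f.support)
    (hβ : β ∈ f.support) (hαβ : α ≠ β) {N s u j : ℕ}
    (hu : ∀ i ≤ N, ∀ x, segmentExp α β (N + 1) i x < u) (hj : j ≤ N) {c : T}
    (h : (∏ i, X i) ^ s * monomial (segmentExp α β (N + 1) j) c ∈
      powIdeal T n (u + s) ⊔ Ideal.span {f}) :
    c * (coeff α f ^ (N - j) * coeff β f ^ j) ∈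
      Ideal.span {coeff α f ^ (N + 1), coeff β f ^ (N + 1)} ⊔
        Ideal.span ((fun m => coeff m f) '' (f.support \ {α, β})) := by
  classical
  obtain ⟨r₁, h₁, r₂, h₂, h₁₂⟩ := Submodule.mem_sup.1 h
  have h₃ := segmentFunctional_mem hα hβ hαβ N s h₂
  rw [← zero_add (segmentFunctional _ _ _ _ _ _ r₂),
    ← segmentFunctional_eq_zero (a := coeff α f) (b := coeff β f) hu h₁, ← map_add, h₁₂,
    prod_univ_X_pow_eq_monomial, monomial_mul, one_mul, segmentFunctional_apply,
    Finset.sum_eq_single_of_mem j (Finset.mem_range_succ_iff.2 hj)] at h₃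
  · have h₄ := Ideal.mul_mem_left _ ((-1) ^ j) h₃
    convert h₄ using 1
    rw [show Finsupp.equivFunOnFinite.symm (fun _ => s) = constExp n s from rfl, coeff_monomial,
      if_pos rfl]
    have : ((-1 : T) ^ j) * (-1) ^ j = 1 := by rw [← mul_pow]; simp
    linear_combination (-c * coeff α f ^ (N - j) * coeff β f ^ j) * this
  · intro i hi hij
    rw [show Finsupp.equivFunOnFinite.symm (fun _ => s) = constExp n s from rfl, coeff_monomial,
      if_neg, mul_zero]
    intro h
    refine hij (segmentExp_injOn hαβ (N := N + 1) ?_ (by lia) (add_left_cancel h.symm))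
    exact (Finset.mem_range_succ_iff.1 hi).trans N.le_succ

/-- If the socle of the top local cohomology is finitely generated, then the coefficients of `f`
satisfy monomial relations with a uniformly bounded shift. -/
lemma exists_coeff_pow_mul_pow_mem [IsNoetherianRing T] (hn : n ≠ 0) {f : MvPolynomial (Fin n) T}
    {p : ℕ} (hf : f.IsHomogeneous p) (hf0 : f ≠ 0)
    (hfin : Module.Finite (MvPolynomial (Fin n) T)
      ((MvPolynomial (Fin n) T ⧸ Ideal.span (Set.range (X : Fin n → MvPolynomial (Fin n) T)))
        →ₗ[MvPolynomial (Fin n) T]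
      (localCohomology (Ideal.span (Set.range (X : Fin n → MvPolynomial (Fin n) T))) n).obj
        (ModuleCat.of (MvPolynomial (Fin n) T) (MvPolynomial (Fin n) T ⧸ Ideal.span {f})))) :
    ∃ α ∈ f.support, ∀ β ∈ f.support, α ≠ β → ∃ s, ∀ N j, j ≤ N →
      coeff α f ^ s * (coeff α f ^ (N - j) * coeff β f ^ j) ∈
        Ideal.span {coeff α f ^ (N + 1), coeff β f ^ (N + 1)} ⊔
          Ideal.span ((fun m => coeff m f) '' (f.support \ {α, β})) := by
  obtain ⟨b, hsurj, hb, hker⟩ := exists_localCohomology_presentation hn f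
  obtain ⟨t, ht⟩ := Ideal.exists_smul_eq_zero_imp_mem_range b hsurj (monotone_nat_of_le_succ
    fun t => by
      rintro _ ⟨r, rfl⟩
      exact ⟨_, hb t r⟩) hfin
  have hsoc (h) (hh : ∀ i, (X i : MvPolynomial (Fin n) T) • h = 0) : ∃ r, b t r = h := by
    refine ht h fun x hx => ?_
    have hle : Ideal.span (Set.range (X : Fin n → MvPolynomial (Fin n) T)) ≤
        LinearMap.ker (LinearMap.toSpanSingleton (MvPolynomial (Fin n) T) _ h) := by
      rw [Ideal.span_le]
      rintro _ ⟨i, rfl⟩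
      exact hh i
    exact hle hx
  have hbf (t r) (h : r ∈ powIdeal T n t ⊔ Ideal.span {f}) : b t r = 0 :=
    (hker t r).2 ⟨0, by simpa using h⟩
  have hdeg {γ} (hγ : γ ∈ f.support) : γ.degree = p := by
    by_contra h
    exact mem_support_iff.1 hγ (hf.coeff_eq_zero h)
  obtain ⟨α, hα, h⟩ := exists_forall_map_monomial_coeff_pow_eq_zero hb hbf hf hf0
  obtain ⟨s, hs⟩ := h (n * t)
  refine ⟨α, hα, fun β hβ hαβ => ⟨s, fun N j hj => ?_⟩⟩
  have hsdeg : (segmentExp α β (N + 1) j).degree = (N + 1) * p := by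
    rw [segmentExp, map_add, map_nsmul, map_nsmul, hdeg hα, hdeg hβ, smul_eq_mul, smul_eq_mul,
      ← add_mul, Nat.add_sub_cancel' (by lia)]
  have hle : (N + 1) * p ≤ n * ((N + 1) * p) := Nat.le_mul_of_pos_left _ (Nat.pos_of_ne_zero hn)
  have h0 := map_monomial_coeff_pow_eq_zero_of_socle hb hker hf hsoc hs
    (n * ((N + 1) * p) - (N + 1) * p + n) ((N + 1) * p + t + 1) (segmentExp α β (N + 1) j) (by
      rw [hsdeg, mul_add, mul_add]
      lia)
  obtain ⟨s', hs'⟩ := (hker _ _).1 h0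
  refine mul_pow_mul_pow_mem hα hβ hαβ (fun i hi x => ?_) hj hs'
  have := segmentExp_apply_le (hdeg hα).le (hdeg hβ).le (show i ≤ N + 1 by lia) x
  lia

end MvPolynomial

open Polynomial in
/-- Two elements generating an ideal primary to the maximal ideal of a local ring of dimension at
least two are analytically independent. -/
theorem IsLocalRing.mem_maximalIdeal_of_sum_pow_mul_pow_eq_zero {T : Type u} [CommRing T]
    [IsLocalRing T] [IsNoetherianRing T] (hd : 2 ≤ ringKrullDim T) {a b : T}
    (hab : maximalIdeal T ≤ (Ideal.span {a, b}).radical)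
    (ha : a ∈ maximalIdeal T) (hb : b ∈ maximalIdeal T) {N : ℕ} {u : ℕ → T}
    (hu : ∑ i ∈ Finset.range (N + 1), u i * (a ^ (N - i) * b ^ i) = 0) {i : ℕ} (hi : i ≤ N) :
    u i ∈ maximalIdeal T := by
  by_contra hui
  set c : T[X] := C a * X - C b with hc
  set P : Ideal T[X] := (maximalIdeal T).map C with hP
  have hPprime : P.IsPrime := Ideal.isPrime_map_C_of_isPrime
  set F : T[X] := ∑ i ∈ Finset.range (N + 1), C (u i) * X ^ i with hF
  have hFP : F ∉ P := by
    intro h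
    refine hui ?_
    have := (Ideal.mem_map_C_iff.mp h) i
    simpa [hF, Polynomial.finsetSum_coeff, Polynomial.coeff_C_mul, Polynomial.coeff_X_pow,
      Nat.lt_succ_iff, hi] using this
  have hmem : C a ^ N * F ∈ Ideal.span {c} := by
    have hzero := congrArg (C : T →+* T[X]) hu
    rw [map_sum, map_zero] at hzero
    have hEq : C a ^ N * F = ∑ i ∈ Finset.range (N + 1),
        C (u i) * (C a ^ (N - i) * ((C a * X) ^ i - C b ^ i)) := by
      rw [← sub_zero (C a ^ N * F), ← hzero, hF, Finset.mul_sum, ← Finset.sum_sub_distrib]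
      refine Finset.sum_congr rfl fun j hj => ?_
      have hj' : N = (N - j) + j := by have := Finset.mem_range.mp hj; omega
      conv_lhs => enter [1, 1]; rw [hj']
      simp only [map_mul, map_pow]
      ring
    rw [hEq]
    refine Ideal.sum_mem _ fun j _ => Ideal.mul_mem_left _ _ (Ideal.mul_mem_left _ _ ?_)
    exact Ideal.mem_span_singleton.mpr (sub_dvd_pow_sub_pow _ _ _)
  have hcP : c ∈ P :=
    P.sub_mem (P.mul_mem_right _ (Ideal.mem_map_of_mem _ ha)) (Ideal.mem_map_of_mem _ hb)
  have hmin : P ∈ (Ideal.span {c}).minimalPrimes := by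
    refine ⟨⟨hPprime, (Ideal.span_singleton_le_iff_mem _).mpr hcP⟩, ?_⟩
    rintro Q ⟨hQ, hcQ⟩ hQP
    have hcQ' : c ∈ Q := hcQ (Ideal.mem_span_singleton_self c)
    have haQ : C a ∈ Q := by
      rcases hQ.mem_or_mem (hcQ hmem) with h | h
      · exact hQ.mem_of_pow_mem _ h
      · exact absurd (hQP h) hFP
    have hbQ : C b ∈ Q := by
      have := Q.sub_mem (Q.mul_mem_right X haQ) hcQ'
      simpa [hc] using this
    rw [hP, Ideal.map_le_iff_le_comap]
    refine hab.trans ?_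
    have : (Q.comap (C : T →+* T[X])).IsPrime := inferInstance
    refine this.radical_le_iff.mpr ?_
    rw [Ideal.span_le]
    rintro x (rfl | rfl)
    · exact haQ
    · exact hbQ
  have h1 := Ideal.height_le_one_of_isPrincipal_of_mem_minimalPrimes _ _ hmin
  rw [hP, Polynomial.height_map_C] at h1
  rw [← IsLocalRing.maximalIdeal_height_eq_ringKrullDim] at hd
  have h2 : (2 : ℕ∞) ≤ (maximalIdeal T).height := WithBot.coe_le_coe.mp hd
  exact absurd (h2.trans h1) (by decide)

theorem Ideal.exists_eq_sum_of_mem_mul_span_pair_pow {T : Type u} [CommRing T] (A : Ideal T)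
    (a b : T) (N : ℕ) {x : T} (hx : x ∈ A * Ideal.span {a, b} ^ N) :
    ∃ w : ℕ → T, (∀ i, w i ∈ A) ∧
      x = ∑ i ∈ Finset.range (N + 1), w i * (a ^ (N - i) * b ^ i) := by
  set L : (ℕ → T) →ₗ[T] T := ∑ i ∈ Finset.range (N + 1),
    (LinearMap.mulRight T (a ^ (N - i) * b ^ i)).comp (LinearMap.proj i) with hL
  have hLapp : ∀ w, L w = ∑ i ∈ Finset.range (N + 1), w i * (a ^ (N - i) * b ^ i) := by
    intro w; simp [hL, LinearMap.sum_apply, mul_assoc]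
  suffices h : A * Ideal.span {a, b} ^ N ≤ (Submodule.pi Set.univ fun _ => A).map L by
    obtain ⟨w, hw, rfl⟩ := h hx
    exact ⟨w, fun i => hw i trivial, hLapp w⟩
  rw [Ideal.span_insert, sup_comm, ← Submodule.add_eq_sup, add_pow, Finset.mul_sum,
    Ideal.sum_eq_sup, Finset.sup_le_iff]
  intro i hi
  refine (Ideal.mul_mono_right Ideal.mul_le_left).trans ?_
  rw [Ideal.span_singleton_pow, Ideal.span_singleton_pow, Ideal.span_singleton_mul_span_singleton]
  intro y hy
  obtain ⟨z, hz, rfl⟩ := Ideal.mem_mul_span_singleton.mp hy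
  refine ⟨Pi.single i z, fun j _ => ?_, ?_⟩
  · by_cases hji : j = i
    · subst hji; simpa using hz
    · simp [hji]
  · rw [hLapp, Finset.sum_eq_single i]
    · simp [mul_comm]
    · intro j _ hj; simp [hj]
    · exact fun h => absurd hi h

theorem IsLocalRing.mem_maximalIdeal_of_sum_pow_mul_pow_mem {T : Type u} [CommRing T]
    [IsLocalRing T] [IsNoetherianRing T] (hd : 2 ≤ ringKrullDim T) {a b : T}
    (hab : maximalIdeal T ≤ (Ideal.span {a, b}).radical)
    (ha : a ∈ maximalIdeal T) (hb : b ∈ maximalIdeal T) {N : ℕ} {u : ℕ → T}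
    (hu : ∑ i ∈ Finset.range (N + 1), u i * (a ^ (N - i) * b ^ i) ∈
      maximalIdeal T * Ideal.span {a, b} ^ N) {i : ℕ} (hi : i ≤ N) :
    u i ∈ maximalIdeal T := by
  obtain ⟨w, hw, hwu⟩ := Ideal.exists_eq_sum_of_mem_mul_span_pair_pow _ _ _ _ hu
  have := mem_maximalIdeal_of_sum_pow_mul_pow_eq_zero hd hab ha hb (u := fun i => u i - w i)
    (N := N) (by simp only [sub_mul, Finset.sum_sub_distrib, hwu, sub_self]) hi
  exact (Submodule.sub_mem_iff_left _ (hw i)).mp this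

theorem IsLocalRing.length_quotient_ne_top {T : Type u} [CommRing T]
    [IsLocalRing T] [IsNoetherianRing T] {I : Ideal T} (hI : maximalIdeal T ≤ I.radical)
    (hne : I ≠ ⊤) : Module.length T (T ⧸ I) ≠ ⊤ := by
  have hmin : maximalIdeal T ∈ I.minimalPrimes := by
    refine ⟨⟨inferInstance, le_maximalIdeal hne⟩, ?_⟩
    rintro Q ⟨hQ, hIQ⟩ -
    exact hI.trans (hQ.radical_le_iff.mpr hIQ)
  have := quotient_artinian_of_mem_minimalPrimes_of_isLocalRing I hmin
  have : IsArtinian T (T ⧸ I) :=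
    (isArtinian_of_surjective_algebraMap (R := T ⧸ I) (S := T) (M := T ⧸ I)
      Ideal.Quotient.mk_surjective)
  exact Module.length_ne_top

/-- In a local ring of dimension at least two with parameters `a`, `b`, no fixed power of `a`
multiplies all the monomials of degree `N` in `a`, `b` into the ideal `(a ^ (N + 1), b ^ (N + 1))`
for every `N`. -/
theorem IsLocalRing.exists_pow_mul_notMem_span_pair {T : Type u} [CommRing T] [IsLocalRing T]
    [IsNoetherianRing T] (hd : 2 ≤ ringKrullDim T) {a b : T}
    (hab : maximalIdeal T ≤ (Ideal.span {a, b}).radical)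
    (ha : a ∈ maximalIdeal T) (hb : b ∈ maximalIdeal T) (s : ℕ) :
    ∃ N j, j ≤ N ∧ a ^ s * (a ^ (N - j) * b ^ j) ∉ Ideal.span {a ^ (N + 1), b ^ (N + 1)} := by
  by_contra! h
  set m := maximalIdeal T
  set J : Ideal T := Ideal.span {a, b} with hJ
  have haJ : a ∈ J := Ideal.subset_span (by simp)
  have hbJ : b ∈ J := Ideal.subset_span (by simp)
  set W : Ideal T := m * J ^ s with hW
  have hWm : m ≤ W.radical := by
    rw [hW, Ideal.radical_mul, le_inf_iff]
    refine ⟨Ideal.le_radical, ?_⟩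
    rcases Nat.eq_zero_or_pos s with rfl | hs
    · simp [Ideal.one_eq_top, Ideal.radical_top]
    · rwa [Ideal.radical_pow _ hs.ne']
  have hWtop : W ≠ ⊤ := fun e =>
    (maximalIdeal.isMaximal T).ne_top (top_le_iff.mp (e ▸ Ideal.mul_le_left))
  have hlen := length_quotient_ne_top hWm hWtop
  suffices hle : ∀ N : ℕ, ((N + 1 : ℕ) : ℕ∞) ≤
      Module.length T (T ⧸ W) + Module.length T (T ⧸ W) by
    obtain ⟨k, hk⟩ := ENat.ne_top_iff_exists.mp hlen
    rw [← hk] at hle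
    have := hle (k + k)
    norm_cast at this
    omega
  intro N
  set D := N + 1 + s with hD
  set V : Ideal T := m * J ^ D with hV
  have hmul : ∀ x ∈ J, W ≤ Submodule.comap (LinearMap.mulLeft T (x ^ (N + 1))) V := by
    intro x hx w hw
    rw [Submodule.mem_comap, LinearMap.mulLeft_apply, hV, hD, pow_add, mul_left_comm]
    exact Ideal.mul_mem_mul (Ideal.pow_mem_pow hx _) hw
  set φ : ((T ⧸ W) × (T ⧸ W)) →ₗ[T] T ⧸ V :=
    (Submodule.mapQ W V _ (hmul a haJ)).coprod (Submodule.mapQ W V _ (hmul b hbJ)) with hφ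
  set ψ : (ℕ → T) →ₗ[T] T ⧸ V := V.mkQ ∘ₗ ∑ i ∈ Finset.range (N + 1),
    (LinearMap.mulRight T (a ^ (D - i) * b ^ i)).comp (LinearMap.proj i) with hψ
  have hψapp : ∀ w, ψ w = V.mkQ (∑ i ∈ Finset.range (N + 1), w i * (a ^ (D - i) * b ^ i)) := by
    intro w; simp [hψ, mul_assoc]
  have hrange : ψ.range ≤ φ.range := by
    rintro _ ⟨w, rfl⟩
    rw [hψapp, map_sum]
    refine Submodule.sum_mem _ fun i hi => ?_
    have hi' : i ≤ N := by have := Finset.mem_range.mp hi; omega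
    have hmem : w i * (a ^ (D - i) * b ^ i) ∈ Ideal.span {a ^ (N + 1), b ^ (N + 1)} := by
      have e : a ^ (D - i) * b ^ i = a * (a ^ s * (a ^ (N - i) * b ^ i)) := by
        rw [show D - i = 1 + s + (N - i) by omega]; ring
      rw [e]
      exact Ideal.mul_mem_left _ _ (Ideal.mul_mem_left _ _ (h N i hi'))
    obtain ⟨r, r', hr⟩ := Ideal.mem_span_pair.mp hmem
    refine ⟨(W.mkQ r, W.mkQ r'), ?_⟩
    rw [← hr, hφ, LinearMap.coprod_apply, Submodule.mkQ_apply, Submodule.mkQ_apply,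
      Submodule.mapQ_apply, Submodule.mapQ_apply, map_add]
    simp [mul_comm]
  set π : (ℕ → T) →ₗ[T] (Fin (N + 1) → T ⧸ m) :=
    LinearMap.pi fun i => m.mkQ ∘ₗ LinearMap.proj (i : ℕ) with hπ
  have hπsurj : Function.Surjective π := by
    intro v
    choose t ht using fun i => Submodule.mkQ_surjective m (v i)
    refine ⟨fun i => if hi : i < N + 1 then t ⟨i, hi⟩ else 0, ?_⟩
    ext i
    simp [hπ, ← ht, Nat.le_of_lt_succ i.isLt]
  have hker : ψ.ker ≤ π.ker := by
    intro w hw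
    rw [LinearMap.mem_ker, hψapp, Submodule.mkQ_apply, Submodule.Quotient.mk_eq_zero] at hw
    have hsum : ∑ i ∈ Finset.range (D + 1), (if i < N + 1 then w i else 0) *
        (a ^ (D - i) * b ^ i) ∈ V := by
      rw [← Finset.sum_subset (Finset.range_subset_range.mpr (show N + 1 ≤ D + 1 by omega))]
      · convert hw using 1
        refine Finset.sum_congr rfl fun i hi => ?_
        rw [if_pos (Finset.mem_range.mp hi)]
      · intro i _ hi
        rw [if_neg (by simpa using hi), zero_mul]
    rw [LinearMap.mem_ker]
    ext i
    have := mem_maximalIdeal_of_sum_pow_mul_pow_mem hd hab ha hb hsum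
      (i := i) (by have := i.isLt; omega)
    rw [if_pos i.isLt] at this
    exact (Submodule.Quotient.mk_eq_zero m).mpr this
  have : IsSimpleModule T (T ⧸ m) :=
    (isSimpleModule_iff_isCoatom).mpr (maximalIdeal.isMaximal T).out
  calc ((N + 1 : ℕ) : ℕ∞) = Module.length T (Fin (N + 1) → T ⧸ m) := by
        simp [Module.length_pi_of_fintype, Module.length_eq_one]
    _ ≤ Module.length T ((ℕ → T) ⧸ ψ.ker) :=
        Module.length_le_of_surjective (ψ.ker.liftQ π hker) fun v => by
          obtain ⟨w, rfl⟩ := hπsurj v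
          exact ⟨ψ.ker.mkQ w, by simp⟩
    _ = Module.length T ψ.range := ψ.quotKerEquivRange.length_eq
    _ ≤ Module.length T φ.range :=
        Module.length_le_of_injective _ (Submodule.inclusion_injective hrange)
    _ ≤ Module.length T ((T ⧸ W) × (T ⧸ W)) :=
        Module.length_le_of_surjective _ φ.surjective_rangeRestrict
    _ = _ := Module.length_prod _ _ _

open MvPolynomial

/-- **Marley–Vassilev, Lemma 2.8.**
Let `(T, m)` be a Noetherian local ring of dimension `d ≥ 2`, `R = T[x₁,…,xₙ]`,
`I = (x₁,…,xₙ)R`, and let `f ∈ R` be homogeneous whose nonzero coefficients form a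
system of parameters for `T`.  Then `Hom_R(R/I, Hⁿ_I(R/fR))` is not a finitely
generated `R`-module. -/
theorem hom_quotient_irrelevant_top_localCohomology_not_finite
    {T : Type} [CommRing T] [IsLocalRing T] [IsNoetherianRing T]
    (hd : 2 ≤ ringKrullDim T)
    (n : ℕ) (f : MvPolynomial (Fin n) T) (p : ℕ) (hf : f.IsHomogeneous p)
    -- the nonzero coefficients of `f` form a system of parameters for `T`:
    (hsop_card : (f.support.card : WithBot (WithTop ℕ)) = ringKrullDim T)
    (hsop_coeff : ∀ m ∈ f.support, MvPolynomial.coeff m f ∈ IsLocalRing.maximalIdeal T)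
    (hsop_rad : (Ideal.span ((fun m => MvPolynomial.coeff m f) '' ↑f.support)).radical
        = IsLocalRing.maximalIdeal T) :
    letI R := MvPolynomial (Fin n) T
    letI I : Ideal R := Ideal.span (Set.range (X : Fin n → R))
    ¬ Module.Finite R
        ((R ⧸ I) →ₗ[R]
          ((localCohomology I n).obj (ModuleCat.of R (R ⧸ Ideal.span {f})))) := by
  classical
  intro hfin
  replace hsop_card : (f.support.card : WithBot ℕ∞) = ringKrullDim T := hsop_card
  have hcard : 2 ≤ f.support.card := by
    rw [← hsop_card] at hd
    exact_mod_cast hd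
  have hn : n ≠ 0 := by
    rintro rfl
    exact absurd (hcard.trans (Finset.card_le_one_of_subsingleton f.support)) (by decide)
  have hf0 : f ≠ 0 := by
    rintro rfl
    simp at hcard
  obtain ⟨α, hα, hrel⟩ := exists_coeff_pow_mul_pow_mem hn hf hf0 hfin
  obtain ⟨β, hβ, hβα⟩ := Finset.exists_mem_ne hcard α
  obtain ⟨s, hs⟩ := hrel β hβ hβα.symm
  set S : Finset T := (f.support \ {α, β}).image fun m => coeff m f with hS
  have hScoe : (S : Set T) = (fun m => coeff m f) '' (f.support \ {α, β}) := by
    simp [hS]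
  rw [← hScoe] at hs
  set K : Ideal T := Ideal.span (S : Set T) with hK
  have hSm : (S : Set T) ⊆ IsLocalRing.maximalIdeal T := by
    rw [hScoe]
    rintro _ ⟨m, hm, rfl⟩
    exact hsop_coeff m hm.1
  have hKm : K ≤ IsLocalRing.maximalIdeal T := Ideal.span_le.mpr hSm
  have hKtop : K ≠ ⊤ := fun e =>
    (IsLocalRing.maximalIdeal.isMaximal T).ne_top (top_le_iff.mp (e ▸ hKm))
  have : Nontrivial (T ⧸ K) := Ideal.Quotient.nontrivial_iff.mpr hKtop
  have : IsLocalRing (T ⧸ K) :=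
    IsLocalRing.of_surjective' (Ideal.Quotient.mk K) Ideal.Quotient.mk_surjective
  have hmap : IsLocalRing.maximalIdeal (T ⧸ K) =
      (IsLocalRing.maximalIdeal T).map (Ideal.Quotient.mk K) :=
    (IsLocalRing.map_maximalIdeal_of_surjective _ Ideal.Quotient.mk_surjective).symm
  have hdim : 2 ≤ ringKrullDim (T ⧸ K) := by
    have h := ringKrullDim_le_ringKrullDim_quotient_add_card S
      (hSm.trans (IsLocalRing.ringJacobson_eq_maximalIdeal T).ge)
    have hScard : S.card + 2 ≤ f.support.card := by
      have h1 : S.card ≤ (f.support \ {α, β}).card := Finset.card_image_le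
      have h2 := Finset.card_sdiff_add_card_eq_card
        (Finset.insert_subset hα (Finset.singleton_subset_iff.mpr hβ))
      rw [Finset.card_pair hβα.symm] at h2
      omega
    rw [← hsop_card] at h
    change _ ≤ ringKrullDim (T ⧸ K) + _ at h
    generalize ringKrullDim (T ⧸ K) = D at h ⊢
    rcases D with _ | _ | D
    · exact absurd (h.trans_eq (WithBot.bot_add _)) (WithBot.natCast_ne_bot _ ∘ le_bot_iff.mp)
    · exact WithBot.coe_le_coe.mpr le_top
    · change _ ≤ ((D : ℕ) : WithBot ℕ∞) + _ at h
      change _ ≤ ((D : ℕ) : WithBot ℕ∞)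
      have h' : f.support.card ≤ D + S.card := by exact_mod_cast h
      have : 2 ≤ D := by omega
      exact_mod_cast this
  have hmem : ∀ m ∈ f.support, Ideal.Quotient.mk K (coeff m f) ∈
      IsLocalRing.maximalIdeal (T ⧸ K) := fun m hm => by
    rw [hmap]
    exact Ideal.mem_map_of_mem _ (hsop_coeff m hm)
  have hrad : IsLocalRing.maximalIdeal (T ⧸ K) ≤ (Ideal.span {Ideal.Quotient.mk K (coeff α f),
      Ideal.Quotient.mk K (coeff β f)}).radical := by
    rw [hmap, ← hsop_rad]
    refine (Ideal.map_radical_le _).trans (Ideal.radical_mono ?_)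
    rw [Ideal.map_span, Ideal.span_le]
    rintro _ ⟨_, ⟨m, hm, rfl⟩, rfl⟩
    by_cases hmαβ : m = α ∨ m = β
    · refine Ideal.subset_span ?_
      rcases hmαβ with rfl | rfl <;> simp
    · have : coeff m f ∈ K := Ideal.subset_span (by
        rw [hScoe]
        exact ⟨m, ⟨hm, by simpa using hmαβ⟩, rfl⟩)
      simp [Ideal.Quotient.eq_zero_iff_mem.mpr this]
  obtain ⟨N, j, hj, hnot⟩ := IsLocalRing.exists_pow_mul_notMem_span_pair hdim hrad
    (hmem α hα) (hmem β hβ) s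
  refine hnot ?_
  have h := Ideal.mem_map_of_mem (Ideal.Quotient.mk K) (hs N j hj)
  rwa [Ideal.map_sup, Ideal.map_quotient_self, sup_bot_eq, Ideal.map_span, Set.image_pair,
    map_mul, map_mul, map_pow, map_pow, map_pow, map_pow, map_pow] at h
end
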